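/- Let m ≥ 1, n ≥ 1, D ≥ 1 be integers. There exists k♯ = k♯(m,n,D) and, for each C_w > 0, a constant C depending only on m, n, D, C_w, such that the following holds. Let E ⊆ ℝ^n be finite and let (Γ⃗(x,M))_{x∈E, M>0} be a (C_w, δ_max)-convex vector-valued shape field. Let Q_0 ⊆ ℝ^n be a closed cube of side length δ_{Q_0} ≤ δ_max, let x_0 ∈ E ∩ Q_0, and let M_0 > 0. Suppose that for each S ⊆ E with |S| ≤ k♯ there exists a Whitney field (P⃗^z)_{z∈S} with ‖(P⃗^z)_{z∈S}‖_{Ẇ^m(S)} ≤ M_0 and P⃗^z ∈ Γ⃗(z, M_0) for all z ∈ S. Then there exist P⃗^0 ∈ Γ⃗(x_0, C·M_0) and a C^m function F : Q_0 → ℝ^D such that: J_z F ∈ Γ⃗(z, C·M_0) for all z ∈ E ∩ Q_0; |∂^α(F − P⃗^0)(x)| ≤ C·M_0·δ_{Q_0}^{m−|α|} for all x ∈ Q_0 and |α| ≤ m; in particular |∂^α F(x)| ≤ C·M_0 for all x ∈ Q_0 and |α| = m. -/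

import Mathlib

open scoped BigOperators Classical

noncomputable section

/-- `En n` is Euclidean space `ℝ^n`. -/
abbrev En (n : ℕ) : Type := EuclideanSpace ℝ (Fin n)

/-- First-order partial derivative `∂_i f` in the `i`-th coordinate direction. -/
noncomputable def pd1 {n : ℕ} (i : Fin n) (f : En n → ℝ) : En n → ℝ :=
  fun x => fderiv ℝ f x (EuclideanSpace.single i 1)

/-- Higher-order partial derivative `∂^α f` for a multi-index `α`. -/
noncomputable def pdalpha {n : ℕ} (α : Fin n → ℕ) (f : En n → ℝ) : En n → ℝ :=
  (List.finRange n).foldr (fun i g => (pd1 i)^[α i] g) f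

/-- First-order partial derivative within a set `s`. -/
noncomputable def pd1W {n : ℕ} (s : Set (En n)) (i : Fin n) (f : En n → ℝ) : En n → ℝ :=
  fun x => fderivWithin ℝ f s x (EuclideanSpace.single i 1)

/-- Higher-order partial derivative `∂^α f` within a set `s`. -/
noncomputable def pdalphaW {n : ℕ} (s : Set (En n)) (α : Fin n → ℕ) (f : En n → ℝ) : En n → ℝ :=
  (List.finRange n).foldr (fun i g => (pd1W s i)^[α i] g) f

/-- `∂^α` of a multivariate polynomial (formal derivative). -/
noncomputable def polyPD {n : ℕ} (α : Fin n → ℕ) (p : MvPolynomial (Fin n) ℝ) :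
    MvPolynomial (Fin n) ℝ :=
  (List.finRange n).foldr (fun i q => (fun r => MvPolynomial.pderiv i r)^[α i] q) p

/-- The value `∂^α p (x)` of the `α`-th derivative of a polynomial at `x`. -/
noncomputable def polyPDval {n : ℕ} (α : Fin n → ℕ) (p : MvPolynomial (Fin n) ℝ) (x : En n) : ℝ :=
  MvPolynomial.eval (fun i => x i) (polyPD α p)

/-- The `(m-1)`-jet (Taylor polynomial of degree `≤ m-1`) of `f` at `x`. -/
noncomputable def jetScalar (m : ℕ) {n : ℕ} (f : En n → ℝ) (x : En n) :
    MvPolynomial (Fin n) ℝ :=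
  ∑ α ∈ (Finset.univ : Finset (Fin n → Fin m)).filter (fun α => (∑ i, (α i : ℕ)) ≤ m - 1),
    MvPolynomial.C (pdalpha (fun i => (α i : ℕ)) f x / ((∏ i, Nat.factorial (α i : ℕ) : ℕ) : ℝ))
      * ∏ i, (MvPolynomial.X i - MvPolynomial.C (x i)) ^ ((α i : ℕ))

/-- The `(m-1)`-jet of `f` at `x`, with derivatives taken within a set `s`. -/
noncomputable def jetScalarW (m : ℕ) {n : ℕ} (s : Set (En n)) (f : En n → ℝ) (x : En n) :
    MvPolynomial (Fin n) ℝ :=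
  ∑ α ∈ (Finset.univ : Finset (Fin n → Fin m)).filter (fun α => (∑ i, (α i : ℕ)) ≤ m - 1),
    MvPolynomial.C (pdalphaW s (fun i => (α i : ℕ)) f x / ((∏ i, Nat.factorial (α i : ℕ) : ℕ) : ℝ))
      * ∏ i, (MvPolynomial.X i - MvPolynomial.C (x i)) ^ ((α i : ℕ))

/-- The vector-valued `(m-1)`-jet `J_x F ∈ 𝒫⃗` of `F : ℝ^n → ℝ^D` at `x`. -/
noncomputable def jetD (m : ℕ) {n D : ℕ} (F : En n → Fin D → ℝ) (x : En n) :
    Fin D → MvPolynomial (Fin n) ℝ :=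
  fun j => jetScalar m (fun y => F y j) x

/-- The vector-valued `(m-1)`-jet of `F` at `x`, derivatives within `s`. -/
noncomputable def jetDW (m : ℕ) {n D : ℕ} (s : Set (En n)) (F : En n → Fin D → ℝ) (x : En n) :
    Fin D → MvPolynomial (Fin n) ℝ :=
  fun j => jetScalarW m s (fun y => F y j) x

/-- Truncation of a polynomial to total degree `≤ k`. -/
noncomputable def truncDeg {n : ℕ} (k : ℕ) (p : MvPolynomial (Fin n) ℝ) :
    MvPolynomial (Fin n) ℝ :=
  ∑ s ∈ p.support.filter (fun s => (s.sum fun _ e => e) ≤ k),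
    MvPolynomial.monomial s (MvPolynomial.coeff s p)

/-- The degree-`k` Taylor truncation of a polynomial at `x` (the jet `J_x p` of order `k`). -/
noncomputable def taylorTrunc {n : ℕ} (k : ℕ) (x : En n) (p : MvPolynomial (Fin n) ℝ) :
    MvPolynomial (Fin n) ℝ :=
  MvPolynomial.bind₁ (fun i => MvPolynomial.X i - MvPolynomial.C (x i))
    (truncDeg k (MvPolynomial.bind₁ (fun i => MvPolynomial.X i + MvPolynomial.C (x i)) p))

/-- The ring multiplication `p ⊙_x q := J_x(pq)` on degree-`k` jets at `x`. -/
noncomputable def odot {n : ℕ} (k : ℕ) (x : En n) (p q : MvPolynomial (Fin n) ℝ) :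
    MvPolynomial (Fin n) ℝ :=
  taylorTrunc k x (p * q)

/-- `(Γ x M)_{x ∈ E, M > 0}` is a shape field with jets of degree `≤ k` and `d` components:
each `Γ x M` is a convex set of `d`-tuples of polynomials of degree `≤ k`, monotone in `M`. -/
def IsShapeField {N : ℕ} (k d : ℕ) (E : Finset (En N))
    (Γ : En N → ℝ → Set (Fin d → MvPolynomial (Fin N) ℝ)) : Prop :=
  (∀ x ∈ E, ∀ M : ℝ, 0 < M → Convex ℝ (Γ x M)) ∧
  (∀ x ∈ E, ∀ M : ℝ, 0 < M → ∀ P ∈ Γ x M, ∀ j, (P j).totalDegree ≤ k) ∧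
  (∀ x ∈ E, ∀ M' M : ℝ, 0 < M' → M' ≤ M → Γ x M' ⊆ Γ x M)

/-- `(C_w, δmax)`-convexity of a shape field with jets of degree `≤ k`. -/
def SFConvex {N : ℕ} (k d : ℕ) (E : Finset (En N))
    (Γ : En N → ℝ → Set (Fin d → MvPolynomial (Fin N) ℝ)) (Cw δmax : ℝ) : Prop :=
  ∀ δ : ℝ, 0 < δ → δ ≤ δmax → ∀ x ∈ E, ∀ M : ℝ, 0 < M →
    ∀ P₁ P₂ : Fin d → MvPolynomial (Fin N) ℝ, P₁ ∈ Γ x M → P₂ ∈ Γ x M →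
    ∀ Q₁ Q₂ : MvPolynomial (Fin N) ℝ, Q₁.totalDegree ≤ k → Q₂.totalDegree ≤ k →
    (∀ α : Fin N → ℕ, (∑ i, α i) ≤ k → ∀ j,
      |polyPDval α (P₁ j - P₂ j) x| ≤ M * δ ^ (k + 1 - ∑ i, α i)) →
    (∀ α : Fin N → ℕ, (∑ i, α i) ≤ k →
      |polyPDval α Q₁ x| ≤ δ ^ (-((∑ i, α i : ℕ) : ℤ)) ∧
      |polyPDval α Q₂ x| ≤ δ ^ (-((∑ i, α i : ℕ) : ℤ))) →
    odot k x Q₁ Q₁ + odot k x Q₂ Q₂ = 1 →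
    (fun j => odot k x (odot k x Q₁ Q₁) (P₁ j) + odot k x (odot k x Q₂ Q₂) (P₂ j))
      ∈ Γ x (Cw * M)

/-- `‖(P^x)_{x ∈ S}‖_{Ẇ^m(S)} ≤ M` : the homogeneous Whitney seminorm bound. -/
def WSemiLE (m : ℕ) {N d : ℕ} (S : Finset (En N))
    (P : En N → Fin d → MvPolynomial (Fin N) ℝ) (M : ℝ) : Prop :=
  ∀ x ∈ S, ∀ y ∈ S, x ≠ y → ∀ α : Fin N → ℕ, (∑ i, α i) ≤ m - 1 → ∀ j,
    |polyPDval α (P x j - P y j) x| ≤ M * dist x y ^ (m - ∑ i, α i)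

/-- The homogeneous Whitney seminorm `‖(P^x)_{x ∈ S}‖_{Ẇ^m(S)}`. -/
noncomputable def WNormHomog (m : ℕ) {N d : ℕ} (S : Finset (En N))
    (P : En N → Fin d → MvPolynomial (Fin N) ℝ) : ℝ :=
  sSup {r : ℝ | ∃ x ∈ S, ∃ y ∈ S, x ≠ y ∧ ∃ α : Fin N → ℕ, (∑ i, α i) ≤ m - 1 ∧ ∃ j : Fin d,
    r = |polyPDval α (P x j - P y j) x| / dist x y ^ (m - ∑ i, α i)}

/-- The lower-order part of the Whitney norm. -/
noncomputable def WNormLow (m : ℕ) {N d : ℕ} (S : Finset (En N))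
    (P : En N → Fin d → MvPolynomial (Fin N) ℝ) : ℝ :=
  sSup {r : ℝ | ∃ x ∈ S, ∃ α : Fin N → ℕ, (∑ i, α i) ≤ m - 1 ∧ ∃ j : Fin d,
    r = |polyPDval α (P x j) x|}

/-- The Whitney norm `‖(P^x)_{x ∈ S}‖_{W^m(S)}`. -/
noncomputable def WNormFull (m : ℕ) {N d : ℕ} (S : Finset (En N))
    (P : En N → Fin d → MvPolynomial (Fin N) ℝ) : ℝ :=
  WNormLow m S P + WNormHomog m S P

/-- `‖F‖_{C^m} ≤ M`: all partials of order `≤ m` of all components bounded by `M`. -/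
def CmLE (m : ℕ) {n D : ℕ} (F : En n → Fin D → ℝ) (M : ℝ) : Prop :=
  ∀ α : Fin n → ℕ, (∑ i, α i) ≤ m → ∀ x : En n, ∀ j, |pdalpha α (fun y => F y j) x| ≤ M

/-- `‖F‖_{Ċ^m} ≤ M`: all partials of order `= m` of all components bounded by `M`. -/
def CmHomogLE (m : ℕ) {n D : ℕ} (F : En n → Fin D → ℝ) (M : ℝ) : Prop :=
  ∀ α : Fin n → ℕ, (∑ i, α i) = m → ∀ x : En n, ∀ j, |pdalpha α (fun y => F y j) x| ≤ M

/-- `‖F‖_{C^{m-1,1}} ≤ M`. -/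
def Cm11LE (m : ℕ) {n D : ℕ} (F : En n → Fin D → ℝ) (M : ℝ) : Prop :=
  (∀ α : Fin n → ℕ, (∑ i, α i) ≤ m - 1 → ∀ x : En n, ∀ j,
    |pdalpha α (fun y => F y j) x| ≤ M) ∧
  (∀ α : Fin n → ℕ, (∑ i, α i) = m - 1 → ∀ j, ∀ x y : En n,
    |pdalpha α (fun z => F z j) x - pdalpha α (fun z => F z j) y| ≤ M * dist x y)

/-- A closed cube in `ℝ^n` with lower corner `a` and side length `δ`. -/
def cube {n : ℕ} (a : En n) (δ : ℝ) : Set (En n) := {y | ∀ i, a i ≤ y i ∧ y i ≤ a i + δ}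

/-- The embedding `ℝ^n → ℝ^{n+D}`, `x ↦ (x, 0)`. -/
noncomputable def embed (n D : ℕ) (x : En n) : En (n + D) :=
  (EuclideanSpace.equiv (Fin (n + D)) ℝ).symm
    (Fin.append (fun i : Fin n => x i) (fun _ : Fin D => (0 : ℝ)))

/-- The projection `ℝ^{n+D} → ℝ^n`, `(x, ξ) ↦ x`. -/
noncomputable def projn (n D : ℕ) (z : En (n + D)) : En n :=
  (EuclideanSpace.equiv (Fin n) ℝ).symm (fun i => z (Fin.castAdd D i))

/-- Restriction of a polynomial on `ℝ^{n+D}` to `ℝ^n × {0}`, as a polynomial on `ℝ^n`. -/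
noncomputable def restrict0 (n D : ℕ) (p : MvPolynomial (Fin (n + D)) ℝ) :
    MvPolynomial (Fin n) ℝ :=
  MvPolynomial.aeval
    (Fin.append (fun i : Fin n => (MvPolynomial.X i : MvPolynomial (Fin n) ℝ))
      (fun _ : Fin D => 0)) p


set_option linter.unusedSectionVars false

/-- convex monotone family -/
structure CM {W : Type} [AddCommGroup W] [Module ℝ W] (G : ℝ → Set W) : Prop where
  conv : ∀ K, Convex ℝ (G K)
  mono : ∀ K K', K ≤ K' → G K ⊆ G K'

def Dir {W : Type} [AddCommGroup W] [Module ℝ W] (G : ℝ → Set W) (P : W) (C : ℝ) (Q : W) : Prop :=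
  P + C⁻¹ • Q ∈ G C ∧ P - C⁻¹ • Q ∈ G C

theorem exists_unif {ι : Type} [Finite ι] {P : ι → ℝ → Prop}
    (hmono : ∀ i C C', C ≤ C' → P i C → P i C') (h : ∀ i, ∃ C, P i C) :
    ∃ C, 1 ≤ C ∧ ∀ i, P i C := by
  choose c hc using h
  obtain ⟨M, hM⟩ := (Set.finite_range c).bddAbove
  refine ⟨max 1 M, le_max_left _ _, fun i => hmono i (c i) _ ?_ (hc i)⟩
  exact (hM (Set.mem_range_self i)).trans (le_max_right _ _)

section DirLemmas
variable {W : Type} [AddCommGroup W] [Module ℝ W] {G : ℝ → Set W}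

theorem CM.seg (hG : CM G) {P V : W} {K a b t : ℝ} (h1 : P + a • V ∈ G K) (h2 : P + b • V ∈ G K)
    (hat : a ≤ t) (htb : t ≤ b) : P + t • V ∈ G K := by
  rcases eq_or_lt_of_le (hat.trans htb) with hab | hab
  · have : t = a := by linarith
    rw [this]; exact h1
  · have hba : 0 < b - a := by linarith
    have := hG.conv K h1 h2 (a := (b - t) / (b - a)) (b := (t - a) / (b - a))
      (div_nonneg (by linarith) hba.le) (div_nonneg (by linarith) hba.le)
      (by field_simp; ring)
    convert this using 1
    have e : t = (b - t) / (b - a) * a + (t - a) / (b - a) * b := by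
      field_simp; ring
    have e1 : (1 : ℝ) = (b - t) / (b - a) + (t - a) / (b - a) := by field_simp; ring
    rw [smul_add, smul_add, smul_smul, smul_smul]
    conv_lhs => rw [e, add_smul, ← one_smul ℝ P, e1, add_smul]
    abel

theorem Dir.scale (hG : CM G) {P Q : W} {C C' b : ℝ} (h : Dir G P C Q) (hC : 0 < C)
    (hCC : C ≤ C') (hb : |b| * C ≤ C') : Dir G P C' (b • Q) := by
  have hC' : 0 < C' := lt_of_lt_of_le hC hCC
  have h1 : P + C⁻¹ • Q ∈ G C' := hG.mono _ _ hCC h.1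
  have h2 : P + (-C⁻¹) • Q ∈ G C' := by
    have := hG.mono _ _ hCC h.2
    rwa [sub_eq_add_neg, ← neg_smul] at this
  have hb1 : |C'⁻¹ * b| ≤ C⁻¹ := by
    rw [abs_mul, abs_of_pos (inv_pos.2 hC'), inv_mul_le_iff₀ hC', ← div_eq_mul_inv,
      le_div_iff₀ hC]; exact hb
  have hb2 := abs_le.1 hb1
  constructor
  · rw [smul_smul]; exact hG.seg h2 h1 hb2.1 hb2.2
  · rw [sub_eq_add_neg, ← neg_smul, neg_smul, smul_smul, ← neg_smul]
    exact hG.seg h2 h1 (by linarith) (by linarith)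

theorem Dir.mono (hG : CM G) {P Q : W} {C C' : ℝ} (h : Dir G P C Q) (hC : 0 < C)
    (hCC : C ≤ C') : Dir G P C' Q := by
  have := h.scale hG (b := 1) hC hCC (by simpa using hCC)
  simpa using this

theorem Dir.zero {P : W} {C : ℝ} (h : P ∈ G C) : Dir G P C 0 := by
  constructor <;> simpa using h

theorem Dir.mem (hG : CM G) {P Q : W} {C : ℝ} (h : Dir G P C Q) : P ∈ G C := by
  have := hG.conv C h.1 h.2 (a := 1/2) (b := 1/2) (by norm_num) (by norm_num) (by norm_num)
  convert this using 1
  module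

theorem Dir.add (hG : CM G) {P Q1 Q2 : W} {C1 C2 : ℝ} (h1 : Dir G P C1 Q1) (h2 : Dir G P C2 Q2)
    (hC1 : 0 < C1) (hC2 : 0 < C2) : Dir G P (C1 + C2) (Q1 + Q2) := by
  have m1 := hG.mono C1 (C1 + C2) (by linarith)
  have m2 := hG.mono C2 (C1 + C2) (by linarith)
  have hs : C1 + C2 ≠ 0 := by positivity
  have e : C1 / (C1 + C2) + C2 / (C1 + C2) = 1 := by field_simp
  have e1 : C1 / (C1 + C2) * C1⁻¹ = (C1 + C2)⁻¹ := by field_simp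
  have e2 : C2 / (C1 + C2) * C2⁻¹ = (C1 + C2)⁻¹ := by field_simp
  constructor
  · have := hG.conv _ (m1 h1.1) (m2 h2.1) (a := C1 / (C1 + C2)) (b := C2 / (C1 + C2))
      (by positivity) (by positivity) e
    convert this using 1
    rw [smul_add, smul_add, smul_add, smul_smul, smul_smul, e1, e2]
    conv_lhs => rw [← one_smul ℝ P, ← e, add_smul]
    abel
  · have := hG.conv _ (m1 h1.2) (m2 h2.2) (a := C1 / (C1 + C2)) (b := C2 / (C1 + C2))
      (by positivity) (by positivity) e
    convert this using 1
    rw [smul_sub, smul_sub, smul_add, smul_smul, smul_smul, e1, e2]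
    conv_lhs => rw [← one_smul ℝ P, ← e, add_smul]
    abel

theorem Dir.sum (hG : CM G) {ι : Type} (s : Finset ι) {P : W} (Q : ι → W) (b : ι → ℝ) {C B : ℝ}
    (hP : P ∈ G C) (hQ : ∀ i ∈ s, Dir G P C (Q i)) (hC : 0 < C) (hB : 1 ≤ B)
    (hb : ∀ i ∈ s, |b i| ≤ B) : Dir G P ((s.card + 1) * (B * C)) (∑ i ∈ s, b i • Q i) := by
  have hBC : 0 < B * C := by positivity
  have hle : C ≤ B * C := le_mul_of_one_le_left hC.le hB
  induction s using Finset.induction_on with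
  | empty => 
    have := (Dir.zero (G := G) hP).mono hG hC hle
    simpa using this
  | insert a s ha ih =>
    rw [Finset.sum_insert ha, Finset.card_insert_of_notMem ha]
    have h1 := ih (fun i hi => hQ i (Finset.mem_insert_of_mem hi))
      (fun i hi => hb i (Finset.mem_insert_of_mem hi))
    have h2 := (hQ a (Finset.mem_insert_self _ _)).scale hG (b := b a) (C' := B * C) hC hle
      (by have := hb a (Finset.mem_insert_self _ _); gcongr)
    have := h2.add hG h1 hBC (by positivity)
    convert this using 1
    push_cast; ring

theorem Dir.midpoint (hG : CM G) {P P' Q : W} {K : ℝ} (h : Dir G P K Q) (hP' : P' ∈ G K)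
    (hK : 0 < K) : Dir G ((1/2 : ℝ) • P + (1/2 : ℝ) • P') (2 * K) Q := by
  have m := hG.mono K (2 * K) (by linarith)
  have h1 := hG.conv _ h.1 hP' (a := 1/2) (b := 1/2) (by norm_num) (by norm_num) (by norm_num)
  have h2 := hG.conv _ h.2 hP' (a := 1/2) (b := 1/2) (by norm_num) (by norm_num) (by norm_num)
  have e : (2 * K)⁻¹ = 1/2 * K⁻¹ := by field_simp
  constructor
  · convert m h1 using 1
    rw [e, smul_add, smul_smul]; abel
  · convert m h2 using 1
    rw [e, smul_sub, smul_smul]; abel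

end DirLemmas

section Strong
variable {W : Type} [AddCommGroup W] [Module ℝ W] {I : Type} [Fintype I]

def Strong (G : ℝ → Set W) (u : I → W →ₗ[ℝ] ℝ) (A : Finset I) (P : W) (C : ℝ) : Prop :=
  1 ≤ C ∧ P ∈ G C ∧ ∀ α ∈ A, ∃ Q, Dir G P C Q ∧ u α Q = 1 ∧ (∀ β ∈ A, β ≠ α → u β Q = 0) ∧
    ∀ β, |u β Q| ≤ C

variable {G : ℝ → Set W} {u : I → W →ₗ[ℝ] ℝ}

theorem Strong.mono (hG : CM G) {A : Finset I} {P : W} {C C' : ℝ} (h : Strong G u A P C)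
    (hC : C ≤ C') : Strong G u A P C' := by
  obtain ⟨h1, h2, h3⟩ := h
  refine ⟨h1.trans hC, hG.mono _ _ hC h2, fun α hα => ?_⟩
  obtain ⟨Q, q1, q2, q3, q4⟩ := h3 α hα
  exact ⟨Q, q1.mono hG (by linarith) hC, q2, q3, fun β => (q4 β).trans hC⟩

/-- adding an index -/
theorem Strong.insert (hG : CM G) {A : Finset I} {P Z : W} {C : ℝ} (h : Strong G u A P C)
    {b : I} (hZ : Dir G P C Z) (hZA : ∀ β ∈ A, u β Z = 0) (hZC : ∀ β, |u β Z| ≤ C)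
    (hZb : 1 / 2 ≤ |u b Z|) : Strong G u (insert b A) P (C + 2 * C * C + 2 * C * C * C) := by
  obtain ⟨h1, h2, h3⟩ := h
  have hz : u b Z ≠ 0 := by intro h0; rw [h0] at hZb; norm_num at hZb
  have hinv : |(u b Z)⁻¹| ≤ 2 := by
    rw [abs_inv]; rw [inv_le_comm₀ (abs_pos.2 hz) (by norm_num)]; linarith
  have hbA : b ∉ A := fun hb => hz (hZA b hb)
  have hCC : (1:ℝ) ≤ C * C := by nlinarith
  have hCCC : (1:ℝ) ≤ C * C * C := by nlinarith
  have hCC2 : C ≤ C * C := by nlinarith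
  have hCC3 : C * C ≤ C * C * C := by nlinarith
  set K := C + 2 * C * C + 2 * C * C * C with hK
  refine ⟨by linarith, hG.mono _ _ (by linarith) h2, fun α hα => ?_⟩
  rw [Finset.mem_insert] at hα
  by_cases hαb : α = b
  · subst hαb
    refine ⟨(u α Z)⁻¹ • Z, hZ.scale hG (by linarith) (by linarith) ?_, ?_, ?_, ?_⟩
    · have : |(u α Z)⁻¹| * C ≤ 2 * C := by gcongr
      linarith
    · simp [hz]
    · intro β hβ hne
      rw [Finset.mem_insert] at hβ
      rcases hβ with hβ | hβ
      · exact absurd hβ hne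
      · simp [hZA β hβ]
    · intro β
      rw [map_smul, smul_eq_mul, abs_mul]
      have : |(u α Z)⁻¹| * |u β Z| ≤ 2 * C := by
        apply mul_le_mul hinv (hZC β) (abs_nonneg _) (by norm_num)
      linarith
  · have hαA : α ∈ A := hα.resolve_left hαb
    obtain ⟨Q, q1, q2, q3, q4⟩ := h3 α hαA
    have hs : |-(u b Q * (u b Z)⁻¹)| ≤ 2 * C := by
      rw [abs_neg, abs_mul, mul_comm 2 C]
      exact mul_le_mul (q4 b) hinv (abs_nonneg _) (by linarith)
    refine ⟨Q + (-(u b Q * (u b Z)⁻¹)) • Z, ?_, ?_, ?_, ?_⟩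
    · have hd := hZ.scale hG (C' := 2 * C * C) (b := -(u b Q * (u b Z)⁻¹)) (by linarith)
        (by linarith) (by gcongr)
      exact (q1.add hG hd (by linarith) (by linarith)).mono hG (by linarith) (by linarith)
    · simp [q2, hZA α hαA]
    · intro β hβ hne
      rw [Finset.mem_insert] at hβ
      rcases hβ with hβ | hβ
      · subst hβ; simp; field_simp; simp
      · simp [q3 β hβ hne, hZA β hβ]
    · intro β
      rw [map_add, map_smul, smul_eq_mul]
      refine (abs_add_le _ _).trans ?_
      rw [abs_mul]
      have : |-(u b Q * (u b Z)⁻¹)| * |u β Z| ≤ 2 * C * C :=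
        mul_le_mul hs (hZC β) (abs_nonneg _) (by linarith)
      have := q4 β
      linarith

/-- near identity -/
theorem Strong.ofNear (hG : CM G) {A : Finset I} {P : W} {C : ℝ} (hC : 1 ≤ C) (hP : P ∈ G C)
    (R : I → W) (hD : ∀ α ∈ A, Dir G P C (R α))
    (hn : ∀ α ∈ A, ∀ β ∈ A, |u β (R α) - if α = β then 1 else 0| ≤ 1 / (2 * (A.card + 1)))
    (hb : ∀ α ∈ A, ∀ β, |u β (R α)| ≤ C) :
    Strong G u A P ((A.card + 1) * (2 * C)) := by
  set p : ℝ := (A.card : ℝ) with hp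
  have hp0 : 0 ≤ p := by positivity
  let T : Matrix A A ℝ := fun α β => (if α = β then 1 else 0) - u β (R α)
  have hT : ∀ α β, |T α β| ≤ 1 / (2 * (p + 1)) := by
    intro α β
    have := hn α α.2 β β.2
    rw [abs_sub_comm] at this
    have e : (if α = β then (1:ℝ) else 0) = if (α : I) = β then 1 else 0 := by
      congr 1; exact propext Subtype.ext_iff
    show |(if α = β then (1:ℝ) else 0) - u β (R α)| ≤ _
    rw [e]; exact this
  have hdet : (1 - T).det ≠ 0 := by
    apply det_ne_zero_of_sum_row_lt_diag
    intro k
    have h1 : ∑ j ∈ Finset.univ.erase k, ‖(1 - T) k j‖ ≤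
        ∑ j ∈ Finset.univ.erase k, 1 / (2 * (p + 1)) := by
      apply Finset.sum_le_sum
      intro j hj
      have hne : k ≠ j := fun h => (Finset.ne_of_mem_erase hj) h.symm
      rw [Matrix.sub_apply, Matrix.one_apply_ne hne, zero_sub, norm_neg]
      exact hT k j
    have h2 : ∑ j ∈ Finset.univ.erase k, 1 / (2 * (p + 1)) = (p - 1) * (1 / (2 * (p + 1))) := by
      rw [Finset.sum_const, Finset.card_erase_of_mem (Finset.mem_univ _), nsmul_eq_mul]
      congr 1
      have : 1 ≤ Fintype.card A := Fintype.card_pos_iff.2 ⟨k⟩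
      rw [Finset.card_univ, Nat.cast_sub this]; simp [hp]
    have h3 : 1 - 1 / (2 * (p + 1)) ≤ ‖(1 - T) k k‖ := by
      rw [Matrix.sub_apply, Matrix.one_apply_eq]
      have := abs_le.1 (hT k k)
      exact le_trans (by linarith) (le_abs_self _)
    have h4 : (p - 1) * (1 / (2 * (p + 1))) < 1 - 1 / (2 * (p + 1)) := by
      have : 0 < 2 * (p + 1) := by positivity
      rw [← sub_pos]
      have e : 1 - 1 / (2 * (p + 1)) - (p - 1) * (1 / (2 * (p + 1))) = (p + 2) / (2 * (p + 1)) := by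
        field_simp; ring
      rw [e]; positivity
    linarith
  set N := (1 - T)⁻¹ with hN
  have hN1 : N * (1 - T) = 1 := Matrix.nonsing_inv_mul _ (isUnit_iff_ne_zero.2 hdet)
  have hNT : N = 1 + N * T := by
    rw [mul_sub, mul_one] at hN1; rw [← hN1]; abel
  have hNb : ∀ α β, |N α β| ≤ 2 := by
    by_cases hA : Nonempty (A × A)
    · obtain ⟨⟨a, b⟩, hab⟩ := Finite.exists_max (fun q : A × A => |N q.1 q.2|)
      have h2 : |N a b| ≤ 2 := by
        have h5 : |N a b| ≤ 1 + p * (|N a b| * (1 / (2 * (p + 1)))) := by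
          conv_lhs => rw [hNT]
          rw [Matrix.add_apply]
          refine (abs_add_le _ _).trans (add_le_add ?_ ?_)
          · rw [Matrix.one_apply]; split_ifs <;> simp
          · rw [Matrix.mul_apply]
            refine (Finset.abs_sum_le_sum_abs _ _).trans ?_
            calc ∑ i, |N a i * T i b| ≤ ∑ i : A, |N a b| * (1 / (2 * (p + 1))) := by
                  apply Finset.sum_le_sum
                  intro i _
                  rw [abs_mul]
                  exact mul_le_mul (hab (a, i)) (hT i b) (abs_nonneg _) (abs_nonneg _)
              _ = _ := by rw [Finset.sum_const, Finset.card_univ, Fintype.card_coe, nsmul_eq_mul]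
        have h6 : p * (|N a b| * (1 / (2 * (p + 1)))) ≤ |N a b| * (1/2) := by
          have : p * (1 / (2 * (p + 1))) ≤ 1/2 := by
            rw [mul_one_div, div_le_div_iff₀ (by linarith) two_pos]; linarith
          nlinarith [abs_nonneg (N a b)]
        linarith
      exact fun α β => (hab (α, β)).trans h2
    · intro α β; exact absurd ⟨(α, β)⟩ hA
  refine ⟨by nlinarith, hG.mono _ _ (by nlinarith) hP, fun α hα => ?_⟩
  have hu : ∀ β : A, u β (∑ γ : A, N ⟨α, hα⟩ γ • R γ) = if α = β then 1 else 0 := by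
    intro β
    have := congrFun (congrFun hN1 ⟨α, hα⟩) β
    rw [Matrix.mul_apply, Matrix.one_apply] at this
    rw [map_sum]
    simp only [map_smul, smul_eq_mul]
    have e : (if (⟨α, hα⟩ : A) = β then (1:ℝ) else 0) = if α = β then 1 else 0 := by
      congr 1; exact propext Subtype.ext_iff
    rw [← e, ← this]
    apply Finset.sum_congr rfl
    intro γ _
    rw [Matrix.sub_apply, Matrix.one_apply]
    show _ = _ * (_ - ((if γ = β then (1:ℝ) else 0) - u β (R γ)))
    rw [sub_sub_cancel]
  refine ⟨∑ γ : A, N ⟨α, hα⟩ γ • R γ, ?_, ?_, ?_, ?_⟩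
  · have := Dir.sum hG (Finset.univ : Finset A) (fun γ => R γ) (fun γ => N ⟨α, hα⟩ γ) (B := 2) hP
      (fun γ _ => hD γ γ.2) (by linarith) (by norm_num) (fun γ _ => hNb _ _)
    simpa [hp] using this
  · have := hu ⟨α, hα⟩; simpa using this
  · intro β hβ hne
    have := hu ⟨β, hβ⟩; simpa [hne.symm] using this
  · intro β
    rw [map_sum]
    refine (Finset.abs_sum_le_sum_abs _ _).trans ?_
    calc ∑ γ : A, |u β (N ⟨α, hα⟩ γ • R γ)| ≤ ∑ γ : A, 2 * C := by
          apply Finset.sum_le_sum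
          intro γ _
          rw [map_smul, smul_eq_mul, abs_mul]
          exact mul_le_mul (hNb _ _) (hb γ γ.2 β) (abs_nonneg _) (by norm_num)
      _ = p * (2 * C) := by rw [Finset.sum_const, Finset.card_univ, Fintype.card_coe, nsmul_eq_mul]
      _ ≤ _ := by nlinarith

end Strong

set_option linter.unusedSectionVars false

structure IdxData (I : Type) [Fintype I] (n : ℕ) where
  m : ℕ
  dg : I → ℕ
  w : I → ℕ
  wk : Fin n → ℕ
  sh : Fin n → I → I → Prop
  dg_le : ∀ β, dg β ≤ m
  w_inj : Function.Injective w
  sh_w : ∀ i β γ, sh i β γ → w γ = w β + wk i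
  deg : ∀ (A : Finset I) (f : A → I), ∑ a : A, w a ≤ ∑ a, w (f a) →
    ∑ a : A, dg a ≤ ∑ a, dg (f a)

section Pivot
variable {I : Type} [Fintype I] {n : ℕ} (X : IdxData I n)

theorem pivot_max {A : Finset I} (U : A → I → ℝ) (w : I → ℕ) (Λ : ℝ) (hΛ : 0 < Λ) :
    ∃ f : A → I, ∀ g : A → I,
      |(Matrix.of fun α α' => U α (g α')).det| * Λ ^ (∑ a, w (f a)) ≤
      |(Matrix.of fun α α' => U α (f α')).det| * Λ ^ (∑ a, w (g a)) := by
  have : Nonempty (A → I) := ⟨fun a => a⟩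
  obtain ⟨f, hf⟩ := Finite.exists_max
    (fun g : A → I => |(Matrix.of fun α α' => U α (g α')).det| / Λ ^ (∑ a, w (g a)))
  refine ⟨f, fun g => ?_⟩
  have := hf g
  rwa [div_le_div_iff₀ (by positivity) (by positivity)] at this

theorem pivot_cramer {A : Finset I} (U : A → I → ℝ) (w : I → ℕ) (Λ : ℝ) (hΛ : 0 < Λ) (f : A → I)
    (hf : ∀ g : A → I,
      |(Matrix.of fun α α' => U α (g α')).det| * Λ ^ (∑ a, w (f a)) ≤
      |(Matrix.of fun α α' => U α (f α')).det| * Λ ^ (∑ a, w (g a)))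
    (hdet : (Matrix.of fun α α' => U α (f α')).det ≠ 0) (α : A) (γ : I) :
    |∑ α', (Matrix.of fun α α' => U α (f α'))⁻¹ α α' * U α' γ| * Λ ^ w (f α) ≤ Λ ^ w γ := by
  set M := (Matrix.of fun α α' => U α (f α')) with hM
  have hMinv : M⁻¹ * M = 1 := Matrix.nonsing_inv_mul _ (isUnit_iff_ne_zero.2 hdet)
  have h1 : M.det * (∑ α', M⁻¹ α α' * U α' γ) =
      (Matrix.of fun a a' => U a (Function.update f α γ a')).det := by
    have h2 := Matrix.mulVec_cramer M (fun a => U a γ)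
    have h3 : M.cramer (fun a => U a γ) = M.det • M⁻¹.mulVec (fun a => U a γ) := by
      rw [← Matrix.mulVec_smul, ← h2, Matrix.mulVec_mulVec, hMinv, Matrix.one_mulVec]
    have h4 := congrFun h3 α
    rw [Matrix.cramer_apply] at h4
    rw [Pi.smul_apply, smul_eq_mul] at h4
    change _ = M.det * (∑ α', M⁻¹ α α' * U α' γ) at h4
    rw [← h4]
    congr 1
    ext a a'
    by_cases h : a' = α
    · subst h; simp
    · simp [h, hM]
  have h5 := hf (Function.update f α γ)
  rw [← h1, abs_mul] at h5
  have hW : (∑ a, w (Function.update f α γ a)) + w (f α) = (∑ a, w (f a)) + w γ := by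
    have e1 := Finset.add_sum_erase Finset.univ (fun a => w (f a)) (Finset.mem_univ α)
    have e2 := Finset.add_sum_erase Finset.univ (fun a => w (Function.update f α γ a))
      (Finset.mem_univ α)
    have e3 : ∑ a ∈ Finset.univ.erase α, w (Function.update f α γ a) =
        ∑ a ∈ Finset.univ.erase α, w (f a) := by
      apply Finset.sum_congr rfl
      intro a ha
      rw [Function.update_of_ne (Finset.ne_of_mem_erase ha)]
    rw [← e1, ← e2, e3]; simp only [Function.update_self]; ring
  have hd : 0 < |M.det| := abs_pos.2 hdet
  rw [mul_assoc] at h5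
  have h6 := le_of_mul_le_mul_left h5 hd
  have h7 : Λ ^ (∑ a, w (f a)) * (|∑ α', M⁻¹ α α' * U α' γ| * Λ ^ w (f α)) ≤
      Λ ^ (∑ a, w (f a)) * Λ ^ w γ := by
    rw [← pow_add, ← hW, pow_add]
    calc _ = (|∑ α', M⁻¹ α α' * U α' γ| * Λ ^ (∑ a, w (f a))) * Λ ^ w (f α) := by ring
      _ ≤ _ := by gcongr
  exact le_of_mul_le_mul_left h7 (by positivity)

theorem pivot (A : Finset I) (C : ℝ) (hC : 1 ≤ C) : ∃ K : ℝ, 1 ≤ K ∧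
    ∀ (U : A → I → ℝ) (t : ℝ), 0 < t → t ≤ 1 → (∀ α β, |U α β| ≤ C) →
    (∀ α β : A, U α β = if α = β then 1 else 0) →
    ∃ f : A → I, Function.Injective f ∧ ∑ a, X.w (f a) ≤ ∑ a : A, X.w a ∧
      (∑ a, X.w (f a) = ∑ a : A, X.w a →
        ∀ (α : A) γ, |t ^ X.dg γ / t ^ X.dg α * U α γ| ≤ K) ∧
      ∃ (M : A → A → ℝ) (N : A → I → ℝ), (∀ α α', |M α α'| ≤ K) ∧
        (∀ α γ, N α γ = ∑ α', M α α' * (t ^ X.dg γ / t ^ X.dg α' * U α' γ)) ∧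
        (∀ α α', N α (f α') = if α = α' then 1 else 0) ∧ (∀ α γ, |N α γ| ≤ K) ∧
        ∃ Λ₁ Λ₂ : ℝ, 1 ≤ Λ₁ ∧ Λ₁ * (2 * (A.card + 1)) ≤ Λ₂ ∧
          ∀ α γ, |N α γ| * Λ₁ ^ X.w (f α) ≤ Λ₁ ^ X.w γ ∧
            |N α γ| * Λ₂ ^ X.w (f α) ≤ Λ₂ ^ X.w γ := by
  set p := A.card with hp
  set Kd : ℝ := p.factorial * C ^ p with hKd
  have hKd1 : 1 ≤ Kd := by
    have h1 : (1:ℝ) ≤ p.factorial := by exact_mod_cast Nat.one_le_iff_ne_zero.2 (Nat.factorial_ne_zero p)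
    have h2 : (1:ℝ) ≤ C ^ p := one_le_pow₀ hC
    nlinarith
  set L : ℝ := 2 * (p + 1) * Kd + 1 with hL
  have hp0 : (0:ℝ) ≤ p := by positivity
  have hLp : 2 * ((p:ℝ) + 1) ≤ L := by nlinarith
  have hLK : Kd < L := by nlinarith
  have hL1 : 1 < L := by linarith
  set F := Fintype.card (A → I) with hF
  set Wm := ∑ β, X.w β with hWm
  have hw : ∀ β, X.w β ≤ Wm := fun β =>
    Finset.single_le_sum (f := X.w) (fun _ _ => Nat.zero_le _) (Finset.mem_univ β)
  set K : ℝ := Kd * (L ^ (F + 1)) ^ Wm with hK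
  have hLF : 1 ≤ L ^ (F + 1) := one_le_pow₀ hL1.le
  have hKK : (L ^ (F + 1)) ^ Wm ≤ K := le_mul_of_one_le_left (by positivity) hKd1
  refine ⟨K, ?_, ?_⟩
  · exact (one_le_pow₀ hLF).trans hKK
  intro U t ht ht1 hU hUA
  set U' : A → I → ℝ := fun α γ => t ^ X.dg γ / t ^ X.dg α * U α γ with hU'
  have hU'A : ∀ α β : A, U' α β = if α = β then 1 else 0 := by
    intro α β
    simp only [hU', hUA]
    by_cases h : α = β
    · subst h; rw [if_pos rfl, mul_one, div_self (by positivity)]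
    · simp [h]
  have hdetval : ∀ g : A → I, ∑ a : A, X.w a ≤ ∑ a, X.w (g a) →
      |(Matrix.of fun α α' => U' α (g α')).det| ≤ Kd := by
    intro g hg
    have hdg := X.deg A g hg
    have e : (Matrix.of fun α α' => U' α (g α')).det =
        (∏ a, t ^ X.dg (g a)) * ((∏ a : A, (t ^ X.dg a)⁻¹) *
          (Matrix.of fun α α' => U α (g α')).det) := by
      rw [← Matrix.det_mul_column, ← Matrix.det_mul_row]
      congr 1; ext a b; simp [hU']; ring
    have e2 : (∏ a, t ^ X.dg (g a)) = t ^ (∑ a, X.dg (g a)) := Finset.prod_pow_eq_pow_sum _ _ _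
    have e3 : (∏ a : A, (t ^ X.dg a)⁻¹) = (t ^ (∑ a : A, X.dg a))⁻¹ := by
      rw [Finset.prod_inv_distrib, Finset.prod_pow_eq_pow_sum]
    have hd : |(Matrix.of fun α α' => U α (g α')).det| ≤ Kd := by
      have := Matrix.det_le (abv := AbsoluteValue.abs) (x := C)
        (A := Matrix.of fun α α' => U α (g α')) (fun i j => hU i (g j))
      rw [Fintype.card_coe, nsmul_eq_mul] at this
      exact this
    rw [e, e2, e3, ← mul_assoc, abs_mul]
    have h1 : |t ^ (∑ a, X.dg (g a)) * (t ^ (∑ a : A, X.dg a))⁻¹| ≤ 1 := by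
      rw [abs_of_pos (by positivity), ← div_eq_mul_inv, div_le_one (by positivity)]
      exact pow_le_pow_of_le_one ht.le ht1 hdg
    calc _ ≤ 1 * Kd := mul_le_mul h1 hd (abs_nonneg _) zero_le_one
      _ = Kd := one_mul _
  have hΛpos : ∀ i : ℕ, 0 < L ^ i := fun i => by positivity
  choose f hf using fun i : Fin (F + 1) => pivot_max U' X.w (L ^ (i.1 + 1)) (hΛpos _)
  obtain ⟨i, j, hij, hfij⟩ := Fintype.exists_ne_map_eq_of_card_lt f (by simp [hF])
  have hid : (Matrix.of fun α α' : A => U' α (α' : I)).det = 1 := by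
    have : (Matrix.of fun α α' : A => U' α (α' : I)) = 1 := by
      ext a b; rw [Matrix.of_apply, hU'A, Matrix.one_apply]
    rw [this, Matrix.det_one]
  have key : ∀ a b : Fin (F + 1), a < b → f a = f b → ∃ f : A → I, Function.Injective f ∧ ∑ a, X.w (f a) ≤ ∑ a : A, X.w a ∧
      (∑ a, X.w (f a) = ∑ a : A, X.w a →
        ∀ (α : A) γ, |t ^ X.dg γ / t ^ X.dg α * U α γ| ≤ K) ∧
      ∃ (M : A → A → ℝ) (N : A → I → ℝ), (∀ α α', |M α α'| ≤ K) ∧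
        (∀ α γ, N α γ = ∑ α', M α α' * (t ^ X.dg γ / t ^ X.dg α' * U α' γ)) ∧
        (∀ α α', N α (f α') = if α = α' then 1 else 0) ∧ (∀ α γ, |N α γ| ≤ K) ∧
        ∃ Λ₁ Λ₂ : ℝ, 1 ≤ Λ₁ ∧ Λ₁ * (2 * (p + 1)) ≤ Λ₂ ∧
          ∀ α γ, |N α γ| * Λ₁ ^ X.w (f α) ≤ Λ₁ ^ X.w γ ∧
            |N α γ| * Λ₂ ^ X.w (f α) ≤ Λ₂ ^ X.w γ := by
    intro a b hab hfab
    set Λ := L ^ (a.1 + 1) with hΛ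
    have hΛ1 : L ≤ Λ := by
      rw [hΛ, pow_succ]; exact le_mul_of_one_le_left (by linarith) (one_le_pow₀ hL1.le)
    have hΛm : Λ ≤ L ^ (F + 1) := by
      apply pow_le_pow_right₀ hL1.le; omega
    have hΛ0 : 0 < Λ := hΛpos _
    have hΛ1' : 1 ≤ Λ := by linarith
    have hfa := hf a
    have hfb := hf b
    rw [← hfab] at hfb
    set g := f a with hg
    have h0 := hfa (fun x => (x : I))
    rw [hid, abs_one, one_mul] at h0
    have hdet : (Matrix.of fun α α' => U' α (g α')).det ≠ 0 := by
      intro h; rw [h, abs_zero, zero_mul] at h0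
      have : 0 < Λ ^ (∑ a, X.w (g a)) := by positivity
      linarith
    have hWle : ∑ a, X.w (g a) ≤ ∑ a : A, X.w a := by
      by_contra hcon
      push Not at hcon
      have h1 := hdetval g hcon.le
      obtain ⟨c, hc⟩ := Nat.exists_eq_add_of_lt hcon
      rw [hc, add_assoc, pow_add, mul_comm] at h0
      have h2 := le_of_mul_le_mul_right h0 (by positivity)
      have h3 : Λ ≤ Λ ^ (c + 1) := by
        rw [pow_succ]; exact le_mul_of_one_le_left hΛ0.le (one_le_pow₀ hΛ1')
      linarith
    have hNa := pivot_cramer U' X.w Λ hΛ0 g hfa hdet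
    have hNb := pivot_cramer U' X.w _ (hΛpos (b.1 + 1)) g hfb hdet
    have hNK : ∀ α γ, |∑ α', (Matrix.of fun α α' => U' α (g α'))⁻¹ α α' * U' α' γ| ≤ K := by
      intro α γ
      calc |∑ α', (Matrix.of fun α α' => U' α (g α'))⁻¹ α α' * U' α' γ| ≤
          |∑ α', (Matrix.of fun α α' => U' α (g α'))⁻¹ α α' * U' α' γ| * Λ ^ X.w (g α) :=
            le_mul_of_one_le_right (abs_nonneg _) (one_le_pow₀ hΛ1')
        _ ≤ Λ ^ X.w γ := hNa α γ
        _ ≤ (L ^ (F + 1)) ^ X.w γ := by gcongr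
        _ ≤ (L ^ (F + 1)) ^ Wm := pow_le_pow_right₀ hLF (hw γ)
        _ ≤ K := hKK
    have hdel : ∀ α α', ∑ a', (Matrix.of fun α α' => U' α (g α'))⁻¹ α a' * U' a' (g α') =
        if α = α' then 1 else 0 := by
      intro α α'
      have := Matrix.nonsing_inv_mul (Matrix.of fun α α' => U' α (g α')) (isUnit_iff_ne_zero.2 hdet)
      have := congrFun (congrFun this α) α'
      rw [Matrix.mul_apply, Matrix.one_apply] at this
      exact this
    refine ⟨g, ?_, hWle, ?_, fun α α' => (Matrix.of fun α α' => U' α (g α'))⁻¹ α α',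
      fun α γ => ∑ α', (Matrix.of fun α α' => U' α (g α'))⁻¹ α α' * U' α' γ, ?_, ?_, ?_, hNK,
      Λ, L ^ (b.1 + 1), hΛ1', ?_, fun α γ => ⟨hNa α γ, hNb α γ⟩⟩
    · intro x y hxy
      by_contra hne
      exact hdet (Matrix.det_zero_of_column_eq hne (fun k => by simp [hxy]))
    · intro hWeq α γ
      have hu := hdetval g hWeq.ge
      have h1 := hfa (Function.update (fun x => (x : I)) α γ)
      have hdd : (Matrix.of fun a a' => U' a (Function.update (fun x : A => (x : I)) α γ a')).det =
          U' α γ := by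
        have h2 := Matrix.cramer_apply (1 : Matrix A A ℝ) (fun a => U' a γ) α
        rw [Matrix.cramer_one] at h2
        simp only [Module.End.one_apply] at h2
        rw [h2]
        congr 1
        ext a a'
        by_cases h : a' = α
        · subst h; simp
        · simp only [Matrix.of_apply, Function.update_of_ne h, hU'A]
          rw [Matrix.updateCol_ne h, Matrix.one_apply]
      rw [hdd] at h1
      have hWu : (∑ a, X.w (Function.update (fun x : A => (x : I)) α γ a)) ≤
          (∑ a : A, X.w a) + X.w γ := by
        have e1 := Finset.add_sum_erase Finset.univ (fun a : A => X.w a) (Finset.mem_univ α)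
        have e2 := Finset.add_sum_erase Finset.univ
          (fun a => X.w (Function.update (fun x : A => (x : I)) α γ a)) (Finset.mem_univ α)
        have e3 : ∑ a ∈ Finset.univ.erase α, X.w (Function.update (fun x : A => (x : I)) α γ a) =
            ∑ a ∈ Finset.univ.erase α, X.w a := by
          apply Finset.sum_congr rfl
          intro a ha
          rw [Function.update_of_ne (Finset.ne_of_mem_erase ha)]
        rw [← e1, ← e2, e3]; simp only [Function.update_self]; omega
      have h3 : |U' α γ| * Λ ^ (∑ a, X.w (g a)) ≤ (Kd * Λ ^ X.w γ) * Λ ^ (∑ a, X.w (g a)) := by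
        refine h1.trans ?_
        rw [mul_assoc, ← pow_add]
        refine mul_le_mul hu (pow_le_pow_right₀ hΛ1' ?_) (by positivity) (by linarith)
        rw [hWeq]; omega
      have h4 := le_of_mul_le_mul_right h3 (by positivity)
      refine h4.trans ?_
      rw [hK]
      gcongr
      calc Λ ^ X.w γ ≤ (L ^ (F + 1)) ^ X.w γ := by gcongr
        _ ≤ (L ^ (F + 1)) ^ Wm := pow_le_pow_right₀ hLF (hw γ)
    · intro α α'
      have h1 := hNK α α'
      have h2 : ∑ a', (Matrix.of fun α α' => U' α (g α'))⁻¹ α a' * U' a' α' =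
          (Matrix.of fun α α' => U' α (g α'))⁻¹ α α' := by
        simp_rw [hU'A]
        simp
      rwa [h2] at h1
    · intro α γ; rfl
    · exact hdel
    · have : a.1 + 1 + 1 ≤ b.1 + 1 := by have : a.1 < b.1 := hab; omega
      calc Λ * (2 * (p + 1)) ≤ Λ * L := by gcongr
        _ = L ^ (a.1 + 1 + 1) := by rw [hΛ, pow_succ L (a.1+1)]
        _ ≤ _ := pow_le_pow_right₀ hL1.le this
  rcases lt_or_gt_of_ne hij with h | h
  · exact key i j h hfij
  · exact key j i h hfij.symm

end Pivot

section Relabel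
variable {I : Type} [Fintype I] {n : ℕ} 

def IdxData.Mono (X : IdxData I n) (A : Finset I) : Prop :=
  ∀ i β γ, X.sh i β γ → β ∈ A → γ ∈ A

def IdxData.rank (X : IdxData I n) (A : Finset I) : ℕ :=
  (Fintype.card I - A.card) * (∑ β, X.w β + 1) + ∑ β ∈ A, X.w β

theorem IdxData.rank_lt (X : IdxData I n) {A B : Finset I} (h : A.card < B.card) :
    X.rank B < X.rank A := by
  unfold IdxData.rank
  have hB : B.card ≤ Fintype.card I := Finset.card_le_univ B
  have h1 : ∑ β ∈ B, X.w β ≤ ∑ β, X.w β := 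
    Finset.sum_le_sum_of_subset (Finset.subset_univ B)
  obtain ⟨c, hc⟩ := Nat.exists_eq_add_of_lt h
  obtain ⟨d, hd⟩ := Nat.exists_eq_add_of_le hB
  have e1 : Fintype.card I - B.card = d := by omega
  have e2 : Fintype.card I - A.card = d + (c + 1) := by omega
  rw [e1, e2]
  have : (d + (c + 1)) * (∑ β, X.w β + 1) = d * (∑ β, X.w β + 1) + (∑ β, X.w β + 1)
    + c * (∑ β, X.w β + 1) := by ring
  rw [this]
  omega

variable {W : Type} [AddCommGroup W] [Module ℝ W]

structure MultAt (X : IdxData I n) (G : ℝ → Set W) (u : I → W →ₗ[ℝ] ℝ) (T : Fin n → W →ₗ[ℝ] W)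
    (Cm : ℝ) : Prop where
  sh_eq : ∀ i β γ, X.sh i β γ → ∀ Q, u γ (T i Q) = u β Q
  sh_zero : ∀ i γ, (∀ β, ¬ X.sh i β γ) → ∀ Q, u γ (T i Q) = 0
  mul : ∀ i P Q K, 1 ≤ K → P + Q ∈ G K → P - Q ∈ G K → (∀ β, |u β Q| ≤ K) →
    P + T i Q ∈ G (Cm * K) ∧ P - T i Q ∈ G (Cm * K)

theorem Dir.of_smul {G : ℝ → Set W} (hG : CM G) {P V : W} {K s : ℝ} (h1 : P + s • V ∈ G K) (h2 : P - s • V ∈ G K)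
    (hK : 0 < K) (hs : K⁻¹ ≤ s) : Dir G P K V := by
  have hK' : 0 < K⁻¹ := inv_pos.2 hK
  have h2' : P + (-s) • V ∈ G K := by rwa [neg_smul, ← sub_eq_add_neg]
  constructor
  · exact hG.seg h2' h1 (by linarith) hs
  · rw [sub_eq_add_neg, ← neg_smul]
    exact hG.seg h2' h1 (by linarith) (by linarith)

theorem two_lam {a b Λ₁ Λ₂ q : ℝ} {s t : ℕ} (hst : s ≠ t) (ha : 0 ≤ a) (hb : 0 ≤ b)
    (h1 : 1 ≤ Λ₁) (hq : 1 ≤ q) (h12 : Λ₁ * q ≤ Λ₂)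
    (ha1 : a * Λ₁ ^ t ≤ Λ₁ ^ s) (ha2 : a * Λ₂ ^ t ≤ Λ₂ ^ s)
    (hb1 : b * Λ₁ ^ s ≤ Λ₁ ^ t) (hb2 : b * Λ₂ ^ s ≤ Λ₂ ^ t) : a * b * q ≤ 1 := by
  have h0 : 0 < Λ₁ := by linarith
  have h02 : 0 < Λ₂ := lt_of_lt_of_le (by positivity) h12
  have main : ∀ (a b : ℝ) (s t : ℕ), 0 ≤ a → 0 ≤ b → s < t → a * Λ₂ ^ t ≤ Λ₂ ^ s →
      b * Λ₁ ^ s ≤ Λ₁ ^ t → a * b * q ≤ 1 := by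
    intro a b s t ha hb hst h3 h4
    obtain ⟨c, hc⟩ := Nat.exists_eq_add_of_lt hst
    rw [hc, add_assoc, pow_add, mul_comm (Λ₂ ^ s), ← mul_assoc] at h3
    have h3' : a * Λ₂ ^ (c + 1) ≤ 1 := by
      have : a * Λ₂ ^ (c + 1) * Λ₂ ^ s ≤ 1 * Λ₂ ^ s := by linarith
      exact le_of_mul_le_mul_right this (by positivity)
    rw [hc, add_assoc, pow_add, mul_comm] at h4
    have h4' : b ≤ Λ₁ ^ (c + 1) := le_of_mul_le_mul_left h4 (by positivity)
    have h5 : (Λ₁ * q) ^ (c + 1) ≤ Λ₂ ^ (c + 1) := by gcongr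
    have h6 : q ≤ q ^ (c + 1) := by
      rw [pow_succ]; exact le_mul_of_one_le_left (by linarith) (one_le_pow₀ hq)
    calc a * b * q ≤ a * Λ₁ ^ (c + 1) * q ^ (c + 1) := by gcongr
      _ = a * (Λ₁ * q) ^ (c + 1) := by rw [mul_pow]; ring
      _ ≤ a * Λ₂ ^ (c + 1) := by gcongr
      _ ≤ 1 := h3'
  rcases lt_or_gt_of_ne hst with h | h
  · exact main a b s t ha hb h ha2 hb1
  · rw [mul_comm a b]; exact main b a t s hb ha h hb2 ha1

set_option maxHeartbeats 1000000 in
theorem relabelStep (X : IdxData I n) (A : Finset I) (C Cm : ℝ) (hC : 1 ≤ C) (hCm : 1 ≤ Cm) :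
    ∃ C', 1 ≤ C' ∧ ∀ (G : ℝ → Set W) (u0 u : I → W →ₗ[ℝ] ℝ) (T : Fin n → W →ₗ[ℝ] W) (P : W) (t : ℝ),
      CM G → 0 < t → t ≤ 1 → (∀ β Q, u β Q = (t ^ (X.m - X.dg β))⁻¹ * u0 β Q) →
      MultAt X G u T Cm → Strong G u0 A P C →
      (∃ A', X.Mono A' ∧ X.rank A' ≤ X.rank A ∧ (X.rank A' = X.rank A → Strong G u A P C') ∧
        Strong G u A' P C') ∨ (∃ A' : Finset I, A.card < A'.card ∧ Strong G u A' P C') := by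
  obtain ⟨K, hK1, hK⟩ := pivot X A C hC
  set p : ℝ := (A.card : ℝ) with hp
  have hp0 : 0 ≤ p := by positivity
  set K1 : ℝ := (p + 1) * (K * C) with hK1d
  have hKC : K ≤ K * C := le_mul_of_one_le_right (by linarith) hC
  have hCK : C ≤ K * C := le_mul_of_one_le_left (by linarith) hK1
  have hKK1 : K * C ≤ K1 := by rw [hK1d]; nlinarith
  have hK11 : 1 ≤ K1 := by linarith
  set K2 : ℝ := Cm * K1 + (p + 1) * (K * K1) with hK2d
  have hCmK : K1 ≤ Cm * K1 := le_mul_of_one_le_left (by linarith) hCm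
  have hKKK : K1 ≤ K * K1 := le_mul_of_one_le_left (by linarith) hK1
  have hCmK0 : 0 < Cm * K1 := by linarith
  have hpK0 : 0 < (p + 1) * (K * K1) := mul_pos (by linarith) (by linarith)
  have hK1K2 : K1 ≤ K2 := by rw [hK2d]; nlinarith
  set C' : ℝ := K2 + 2 * K2 * K2 + 2 * K2 * K2 * K2 with hC'
  have hK21 : 1 ≤ K2 := by linarith
  have hK2C' : K2 ≤ C' := by
    have : 0 ≤ 2 * K2 * K2 := by positivity
    have : 0 ≤ 2 * K2 * K2 * K2 := by positivity
    linarith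
  refine ⟨C', by linarith, ?_⟩
  intro G u0 u T P t hG ht ht1 hu hT hS
  obtain ⟨-, hP, hQ⟩ := hS
  choose! Q0 q1 q2 q3 q4 using hQ
  obtain ⟨f, finj, hfw, hfeq, M, N, hM, hN, hNf, hNK, Λ₁, Λ₂, hΛ1, hΛ2, hΛ⟩ :=
    hK (fun α β => u0 β (Q0 α)) t ht ht1 (fun α β => q4 α α.2 β) (by
      intro α β
      by_cases h : α = β
      · subst h; rw [if_pos rfl]; exact q2 α α.2
      · rw [if_neg h]; exact q3 α α.2 β β.2 (fun h' => h (Subtype.ext h'.symm)))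
  -- rescaled vectors
  set Q1 : A → W := fun α => t ^ (X.m - X.dg α) • Q0 α with hQ1
  have hQ1D : ∀ α, Dir G P C (Q1 α) := by
    intro α
    refine (q1 α α.2).scale hG (by linarith) le_rfl ?_
    rw [abs_of_pos (by positivity)]
    exact mul_le_of_le_one_left (by linarith) (pow_le_one₀ ht.le ht1)
  have hQ1u : ∀ (α : A) γ, u γ (Q1 α) = t ^ X.dg γ / t ^ X.dg α * u0 γ (Q0 α) := by
    intro α γ
    rw [hu, hQ1, map_smul, smul_eq_mul, ← mul_assoc]
    congr 1
    have e1 : t ^ (X.m - X.dg γ) * t ^ X.dg γ = t ^ X.m := by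
      rw [← pow_add, Nat.sub_add_cancel (X.dg_le γ)]
    have e2 : t ^ (X.m - X.dg α) * t ^ X.dg α = t ^ X.m := by
      rw [← pow_add, Nat.sub_add_cancel (X.dg_le α)]
    rw [inv_mul_eq_div, div_eq_div_iff (by positivity) (by positivity), e2, mul_comm, e1]
  set Q2 : A → W := fun α => ∑ α', M α α' • Q1 α' with hQ2
  have hQ2u : ∀ α γ, u γ (Q2 α) = N α γ := by
    intro α γ
    rw [hN, hQ2, map_sum]
    apply Finset.sum_congr rfl
    intro α' _
    rw [map_smul, smul_eq_mul, hQ1u]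
  have hQ2D : ∀ α, Dir G P K1 (Q2 α) := by
    intro α
    have := Dir.sum hG (Finset.univ : Finset A) Q1 (M α) (B := K) hP (fun γ _ => hQ1D γ)
      (by linarith) hK1 (fun γ _ => hM α γ)
    rwa [Finset.card_univ, Fintype.card_coe] at this
  have hP1 : P ∈ G K1 := hG.mono _ _ (by linarith) hP
  set B : Finset I := Finset.univ.image f with hB
  have hBcard : B.card = A.card := by
    rw [hB, Finset.card_image_of_injective _ finj, Finset.card_univ, Fintype.card_coe]
  have hBS : Strong G u B P K1 := by
    refine ⟨hK11, hP1, ?_⟩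
    intro β hβ
    rw [hB, Finset.mem_image] at hβ
    obtain ⟨α, -, rfl⟩ := hβ
    refine ⟨Q2 α, hQ2D α, ?_, ?_, ?_⟩
    · rw [hQ2u, hNf, if_pos rfl]
    · intro β hβ hne
      rw [hB, Finset.mem_image] at hβ
      obtain ⟨α', -, rfl⟩ := hβ
      rw [hQ2u, hNf, if_neg (fun h => hne (by rw [h]))]
    · intro β; rw [hQ2u]; linarith [hNK α β]
  have hrB : X.rank B = (Fintype.card I - A.card) * (∑ β, X.w β + 1) + ∑ a, X.w (f a) := by
    unfold IdxData.rank
    rw [hBcard, hB, Finset.sum_image (fun x _ y _ h => finj h)]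
  have hrA : X.rank A = (Fintype.card I - A.card) * (∑ β, X.w β + 1) + ∑ a : A, X.w a := by
    unfold IdxData.rank
    rw [Finset.sum_coe_sort A X.w]
  by_cases hmono : X.Mono B
  · left
    refine ⟨B, hmono, by rw [hrB, hrA]; omega, ?_, hBS.mono hG (by linarith)⟩
    intro hr
    have hw : ∑ a, X.w (f a) = ∑ a : A, X.w a := by rw [hrB, hrA] at hr; omega
    refine ⟨by linarith, hG.mono _ _ (by linarith) hP, ?_⟩
    intro α hα
    refine ⟨Q1 ⟨α, hα⟩, (hQ1D _).mono hG (by linarith) (by linarith), ?_, ?_, ?_⟩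
    · rw [hQ1u, q2 α hα, div_self (by positivity), one_mul]
    · intro β hβ hne
      rw [hQ1u, q3 α hα β hβ hne, mul_zero]
    · intro β
      rw [hQ1u]
      have := hfeq hw ⟨α, hα⟩ β
      linarith
  · right
    unfold IdxData.Mono at hmono
    push Not at hmono
    obtain ⟨i, β, γ, hsh, hβ, hγ⟩ := hmono
    rw [hB, Finset.mem_image] at hβ
    obtain ⟨α, -, rfl⟩ := hβ
    set Z := T i (Q2 α) with hZ
    have hwγ := X.sh_w i _ _ hsh
    have hZb : ∀ δ, |u δ Z| ≤ K ∧ |u δ Z| * Λ₁ ^ X.w γ ≤ Λ₁ ^ X.w δ ∧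
        |u δ Z| * Λ₂ ^ X.w γ ≤ Λ₂ ^ X.w δ := by
      intro δ
      have hΛ2' : 0 < Λ₂ := lt_of_lt_of_le (by positivity) hΛ2
      by_cases h : ∃ ε, X.sh i ε δ
      · obtain ⟨ε, hε⟩ := h
        rw [hZ, hT.sh_eq i ε δ hε, hQ2u, hwγ, X.sh_w i _ _ hε]
        refine ⟨hNK _ _, ?_, ?_⟩
        · rw [pow_add, pow_add, ← mul_assoc]
          gcongr
          exact (hΛ α ε).1
        · rw [pow_add, pow_add, ← mul_assoc]
          gcongr
          exact (hΛ α ε).2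
      · push Not at h
        rw [hZ, hT.sh_zero i δ h]
        simp only [abs_zero, zero_mul]
        exact ⟨by linarith, by positivity, by positivity⟩
    have hZ1 : u γ Z = 1 := by
      rw [hZ, hT.sh_eq i _ _ hsh, hQ2u, hNf, if_pos rfl]
    have hZD : Dir G P (Cm * K1) Z := by
      have h1 := hT.mul i P (K1⁻¹ • Q2 α) K1 hK11 (hQ2D α).1 (hQ2D α).2 (by
        intro β
        rw [map_smul, smul_eq_mul, abs_mul, hQ2u, abs_of_pos (by positivity)]
        have h3 : K1⁻¹ ≤ 1 := inv_le_one_of_one_le₀ hK11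
        have := hNK α β
        calc K1⁻¹ * |N α β| ≤ 1 * |N α β| := by gcongr
          _ ≤ K1 := by linarith)
      rw [map_smul] at h1
      refine Dir.of_smul hG h1.1 h1.2 hCmK0 ?_
      exact inv_anti₀ (by linarith) hCmK
    set Z' := Z + ∑ α' : A, (- u (f α') Z) • Q2 α' with hZ'
    have hZ'D : Dir G P K2 Z' := by
      have h1 := Dir.sum hG (Finset.univ : Finset A) Q2 (fun α' => - u (f α') Z) (B := K) hP1
        (fun γ _ => hQ2D γ) (by linarith) hK1 (fun γ _ => by rw [abs_neg]; exact (hZb _).1)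
      rw [Finset.card_univ, Fintype.card_coe] at h1
      exact hZD.add hG h1 hCmK0 hpK0
    have hZ'u : ∀ δ, u δ Z' = u δ Z + ∑ α' : A, (- u (f α') Z) * N α' δ := by
      intro δ
      rw [hZ', map_add, map_sum]
      simp only [map_smul, smul_eq_mul, hQ2u]
    refine ⟨insert γ B, ?_, ?_⟩
    · rw [Finset.card_insert_of_notMem hγ, hBcard]; omega
    · refine (hBS.mono hG hK1K2).insert hG hZ'D ?_ ?_ ?_
      · intro β hβ
        rw [hB, Finset.mem_image] at hβ
        obtain ⟨α', -, rfl⟩ := hβ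
        rw [hZ'u]
        simp_rw [hNf]
        simp
      · intro β
        rw [hZ'u]
        refine (abs_add_le _ _).trans ?_
        have h1 : |∑ α' : A, (- u (f α') Z) * N α' β| ≤ p * (K * K) := by
          refine (Finset.abs_sum_le_sum_abs _ _).trans ?_
          calc ∑ α' : A, |(- u (f α') Z) * N α' β| ≤ ∑ α' : A, K * K := by
                apply Finset.sum_le_sum
                intro α' _
                rw [abs_mul, abs_neg]
                exact mul_le_mul (hZb _).1 (hNK _ _) (abs_nonneg _) (by linarith)
            _ = p * (K * K) := by
              rw [Finset.sum_const, Finset.card_univ, Fintype.card_coe, nsmul_eq_mul]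
        have h2 := (hZb β).1
        have h3 : p * (K * K) ≤ (p + 1) * (K * K1) := by
          gcongr <;> linarith
        linarith
      · rw [hZ'u, hZ1]
        have h1 : |∑ α' : A, (- u (f α') Z) * N α' γ| ≤ 1 / 2 := by
          refine (Finset.abs_sum_le_sum_abs _ _).trans ?_
          calc ∑ α' : A, |(- u (f α') Z) * N α' γ| ≤ ∑ α' : A, (2 * (p + 1))⁻¹ := by
                apply Finset.sum_le_sum
                intro α' _
                rw [abs_mul, abs_neg, ← one_div, le_div_iff₀ (by positivity)]
                have hne : X.w (f α') ≠ X.w γ := by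
                  intro h
                  apply hγ
                  rw [← X.w_inj h, hB]
                  exact Finset.mem_image_of_mem _ (Finset.mem_univ _)
                exact two_lam hne (abs_nonneg _) (abs_nonneg _) hΛ1 (by linarith) hΛ2
                  (hZb _).2.1 (hZb _).2.2 (hΛ α' γ).1 (hΛ α' γ).2
            _ = p * (2 * (p + 1))⁻¹ := by
              rw [Finset.sum_const, Finset.card_univ, Fintype.card_coe, nsmul_eq_mul]
            _ ≤ 1 / 2 := by
              rw [← div_eq_mul_inv, div_le_div_iff₀ (by positivity) (by norm_num)]; linarith
        have h2 := abs_le.1 h1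
        exact le_trans (by linarith) (le_abs_self _)

theorem relabel (X : IdxData I n) (A : Finset I) (C Cm : ℝ) (hC : 1 ≤ C) (hCm : 1 ≤ Cm) :
    ∃ C', 1 ≤ C' ∧ ∀ (G : ℝ → Set W) (u0 u : I → W →ₗ[ℝ] ℝ) (T : Fin n → W →ₗ[ℝ] W) (P : W) (t : ℝ),
      CM G → 0 < t → t ≤ 1 → (∀ β Q, u β Q = (t ^ (X.m - X.dg β))⁻¹ * u0 β Q) →
      MultAt X G u T Cm → Strong G u0 A P C →
      ∃ A', X.Mono A' ∧ X.rank A' ≤ X.rank A ∧ (X.rank A' = X.rank A → Strong G u A P C') ∧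
        Strong G u A' P C' := by
  induction hk : Fintype.card I - A.card using Nat.strong_induction_on generalizing A C with
  | _ k ih =>
  obtain ⟨C1, hC1, hstep⟩ := relabelStep (W := W) X A C Cm hC hCm
  have hall : ∃ C2, 1 ≤ C2 ∧ ∀ B : Finset I, A.card < B.card → 
      ∀ (G : ℝ → Set W) (u0 u : I → W →ₗ[ℝ] ℝ) (T : Fin n → W →ₗ[ℝ] W) (P : W) (t : ℝ),
      CM G → 0 < t → t ≤ 1 → (∀ β Q, u β Q = (t ^ (X.m - X.dg β))⁻¹ * u0 β Q) →
      MultAt X G u T Cm → Strong G u0 B P C1 →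
      ∃ A', X.Mono A' ∧ X.rank A' ≤ X.rank B ∧ (X.rank A' = X.rank B → Strong G u B P C2) ∧
        Strong G u A' P C2 := by
    apply exists_unif
    · intro B C2 C3 h23 h hAB G u0 u T P t hG ht ht1 hu hT hS
      obtain ⟨A', h1, h2, h3, h4⟩ := h hAB G u0 u T P t hG ht ht1 hu hT hS
      exact ⟨A', h1, h2, fun h => (h3 h).mono hG h23, h4.mono hG h23⟩
    · intro B
      by_cases hAB : A.card < B.card
      · have hBc : B.card ≤ Fintype.card I := Finset.card_le_univ B
        obtain ⟨C2, -, h⟩ := ih _ (by omega) B C1 hC1 rfl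
        exact ⟨C2, fun _ => h⟩
      · exact ⟨1, fun h => absurd h hAB⟩
  obtain ⟨C2, hC2, hB⟩ := hall
  refine ⟨max C1 C2, le_max_of_le_left hC1, ?_⟩
  intro G u0 u T P t hG ht ht1 hu hT hS
  rcases hstep G u0 u T P t hG ht ht1 hu hT hS with ⟨A', h1, h2, h3, h4⟩ | ⟨B, hAB, hBS⟩
  · exact ⟨A', h1, h2, fun h => (h3 h).mono hG (le_max_left _ _), h4.mono hG (le_max_left _ _)⟩
  · obtain ⟨A', h1, h2, h3, h4⟩ := hB B hAB G u u T P 1 hG one_pos le_rfl (by simp) hT hBS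
    have hr := X.rank_lt hAB
    exact ⟨A', h1, by omega, fun h => by omega, h4.mono hG (le_max_right _ _)⟩

/-- Lemma D -/
theorem dichotomy (X : IdxData I n) (A : Finset I) (C Cm : ℝ) (hC : 1 ≤ C) (hCm : 1 ≤ Cm) :
    ∃ C1, 1 ≤ C1 ∧ ∀ C2, 1 ≤ C2 → ∃ C3, 1 ≤ C3 ∧
      ∀ (G : ℝ → Set W) (u0 u : I → W →ₗ[ℝ] ℝ) (T : Fin n → W →ₗ[ℝ] W) (P : W) (t : ℝ),
      CM G → 0 < t → t ≤ 1 → (∀ β Q, u β Q = (t ^ (X.m - X.dg β))⁻¹ * u0 β Q) →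
      MultAt X G u T Cm → Strong G u0 A P C →
      (∃ A' P', X.Mono A' ∧ X.rank A' < X.rank A ∧ (∀ α ∈ A, u α (P' - P) = 0) ∧
        (∀ β, |u β (P' - P)| ≤ 1) ∧ Strong G u A' P' C3) ∨
      (Strong G u A P C1 ∧ ∀ P' ∈ G C2, (∀ α ∈ A, u α (P' - P) = 0) →
        ∀ β, |u β (P' - P)| ≤ 1) := by
  obtain ⟨C1, hC1, hR⟩ := relabel (W := W) X A C Cm hC hCm
  refine ⟨C1, hC1, fun C2 hC2 => ?_⟩
  set K := 2 * (C1 + C2) with hK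
  have hK1 : 1 ≤ K := by linarith
  set K' := K + 2 * K * K + 2 * K * K * K with hK'
  have hK'1 : 1 ≤ K' := by
    have : 0 ≤ 2 * K * K := by positivity
    have : 0 ≤ 2 * K * K * K := by positivity
    linarith
  have hall : ∃ C3, 1 ≤ C3 ∧ ∀ B : Finset I, 
      ∀ (G : ℝ → Set W) (u : I → W →ₗ[ℝ] ℝ) (T : Fin n → W →ₗ[ℝ] W) (P : W),
      CM G → MultAt X G u T Cm → Strong G u B P K' →
      ∃ A', X.Mono A' ∧ X.rank A' ≤ X.rank B ∧ Strong G u A' P C3 := by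
    apply exists_unif
    · intro B C2 C3 h23 h G u T P hG hT hS
      obtain ⟨A', h1, h2, h4⟩ := h G u T P hG hT hS
      exact ⟨A', h1, h2, h4.mono hG h23⟩
    · intro B
      obtain ⟨C2, -, h⟩ := relabel (W := W) X B K' Cm hK'1 hCm
      refine ⟨C2, fun G u T P hG hT hS => ?_⟩
      obtain ⟨A', h1, h2, h3, h4⟩ := h G u u T P 1 hG one_pos le_rfl (by simp) hT hS
      exact ⟨A', h1, h2, h4⟩
  obtain ⟨C3, hC3, hR2⟩ := hall
  refine ⟨max C1 C3, le_max_of_le_left hC1, ?_⟩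
  intro G u0 u T P t hG ht ht1 hu hT hS
  obtain ⟨A', hA', hr, hreq, hS'⟩ := hR G u0 u T P t hG ht ht1 hu hT hS
  rcases lt_or_eq_of_le hr with hr | hr
  · left
    exact ⟨A', P, hA', hr, by simp, by simp, hS'.mono hG (le_max_left _ _)⟩
  have hSA := hreq hr
  by_cases huniq : ∀ P' ∈ G C2, (∀ α ∈ A, u α (P' - P) = 0) → ∀ β, |u β (P' - P)| ≤ 1
  · right; exact ⟨hSA, huniq⟩
  left
  push Not at huniq
  obtain ⟨P', hP', hP'A, β0, hβ0⟩ := huniq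
  have : Nonempty I := ⟨β0⟩
  obtain ⟨β, hβ⟩ := Finite.exists_max (fun β => |u β (P' - P)|)
  set s := |u β (P' - P)| with hs
  have hs1 : 1 < s := lt_of_lt_of_le hβ0 (hβ β0)
  have hs0 : 0 < s := by linarith
  set V := s⁻¹ • (P' - P) with hV
  have hPK : P ∈ G (C1 + C2) := hG.mono _ _ (by linarith) hSA.2.1
  have hP'K : P' ∈ G (C1 + C2) := hG.mono _ _ (by linarith) hP'
  have hPV : P + V ∈ G (C1 + C2) := by
    rw [hV]
    refine hG.seg (a := 0) (b := 1) ?_ ?_ (by positivity) (inv_le_one_of_one_le₀ hs1.le)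
    · simpa using hPK
    · simpa using hP'K
  set P1 := (1/2 : ℝ) • P + (1/2 : ℝ) • (P + V) with hP1
  have hP1P : P1 - P = (1/2 : ℝ) • V := by rw [hP1]; module
  have hVu : ∀ β, |u β V| ≤ 1 := by
    intro β'
    rw [hV, map_smul, smul_eq_mul, abs_mul, abs_of_pos (by positivity), inv_mul_le_iff₀ hs0, mul_one]
    exact hβ β'
  have hVβ : |u β V| = 1 := by
    rw [hV, map_smul, smul_eq_mul, abs_mul, abs_of_pos (by positivity)]
    exact inv_mul_cancel₀ hs0.ne'
  have hVA : ∀ α ∈ A, u α V = 0 := by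
    intro α hα; rw [hV, map_smul, hP'A α hα, smul_zero]
  have hS1 : Strong G u A P1 K := by
    refine ⟨hK1, ?_, fun α hα => ?_⟩
    · exact hG.mono _ _ (by linarith) (hG.conv _ hPK hPV (by norm_num) (by norm_num) (by norm_num))
    · obtain ⟨Q, q1, q2, q3, q4⟩ := hSA.2.2 α hα
      exact ⟨Q, (q1.mono hG (by linarith) (by linarith)).midpoint hG hPV (by linarith), q2, q3,
        fun β => (q4 β).trans (by linarith)⟩
  have hVD : Dir G P1 K V := by
    refine Dir.of_smul (s := 1/2) hG ?_ ?_ (by linarith) ?_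
    · have : P1 + (1/2:ℝ) • V = P + V := by rw [hP1]; module
      rw [this]; exact hG.mono _ _ (by linarith) hPV
    · have : P1 - (1/2:ℝ) • V = P := by rw [hP1]; module
      rw [this]; exact hG.mono _ _ (by linarith) hPK
    · rw [inv_le_comm₀ (by linarith) (by norm_num)]; linarith
  have hS2 := hS1.insert hG (b := β) hVD hVA (fun β' => (hVu β').trans (by linarith))
    (by rw [hVβ]; norm_num)
  obtain ⟨A'', hA'', hr'', hS''⟩ := hR2 _ G u T P1 hG hT hS2
  have hβA : β ∉ A := by
    intro h; have := hVA β h; rw [this] at hVβ; norm_num at hVβ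
  have hrlt := X.rank_lt (A := A) (B := insert β A) (by rw [Finset.card_insert_of_notMem hβA]; omega)
  refine ⟨A'', P1, hA'', by omega, ?_, ?_, hS''.mono hG (le_max_right _ _)⟩
  · intro α hα; rw [hP1P, map_smul, hVA α hα, smul_zero]
  · intro β'
    rw [hP1P, map_smul, smul_eq_mul, abs_mul]
    have := hVu β'
    rw [abs_of_pos (by norm_num)]; linarith

/-- Lemma U -/
theorem uniqBound {G : ℝ → Set W} {u : I → W →ₗ[ℝ] ℝ} (hG : CM G) {A : Finset I} {P P'' : W}
    {C C2 K : ℝ} (hS : Strong G u A P C) (hC2 : 1 ≤ C2)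
    (hK : (A.card + 1) * C + C2 ≤ K)
    (huniq : ∀ P' ∈ G K, (∀ α ∈ A, u α (P' - P) = 0) → ∀ β, |u β (P' - P)| ≤ 1)
    (hP'' : P'' ∈ G C2) (hα : ∀ α ∈ A, |u α (P'' - P)| ≤ C2) (β : I) :
    |u β (P'' - P)| ≤ 2 * (1 + (A.card + 1) * C * C2) := by
  obtain ⟨hC, hP, hQ⟩ := hS
  choose! Q q1 q2 q3 q4 using hQ
  set p : ℝ := (A.card : ℝ) with hp
  have hp0 : 0 ≤ p := by positivity
  set c : ℝ := (p + 1) * C with hc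
  have hc1 : 1 ≤ c := by nlinarith
  have hcC : C ≤ c := by nlinarith
  set lam : ℝ := (1 + c * C2)⁻¹ with hlam
  have hcc : 0 < c * C2 := by positivity
  have hlam0 : 0 < lam := by positivity
  have hlam1 : 1 - lam = c * C2 * lam := by rw [hlam]; field_simp; ring
  set R := ∑ α ∈ A, (u α (P'' - P) / C2) • Q α with hR
  have hRD : Dir G P ((p + 1) * (1 * C)) R := by
    apply Dir.sum hG A Q _ hP q1 (by linarith) le_rfl
    intro α hαA
    rw [abs_div, abs_of_pos (by linarith : 0 < C2), div_le_one (by linarith)]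
    exact hα α hαA
  rw [one_mul] at hRD
  have hRu : ∀ α ∈ A, u α R = u α (P'' - P) / C2 := by
    intro α hαA
    rw [hR, map_sum, Finset.sum_eq_single α]
    · rw [map_smul, smul_eq_mul, q2 α hαA, mul_one]
    · intro b hb hne
      rw [map_smul, q3 b hb α hαA hne.symm, smul_zero]
    · exact fun h => absurd hαA h
  set Ps := lam • P'' + (1 - lam) • (P - c⁻¹ • R) with hPs
  have hPsG : Ps ∈ G K := by
    apply hG.conv K (hG.mono _ _ (by linarith) hP'') (hG.mono _ _ (by linarith) hRD.2) hlam0.le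
    · rw [hlam1]; positivity
    · ring
  have hdiff : Ps - P = lam • (P'' - P) - ((1 - lam) * c⁻¹) • R := by
    rw [hPs]; module
  have hcoef : (1 - lam) * c⁻¹ = C2 * lam := by
    rw [hlam1]; field_simp
  rw [hcoef] at hdiff
  have h0 : ∀ α ∈ A, u α (Ps - P) = 0 := by
    intro α hαA
    rw [hdiff, map_sub, map_smul, map_smul, smul_eq_mul, smul_eq_mul, hRu α hαA]
    field_simp; ring
  have h1 := huniq Ps hPsG h0 β
  have hRb : |u β R| ≤ c := by
    rw [hR, map_sum]
    refine (Finset.abs_sum_le_sum_abs _ _).trans ?_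
    calc ∑ α ∈ A, |u β ((u α (P'' - P) / C2) • Q α)| ≤ ∑ α ∈ A, C := by
          apply Finset.sum_le_sum
          intro α hαA
          rw [map_smul, smul_eq_mul, abs_mul]
          have : |u α (P'' - P) / C2| ≤ 1 := by
            rw [abs_div, abs_of_pos (by linarith : 0 < C2), div_le_one (by linarith)]
            exact hα α hαA
          calc _ ≤ 1 * C := mul_le_mul this (q4 α hαA β) (abs_nonneg _) zero_le_one
            _ = C := one_mul _
      _ = p * C := by rw [Finset.sum_const, nsmul_eq_mul]
      _ ≤ c := by nlinarith
  have h2 : lam * |u β (P'' - P)| ≤ 2 := by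
    have e : lam * u β (P'' - P) = u β (Ps - P) + C2 * lam * u β R := by
      have e3 := congrArg (u β) hdiff
      simp only [map_sub, map_smul, smul_eq_mul] at e3 ⊢
      linarith
    have e2 : lam * |u β (P'' - P)| = |lam * u β (P'' - P)| := by
      rw [abs_mul, abs_of_pos hlam0]
    rw [e2, e]
    refine (abs_add_le _ _).trans ?_
    have h3 : |C2 * lam * u β R| ≤ 1 := by
      rw [abs_mul, abs_of_pos (by positivity)]
      calc C2 * lam * |u β R| ≤ C2 * lam * c := by gcongr
        _ = 1 - lam := by rw [hlam1]; ring
        _ ≤ 1 := by linarith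
    linarith
  rw [hlam, inv_mul_le_iff₀ (by positivity)] at h2
  linarith

end Relabel

section Transport
variable {I : Type} [Fintype I] {W : Type} [AddCommGroup W] [Module ℝ W]

theorem avg_mem {G : ℝ → Set W} (hG : CM G) {C : ℝ} {A : Finset I} {Pz : W} (hz : Pz ∈ G C)
    (y : A → W) (hy : ∀ a, y a ∈ G C) :
    ((A.card : ℝ) + 1)⁻¹ • (Pz + ∑ a, y a) ∈ G C := by
  have h := (hG.conv C).sum_mem (t := (Finset.univ : Finset (Option A)))
    (w := fun _ => ((A.card : ℝ) + 1)⁻¹) (z := fun o => o.elim Pz y)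
    (by intro i _; positivity)
    (by
      rw [Finset.sum_const, Finset.card_univ, Fintype.card_option, Fintype.card_coe, nsmul_eq_mul]
      push_cast
      exact mul_inv_cancel₀ (by positivity))
    (by
      intro o _
      cases o with
      | none => exact hz
      | some a => exact hy a)
  rw [Fintype.sum_option] at h
  simp only [Option.elim] at h
  rwa [smul_add, Finset.smul_sum]

set_option maxHeartbeats 1000000 in
theorem transport (A : Finset I) (C : ℝ) (hC : 1 ≤ C) : ∃ ε, 0 < ε ∧ ε ≤ 1 ∧ ∃ C', 1 ≤ C' ∧
    ∀ (G G' : ℝ → Set W) (u v : I → W →ₗ[ℝ] ℝ) (s : I → I → ℝ) (P0 : W), CM G' →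
      (∀ β Q, v β Q = ∑ γ, s β γ * u γ Q) → (∀ β, s β β = 1) → (∀ β γ, γ ≠ β → |s β γ| ≤ ε) →
      (∀ β ∈ A, ∀ γ, γ ∉ A → s β γ = 0) →
      (∀ P ∈ G C, ∃ P' ∈ G' C, ∀ β, |v β (P' - P)| ≤ ε * C) →
      Strong G u A P0 C →
      ∃ P', (∀ α ∈ A, v α (P' - P0) = 0) ∧ (∀ β, |v β (P' - P0)| ≤ C') ∧ Strong G' v A P' C' := by
  set p : ℝ := (A.card : ℝ) with hp
  have hp0 : 0 ≤ p := by positivity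
  set N : ℝ := (Fintype.card I : ℝ) with hN
  have hN0 : 0 ≤ N := by positivity
  set K0 : ℝ := (p + 1) * ((N + 1) * C) with hK0
  have hNC : C ≤ (N + 1) * C := by nlinarith
  have hK0C : (N + 1) * C ≤ K0 := by rw [hK0]; nlinarith
  have hK0p : (p + 1) * C ≤ K0 := by rw [hK0]; gcongr
  set K1 : ℝ := (p + 1) * (2 * K0) with hK1
  have hK01 : 1 ≤ K0 := by linarith
  have hK11 : 1 ≤ K1 := by rw [hK1]; nlinarith
  set K2 : ℝ := (p + 1) * (1 * K1) with hK2
  have hK12 : K1 ≤ K2 := by rw [hK2]; nlinarith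
  have hK20 : 0 < K2 := by linarith
  set ε : ℝ := (2 * (1 + C ^ 2) * K2)⁻¹ with hε
  have hε0 : 0 < ε := by positivity
  have hε1 : ε * (1 + C ^ 2) * (2 * K2) = 1 := by rw [hε]; field_simp
  have hCC : C ≤ 1 + C ^ 2 := by nlinarith
  have hε2 : 2 * K2 * (ε * C) ≤ 1 := by
    rw [← hε1]
    calc 2 * K2 * (ε * C) ≤ 2 * K2 * (ε * (1 + C ^ 2)) := by gcongr
      _ = _ := by ring
  have hε3 : ε * (1 + C ^ 2) ≤ 1 / (2 * (p + 1)) := by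
    rw [le_div_iff₀ (by linarith)]
    have hpK : p + 1 ≤ K2 := by rw [hK2]; nlinarith
    calc ε * (1 + C ^ 2) * (2 * (p + 1)) ≤ ε * (1 + C ^ 2) * (2 * K2) := by gcongr
      _ = 1 := hε1
  have hεC : ε * C ≤ 1 := by
    calc ε * C ≤ 2 * K2 * (ε * C) := le_mul_of_one_le_left (by positivity) (by linarith)
      _ ≤ 1 := hε2
  have hεle : ε ≤ 1 := by
    calc ε ≤ ε * C := le_mul_of_one_le_right hε0.le hC
      _ ≤ 1 := hεC
  refine ⟨ε, hε0, hεle, 2 * K2, by linarith, ?_⟩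
  intro G G' u v s P0 hG' hv hs1 hsε hsA htr hS
  obtain ⟨-, hP0, hQ⟩ := hS
  choose! Q q1 q2 q3 q4 using hQ
  obtain ⟨Pz, hPz, hPzv⟩ := htr P0 hP0
  choose! Pp hPp hPpv using fun (α : I) (hα : α ∈ A) => htr _ (q1 α hα).1
  choose! Pm hPm hPmv using fun (α : I) (hα : α ∈ A) => htr _ (q1 α hα).2
  set z : A → W := fun a => (1/2 : ℝ) • Pp a + (1/2 : ℝ) • Pm a with hz
  have hzG : ∀ a, z a ∈ G' C := fun a =>
    hG'.conv _ (hPp a a.2) (hPm a a.2) (by norm_num) (by norm_num) (by norm_num)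
  set Pc := (p + 1)⁻¹ • (Pz + ∑ a, z a) with hPc
  have hPcG : Pc ∈ G' C := avg_mem hG' hPz z hzG
  set R : I → W := fun α => (C / 2) • (Pp α - Pm α) with hR
  have hupd : ∀ (a : A) (y : W), (p + 1)⁻¹ • (Pz + ∑ b, Function.update z a y b) =
      Pc + (p + 1)⁻¹ • (y - z a) := by
    intro a y
    have e1 := Finset.add_sum_erase Finset.univ z (Finset.mem_univ a)
    have e2 := Finset.add_sum_erase Finset.univ (Function.update z a y) (Finset.mem_univ a)
    have e3 : ∑ b ∈ Finset.univ.erase a, Function.update z a y b =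
        ∑ b ∈ Finset.univ.erase a, z b := by
      apply Finset.sum_congr rfl
      intro b hb
      rw [Function.update_of_ne (Finset.ne_of_mem_erase hb)]
    rw [hPc, ← e1, ← e2, e3, Function.update_self]; module
  have hupdG : ∀ (a : A) (y : W), y ∈ G' C → Pc + (p + 1)⁻¹ • (y - z a) ∈ G' C := by
    intro a y hy
    rw [← hupd]
    apply avg_mem hG' hPz
    intro b
    by_cases h : b = a
    · subst h; rw [Function.update_self]; exact hy
    · rw [Function.update_of_ne h]; exact hzG b
  have hCne : C ≠ 0 := by linarith
  have hRD : ∀ α ∈ A, Dir G' Pc K0 (R α) := by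
    intro α hα
    have hd : Dir G' Pc K0 (R α) := by
      refine Dir.of_smul (s := (p + 1)⁻¹ * C⁻¹) hG' ?_ ?_ (by linarith) ?_
      · have := hupdG ⟨α, hα⟩ _ (hPp α hα)
        apply hG'.mono _ _ (by linarith : C ≤ K0)
        convert this using 2
        rw [hR, hz, smul_smul]
        have : (p + 1)⁻¹ * C⁻¹ * (C / 2) = (p + 1)⁻¹ * (1/2) := by field_simp
        rw [this]; module
      · have := hupdG ⟨α, hα⟩ _ (hPm α hα)
        apply hG'.mono _ _ (by linarith : C ≤ K0)
        rw [sub_eq_add_neg]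
        convert this using 2
        rw [hR, hz, smul_smul]
        have : (p + 1)⁻¹ * C⁻¹ * (C / 2) = (p + 1)⁻¹ * (1/2) := by field_simp
        rw [this]; module
      · rw [← mul_inv]; exact inv_anti₀ (by positivity) hK0p
    exact hd
  have hRQ : ∀ α ∈ A, ∀ β, |v β (R α) - v β (Q α)| ≤ ε * C ^ 2 := by
    intro α hα β
    have e : v β (R α) - v β (Q α) = C / 2 * (v β (Pp α - (P0 + C⁻¹ • Q α)) -
        v β (Pm α - (P0 - C⁻¹ • Q α))) := by
      rw [← map_sub, ← map_sub, ← smul_eq_mul, ← map_smul]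
      congr 1
      rw [hR]
      have : Q α = (C * C⁻¹) • Q α := by rw [mul_inv_cancel₀ hCne, one_smul]
      conv_lhs => rw [this]
      module
    rw [e, abs_mul, abs_of_pos (by positivity)]
    have h1 := hPpv α hα β
    have h2 := hPmv α hα β
    calc _ ≤ C / 2 * (ε * C + ε * C) := by
          gcongr
          exact (abs_sub _ _).trans (add_le_add h1 h2)
      _ = ε * C ^ 2 := by ring
  have hQv : ∀ α ∈ A, ∀ β ∈ A, |v β (Q α) - if α = β then 1 else 0| ≤ ε := by
    intro α hα β hβ
    have e : v β (Q α) = s β α := by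
      rw [hv, Finset.sum_eq_single α]
      · rw [q2 α hα, mul_one]
      · intro γ _ hne
        by_cases hγ : γ ∈ A
        · rw [q3 α hα γ hγ hne, mul_zero]
        · rw [hsA β hβ γ hγ, zero_mul]
      · intro h; exact absurd (Finset.mem_univ _) h
    rw [e]
    by_cases h : α = β
    · subst h; rw [if_pos rfl, hs1, sub_self, abs_zero]; exact hε0.le
    · rw [if_neg h, sub_zero]; exact hsε _ _ h
  have hs_le : ∀ β γ, |s β γ| ≤ 1 := by
    intro β γ
    by_cases h : γ = β
    · subst h; rw [hs1, abs_one]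
    · exact (hsε β γ h).trans hεle
  have hQvb : ∀ α ∈ A, ∀ β, |v β (Q α)| ≤ N * C := by
    intro α hα β
    rw [hv]
    refine (Finset.abs_sum_le_sum_abs _ _).trans ?_
    calc ∑ γ, |s β γ * u γ (Q α)| ≤ ∑ γ : I, C := by
          apply Finset.sum_le_sum
          intro γ _
          rw [abs_mul]
          calc _ ≤ 1 * C := mul_le_mul (hs_le _ _) (q4 α hα γ) (abs_nonneg _) zero_le_one
            _ = C := one_mul _
      _ = N * C := by rw [Finset.sum_const, nsmul_eq_mul, Finset.card_univ]
  have hS1 : Strong G' v A Pc K1 := by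
    apply Strong.ofNear hG' hK01 (hG'.mono _ _ (by linarith) hPcG) R hRD
    · intro α hα β hβ
      have h1 := hRQ α hα β
      have h2 := hQv α hα β hβ
      have e : v β (R α) - (if α = β then (1:ℝ) else 0) = (v β (R α) - v β (Q α)) +
        (v β (Q α) - if α = β then (1:ℝ) else 0) := by ring
      rw [e]
      refine (abs_add_le _ _).trans ?_
      calc _ ≤ ε * C ^ 2 + ε := add_le_add h1 h2
        _ = ε * (1 + C ^ 2) := by ring
        _ ≤ _ := hε3
    · intro α hα β
      have h1 := hRQ α hα β
      have h2 := hQvb α hα β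
      have e : v β (R α) = (v β (R α) - v β (Q α)) + v β (Q α) := by ring
      rw [e]
      refine (abs_add_le _ _).trans ?_
      have : ε * C ^ 2 ≤ C := by
        calc ε * C ^ 2 = (ε * C) * C := by ring
          _ ≤ 1 * C := by gcongr
          _ = C := one_mul _
      have : N * C + C ≤ K0 := by linarith
      linarith
  have hPcv : ∀ β, |v β (Pc - P0)| ≤ ε * C := by
    intro β
    have e : Pc - P0 = (p + 1)⁻¹ • ((Pz - P0) + ∑ a, (z a - P0)) := by
      rw [hPc, Finset.sum_sub_distrib, Finset.sum_const, Finset.card_univ, Fintype.card_coe]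
      rw [← Nat.cast_smul_eq_nsmul ℝ, ← hp]
      have : P0 = ((p + 1)⁻¹ * (p + 1)) • P0 := by
        rw [inv_mul_cancel₀ (by positivity), one_smul]
      conv_lhs => rw [this]
      module
    rw [e, map_smul, smul_eq_mul, abs_mul, abs_of_pos (by positivity), inv_mul_le_iff₀ (by positivity),
      map_add, map_sum]
    refine (abs_add_le _ _).trans ?_
    have h1 := hPzv β
    have h2 : |∑ a, v β (z a - P0)| ≤ p * (ε * C) := by
      refine (Finset.abs_sum_le_sum_abs _ _).trans ?_
      calc ∑ a, |v β (z a - P0)| ≤ ∑ a : A, ε * C := by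
            apply Finset.sum_le_sum
            intro a _
            have e : z a - P0 = (1/2:ℝ) • (Pp a - (P0 + C⁻¹ • Q a)) +
              (1/2:ℝ) • (Pm a - (P0 - C⁻¹ • Q a)) := by rw [hz]; module
            rw [e, map_add, map_smul, map_smul, smul_eq_mul, smul_eq_mul]
            have h1 := hPpv a a.2 β
            have h2 := hPmv a a.2 β
            rw [abs_le] at h1 h2 ⊢
            constructor <;> linarith [h1.1, h1.2, h2.1, h2.2]
        _ = p * (ε * C) := by rw [Finset.sum_const, nsmul_eq_mul, Finset.card_univ, Fintype.card_coe]
    linarith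
  obtain ⟨-, hPcK1, hQ'⟩ := hS1
  choose! Q' r1 r2 r3 r4 using hQ'
  set V := ∑ α ∈ A, (2 * K2 * v α (Pc - P0)) • Q' α with hV
  have hVD : Dir G' Pc K2 V := by
    apply Dir.sum hG' A Q' _ hPcK1 r1 (by linarith) le_rfl
    intro α hα
    rw [abs_mul, abs_of_pos (by linarith)]
    calc _ ≤ 2 * K2 * (ε * C) := by
          have := hPcv α
          exact mul_le_mul_of_nonneg_left this (by linarith)
      _ ≤ 1 := hε2
  have hVu : ∀ α ∈ A, v α V = 2 * K2 * v α (Pc - P0) := by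
    intro α hα
    rw [hV, map_sum, Finset.sum_eq_single α]
    · rw [map_smul, smul_eq_mul, r2 α hα, mul_one]
    · intro b hb hne
      rw [map_smul, r3 b hb α hα hne.symm, smul_zero]
    · exact fun h => absurd hα h
  have hVb : ∀ β, |v β V| ≤ K2 := by
    intro β
    rw [hV, map_sum]
    refine (Finset.abs_sum_le_sum_abs _ _).trans ?_
    calc ∑ α ∈ A, |v β ((2 * K2 * v α (Pc - P0)) • Q' α)| ≤ ∑ α ∈ A, K1 := by
          apply Finset.sum_le_sum
          intro α hα
          rw [map_smul, smul_eq_mul, abs_mul]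
          have : |2 * K2 * v α (Pc - P0)| ≤ 1 := by
            rw [abs_mul, abs_of_pos (by linarith)]
            exact le_trans (mul_le_mul_of_nonneg_left (hPcv α) (by linarith)) hε2
          calc _ ≤ 1 * K1 := mul_le_mul this (r4 α hα β) (abs_nonneg _) zero_le_one
            _ = K1 := one_mul _
      _ = p * K1 := by rw [Finset.sum_const, nsmul_eq_mul]
      _ ≤ K2 := by rw [hK2]; nlinarith
  set Py := (1/2 : ℝ) • Pc + (1/2 : ℝ) • (Pc - K2⁻¹ • V) with hPy
  have hPyP : Py - P0 = (Pc - P0) - (1/2 * K2⁻¹) • V := by rw [hPy]; module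
  refine ⟨Py, ?_, ?_, ?_⟩
  · intro α hα
    rw [hPyP, map_sub, map_smul, smul_eq_mul, hVu α hα]
    field_simp; ring
  · intro β
    rw [hPyP, map_sub, map_smul, smul_eq_mul]
    refine (abs_sub _ _).trans ?_
    have h1 := hPcv β
    have h2 : |1/2 * K2⁻¹ * v β V| ≤ 1 := by
      rw [abs_mul, abs_of_pos (by positivity)]
      calc 1/2 * K2⁻¹ * |v β V| ≤ 1/2 * K2⁻¹ * K2 := by gcongr; exact hVb β
        _ = 1/2 := by field_simp
        _ ≤ 1 := by norm_num
    linarith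
  · have hPcK2 : Pc ∈ G' K2 := hG'.mono _ _ hK12 hPcK1
    refine ⟨by linarith, ?_, ?_⟩
    · exact hG'.mono _ _ (by linarith)
        (hG'.conv K2 hPcK2 hVD.2 (by norm_num) (by norm_num) (by norm_num))
    · intro α hα
      exact ⟨Q' α, ((r1 α hα).mono hG' (by linarith) hK12).midpoint hG' hVD.2 hK20, r2 α hα,
        r3 α hα, fun β => (r4 α hα β).trans (by linarith)⟩

end Transport

section Poly
open MvPolynomial
variable {n : ℕ}

/-- translation of a polynomial -/
def shp (x : En n) : MvPolynomial (Fin n) ℝ →ₐ[ℝ] MvPolynomial (Fin n) ℝ :=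
  bind₁ (fun i => X i + C (x i))

def ush (x : En n) : MvPolynomial (Fin n) ℝ →ₐ[ℝ] MvPolynomial (Fin n) ℝ :=
  bind₁ (fun i => X i - C (x i))

theorem shp_X (x : En n) (i : Fin n) : shp x (X i) = X i + C (x i) := by simp [shp]
theorem ush_X (x : En n) (i : Fin n) : ush x (X i) = X i - C (x i) := by simp [ush]
theorem shp_C (x : En n) (a : ℝ) : shp x (C a) = C a := by simp [shp]
theorem ush_C (x : En n) (a : ℝ) : ush x (C a) = C a := by simp [ush]

theorem shp_ush (x : En n) (p : MvPolynomial (Fin n) ℝ) : shp x (ush x p) = p := by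
  have : (shp x).comp (ush x) = AlgHom.id ℝ _ := by
    apply algHom_ext
    intro i
    simp [shp_X, ush_X, shp_C]
  exact congrArg (fun f => f p) this

theorem ush_shp (x : En n) (p : MvPolynomial (Fin n) ℝ) : ush x (shp x p) = p := by
  have : (ush x).comp (shp x) = AlgHom.id ℝ _ := by
    apply algHom_ext
    intro i
    simp [shp_X, ush_X, ush_C]
  exact congrArg (fun f => f p) this

theorem shp_inj (x : En n) {p q : MvPolynomial (Fin n) ℝ} (h : shp x p = shp x q) : p = q := by
  rw [← ush_shp x p, h, ush_shp]

theorem shp_shp (x y : En n) (p : MvPolynomial (Fin n) ℝ) :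
    shp (y - x) (shp x p) = shp y p := by
  have : (shp (y - x)).comp (shp x) = shp y := by
    apply algHom_ext
    intro i
    simp only [AlgHom.comp_apply, shp_X, map_add, shp_C, PiLp.sub_apply, map_sub]
    ring
  exact congrArg (fun f => f p) this

def Dk (k : ℕ) (p : MvPolynomial (Fin n) ℝ) : Prop := ∀ α : Fin n →₀ ℕ, k < α.degree → coeff α p = 0

theorem Dk_iff {k : ℕ} {p : MvPolynomial (Fin n) ℝ} : Dk k p ↔ p.totalDegree ≤ k := by
  constructor
  · intro h
    rw [totalDegree, Finset.sup_le_iff]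
    intro s hs
    by_contra hc
    push Not at hc
    exact (mem_support_iff.mp hs) (h s hc)
  · intro h α hα
    by_contra hc
    have := le_totalDegree (mem_support_iff.mpr hc)
    have h2 : α.degree = α.sum fun _ e => e := rfl
    omega

theorem Dk.zero {k : ℕ} : Dk k (0 : MvPolynomial (Fin n) ℝ) := fun _ _ => coeff_zero _
theorem Dk.add {k : ℕ} {p q : MvPolynomial (Fin n) ℝ} (hp : Dk k p) (hq : Dk k q) : Dk k (p + q) :=
  fun α h => by rw [coeff_add, hp α h, hq α h, add_zero]
theorem Dk.sub {k : ℕ} {p q : MvPolynomial (Fin n) ℝ} (hp : Dk k p) (hq : Dk k q) : Dk k (p - q) :=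
  fun α h => by rw [coeff_sub, hp α h, hq α h, sub_zero]
theorem Dk.smul {k : ℕ} {p : MvPolynomial (Fin n) ℝ} (a : ℝ) (hp : Dk k p) : Dk k (a • p) :=
  fun α h => by rw [coeff_smul, hp α h, smul_zero]

theorem coeff_truncDeg (k : ℕ) (p : MvPolynomial (Fin n) ℝ) (α : Fin n →₀ ℕ) :
    coeff α (truncDeg k p) = if α.degree ≤ k then coeff α p else 0 := by
  unfold truncDeg
  rw [coeff_sum]
  simp only [coeff_monomial]
  rw [Finset.sum_ite_eq']
  have h2 : α.degree = α.sum fun _ e => e := rfl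
  simp only [Finset.mem_filter, ← h2, mem_support_iff]
  by_cases h : α.degree ≤ k
  · simp only [h, and_true, if_true]
    by_cases h3 : coeff α p = 0
    · simp [h3]
    · simp [h3]
  · simp [h]

/-- truncation as a linear map -/
def trk (k : ℕ) : MvPolynomial (Fin n) ℝ →ₗ[ℝ] MvPolynomial (Fin n) ℝ where
  toFun := truncDeg k
  map_add' p q := by
    ext α
    simp only [coeff_add, coeff_truncDeg]
    split_ifs <;> simp
  map_smul' a p := by
    ext α
    simp only [coeff_smul, coeff_truncDeg, RingHom.id_apply]
    split_ifs <;> simp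

theorem trk_apply (k : ℕ) (p : MvPolynomial (Fin n) ℝ) : trk k p = truncDeg k p := rfl

theorem coeff_trk (k : ℕ) (p : MvPolynomial (Fin n) ℝ) (α : Fin n →₀ ℕ) :
    coeff α (trk k p) = if α.degree ≤ k then coeff α p else 0 := coeff_truncDeg k p α

theorem Dk_trk (k : ℕ) (p : MvPolynomial (Fin n) ℝ) : Dk k (trk k p) := by
  intro α h
  rw [coeff_trk, if_neg (by omega)]

theorem trk_of_Dk {k : ℕ} {p : MvPolynomial (Fin n) ℝ} (h : Dk k p) : trk k p = p := by
  ext α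
  rw [coeff_trk]
  split_ifs with h1
  · rfl
  · exact (h α (by omega)).symm

/-- shift coefficients -/
def aco (α γ : Fin n →₀ ℕ) (h : En n) : ℝ := coeff α (shp h (monomial γ (1:ℝ)))

theorem aco_succ (α γ : Fin n →₀ ℕ) (i : Fin n) (h : En n) :
    aco α (γ + Finsupp.single i 1) h =
      (if i ∈ α.support then aco (α - Finsupp.single i 1) γ h else 0) + h i * aco α γ h := by
  unfold aco
  have : (monomial (γ + Finsupp.single i 1) (1:ℝ) : MvPolynomial (Fin n) ℝ) =
      monomial γ (1:ℝ) * X i := by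
    rw [X, monomial_mul, one_mul]
  rw [this, map_mul, shp_X, mul_add, coeff_add, coeff_mul_X', mul_comm _ (C (h i)), coeff_C_mul]

theorem aco_zero_right (α : Fin n →₀ ℕ) (h : En n) : aco α 0 h = if α = 0 then 1 else 0 := by
  unfold aco
  have : (monomial 0 (1:ℝ) : MvPolynomial (Fin n) ℝ) = 1 := rfl
  rw [this, map_one, coeff_one]
  by_cases h : α = 0
  · simp [h]
  · simp [h, Ne.symm h]

theorem finsupp_ind {p : (Fin n →₀ ℕ) → Prop} (h0 : p 0)
    (hs : ∀ γ i, p γ → p (γ + Finsupp.single i 1)) (γ : Fin n →₀ ℕ) : p γ := by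
  induction γ using Finsupp.induction_linear with
  | zero => exact h0
  | add f g hf hg => 
    clear hf
    suffices h : ∀ f g : Fin n →₀ ℕ, p g → p (f + g) from h f g hg
    clear hg f g
    intro f
    induction f using Finsupp.induction_linear with
    | zero => intro g hg; rwa [zero_add]
    | add f g hf hg => intro q hq; rw [add_assoc]; exact hf _ (hg _ hq)
    | single a b =>
      intro g hg
      induction b with
      | zero => simpa using hg
      | succ b ih =>
        have e : Finsupp.single a (b+1) + g = (Finsupp.single a b + g) + Finsupp.single a 1 := by
          rw [Finsupp.single_add]; abel
        rw [e]; exact hs _ _ ih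
  | single a b =>
      induction b with
      | zero => simpa using h0
      | succ b ih =>
        rw [Finsupp.single_add]; exact hs _ _ ih

theorem sub_single_le {α γ : Fin n →₀ ℕ} {i : Fin n} (hi : i ∈ α.support) :
    α - Finsupp.single i 1 ≤ γ ↔ α ≤ γ + Finsupp.single i 1 := by
  rw [tsub_le_iff_right]

theorem sub_single_add {α : Fin n →₀ ℕ} {i : Fin n} (hi : i ∈ α.support) :
    α - Finsupp.single i 1 + Finsupp.single i 1 = α := by
  apply tsub_add_cancel_of_le
  rw [Finsupp.single_le_iff]
  have := Finsupp.mem_support_iff.mp hi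
  omega

theorem degree_add_single (γ : Fin n →₀ ℕ) (i : Fin n) :
    (γ + Finsupp.single i 1).degree = γ.degree + 1 := by
  rw [map_add, Finsupp.degree_single]

theorem degree_sub_single {α : Fin n →₀ ℕ} {i : Fin n} (hi : i ∈ α.support) :
    (α - Finsupp.single i 1).degree + 1 = α.degree := by
  rw [← degree_add_single _ i, sub_single_add hi]

theorem aco_eq_zero (h : En n) (γ : Fin n →₀ ℕ) : ∀ α, ¬ α ≤ γ → aco α γ h = 0 := by
  induction γ using finsupp_ind with
  | h0 =>
    intro α hα
    rw [aco_zero_right, if_neg]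
    rintro rfl; exact hα le_rfl
  | hs γ i ih =>
    intro α hα
    rw [aco_succ, ih α (fun h => hα (h.trans le_self_add)), mul_zero, add_zero]
    split_ifs with hi
    · exact ih _ (fun h => hα ((sub_single_le hi).mp h))
    · rfl

theorem aco_self (h : En n) (γ : Fin n →₀ ℕ) : aco γ γ h = 1 := by
  induction γ using finsupp_ind with
  | h0 => rw [aco_zero_right, if_pos rfl]
  | hs γ i ih =>
    rw [aco_succ, aco_eq_zero h γ (γ + Finsupp.single i 1), mul_zero, add_zero, if_pos,
      add_tsub_cancel_right, ih]
    · simp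
    · intro hle
      have := hle i
      simp at this

theorem aco_bound (h : En n) {r : ℝ} (hr : ∀ i, |h i| ≤ r) (γ : Fin n →₀ ℕ) :
    ∀ α, α ≤ γ → |aco α γ h| ≤ 2 ^ γ.degree * r ^ (γ.degree - α.degree) := by
  induction γ using finsupp_ind with
  | h0 =>
    intro α hα
    have : α = 0 := by simpa using hα
    subst this
    simp [aco_zero_right]
  | hs γ i ih =>
    intro α hα
    have hr0 : 0 ≤ r := (abs_nonneg _).trans (hr i)
    rw [aco_succ, degree_add_single]
    have h1 : |if i ∈ α.support then aco (α - Finsupp.single i 1) γ h else 0| ≤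
        2 ^ γ.degree * r ^ (γ.degree + 1 - α.degree) := by
      split_ifs with hi
      · have := ih _ ((sub_single_le hi).mpr hα)
        have e := degree_sub_single hi
        have e2 : Finsupp.degree γ - (α - Finsupp.single i 1).degree = Finsupp.degree γ + 1 - Finsupp.degree α := by omega
        rwa [e2] at this
      · rw [abs_zero]; positivity
    have h2 : |h i * aco α γ h| ≤ 2 ^ γ.degree * r ^ (γ.degree + 1 - α.degree) := by
      by_cases hle : α ≤ γ
      · have h3 := ih α hle
        have h4 := Finsupp.degree_mono hle
        rw [abs_mul, Nat.succ_sub h4, pow_succ]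
        calc |h i| * |aco α γ h| ≤ r * (2 ^ γ.degree * r ^ (γ.degree - α.degree)) :=
              mul_le_mul (hr i) h3 (abs_nonneg _) hr0
          _ = _ := by ring
      · rw [aco_eq_zero h γ α hle, mul_zero, abs_zero]; positivity
    refine (abs_add_le _ _).trans ?_
    calc _ ≤ _ := add_le_add h1 h2
      _ = _ := by rw [pow_succ]; ring

theorem coeff_shp (α : Fin n →₀ ℕ) (h : En n) (p : MvPolynomial (Fin n) ℝ) :
    coeff α (shp h p) = ∑ γ ∈ p.support, coeff γ p * aco α γ h := by
  conv_lhs => rw [as_sum p, map_sum, coeff_sum]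
  apply Finset.sum_congr rfl
  intro γ _
  have : (monomial γ (coeff γ p) : MvPolynomial (Fin n) ℝ) = coeff γ p • monomial γ 1 := by
    rw [smul_monomial, smul_eq_mul, mul_one]
  rw [this, map_smul, coeff_smul, smul_eq_mul, aco]

theorem Dk.shp {k : ℕ} {p : MvPolynomial (Fin n) ℝ} (hp : Dk k p) (h : En n) : Dk k (shp h p) := by
  intro α hα
  rw [coeff_shp]
  apply Finset.sum_eq_zero
  intro γ hγ
  by_cases hle : α ≤ γ
  · rw [hp γ (lt_of_lt_of_le hα (Finsupp.degree_mono hle)), zero_mul]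
  · rw [aco_eq_zero h γ α hle, mul_zero]

theorem ush_eq (x : En n) : ush x = shp (-x) := by
  apply algHom_ext
  intro i
  rw [ush_X, shp_X]
  simp [sub_eq_add_neg]

theorem Dk.ush {k : ℕ} {p : MvPolynomial (Fin n) ℝ} (hp : Dk k p) (h : En n) : Dk k (ush h p) := by
  rw [ush_eq]; exact hp.shp _

theorem taylorTrunc_eq (k : ℕ) (x : En n) (p : MvPolynomial (Fin n) ℝ) :
    taylorTrunc k x p = ush x (trk k (shp x p)) := rfl

theorem Dk_taylorTrunc (k : ℕ) (x : En n) (p : MvPolynomial (Fin n) ℝ) : Dk k (taylorTrunc k x p) := by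
  rw [taylorTrunc_eq]; exact (Dk_trk _ _).ush _

theorem Dk_odot (k : ℕ) (x : En n) (p q : MvPolynomial (Fin n) ℝ) : Dk k (odot k x p q) :=
  Dk_taylorTrunc _ _ _

theorem shp_odot (k : ℕ) (x : En n) (p q : MvPolynomial (Fin n) ℝ) :
    shp x (odot k x p q) = trk k (shp x p * shp x q) := by
  rw [odot, taylorTrunc_eq, shp_ush, map_mul]

theorem trk_mul_trk (k : ℕ) (p q : MvPolynomial (Fin n) ℝ) :
    trk k (trk k p * q) = trk k (p * q) := by
  ext α
  rw [coeff_trk, coeff_trk]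
  split_ifs with h
  · rw [coeff_mul, coeff_mul]
    apply Finset.sum_congr rfl
    intro a ha
    rw [coeff_trk, if_pos]
    rw [Finset.HasAntidiagonal.mem_antidiagonal] at ha
    have := congrArg Finsupp.degree ha
    rw [map_add] at this
    omega
  · rfl

/-- Taylor coefficient of order `α` at `x`. -/
def cf (k : ℕ) (x : En n) (α : Fin n →₀ ℕ) : MvPolynomial (Fin n) ℝ →ₗ[ℝ] ℝ :=
  (lcoeff ℝ α) ∘ₗ (shp x).toLinearMap ∘ₗ trk k

theorem cf_apply (k : ℕ) (x : En n) (α : Fin n →₀ ℕ) (p : MvPolynomial (Fin n) ℝ) :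
    cf k x α p = coeff α (shp x (trk k p)) := rfl

theorem cf_of_Dk {k : ℕ} (x : En n) (α : Fin n →₀ ℕ) {p : MvPolynomial (Fin n) ℝ} (h : Dk k p) :
    cf k x α p = coeff α (shp x p) := by rw [cf_apply, trk_of_Dk h]

/-- multi-indices of degree at most `k` -/
abbrev Mi (k n : ℕ) := {α : Fin n →₀ ℕ // α.degree ≤ k}

instance (k n : ℕ) : Fintype (Mi k n) := (Finsupp.finite_of_degree_le k).fintype

theorem cf_shift (k : ℕ) (x y : En n) (α : Fin n →₀ ℕ) (p : MvPolynomial (Fin n) ℝ) :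
    cf k y α p = ∑ γ : Mi k n, aco α γ.1 (y - x) * cf k x γ.1 p := by
  simp only [cf_apply]
  set q := shp x (trk k p) with hq
  have hD : Dk k q := (Dk_trk k p).shp x
  rw [← shp_shp x y, ← hq, coeff_shp]
  symm
  have e : ∀ γ : Fin n →₀ ℕ, γ ∈ q.support → γ.degree ≤ k := by
    intro γ hγ
    by_contra hc
    exact (mem_support_iff.mp hγ) (hD γ (by omega))
  have e1 : ∑ γ : Mi k n, aco α γ.1 (y - x) * coeff γ.1 q =
      ∑ γ ∈ (Finset.univ : Finset (Mi k n)).image Subtype.val, aco α γ (y - x) * coeff γ q := by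
    rw [Finset.sum_image]
    intro a _ b _ h
    exact Subtype.ext h
  rw [e1]
  symm
  simp only [mul_comm (coeff _ q)]
  apply Finset.sum_subset
  · intro γ hγ
    rw [Finset.mem_image]
    exact ⟨⟨γ, e γ hγ⟩, Finset.mem_univ _, rfl⟩
  · intro γ _ h
    rw [notMem_support_iff.mp h, mul_zero]

theorem cf_ext {k : ℕ} (x : En n) {p q : MvPolynomial (Fin n) ℝ} (hp : Dk k p) (hq : Dk k q)
    (h : ∀ α : Mi k n, cf k x α.1 p = cf k x α.1 q) : p = q := by
  apply shp_inj x
  ext α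
  by_cases hα : α.degree ≤ k
  · have := h ⟨α, hα⟩
    rwa [cf_of_Dk _ _ hp, cf_of_Dk _ _ hq] at this
  · rw [hp.shp x α (by omega), hq.shp x α (by omega)]

/-- multiplication by `X i - x i`, truncated at `x` -/
def mulX (k : ℕ) (x : En n) (i : Fin n) : MvPolynomial (Fin n) ℝ →ₗ[ℝ] MvPolynomial (Fin n) ℝ :=
  (ush x).toLinearMap ∘ₗ trk k ∘ₗ (LinearMap.mulLeft ℝ (X i)) ∘ₗ (shp x).toLinearMap ∘ₗ trk k

theorem mulX_apply (k : ℕ) (x : En n) (i : Fin n) (p : MvPolynomial (Fin n) ℝ) :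
    mulX k x i p = ush x (trk k (X i * shp x (trk k p))) := rfl

theorem Dk_mulX (k : ℕ) (x : En n) (i : Fin n) (p : MvPolynomial (Fin n) ℝ) : Dk k (mulX k x i p) := by
  rw [mulX_apply]; exact (Dk_trk _ _).ush _

theorem cf_mulX (k : ℕ) (x : En n) (i : Fin n) (p : MvPolynomial (Fin n) ℝ) (α : Fin n →₀ ℕ)
    (hα : α.degree ≤ k) : cf k x α (mulX k x i p) =
      if i ∈ α.support then cf k x (α - Finsupp.single i 1) p else 0 := by
  rw [cf_of_Dk _ _ (Dk_mulX _ _ _ _), mulX_apply, shp_ush, coeff_trk, if_pos hα, coeff_X_mul']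
  rfl

theorem shp_pderiv (x : En n) (i : Fin n) (p : MvPolynomial (Fin n) ℝ) :
    shp x (pderiv i p) = pderiv i (shp x p) := by
  induction p using MvPolynomial.induction_on with
  | C a => simp [shp_C]
  | add p q hp hq => simp [hp, hq]
  | mul_X p j hp =>
    simp only [Derivation.leibniz, map_add, smul_eq_mul, map_mul, hp, shp_X, pderiv_X, pderiv_C]
    by_cases h : j = i
    · subst h; simp
    · simp [Pi.single_apply, h]

theorem coeff_pderiv_iter (i : Fin n) (a : ℕ) (p : MvPolynomial (Fin n) ℝ) : ∀ β : Fin n →₀ ℕ,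
    coeff β ((fun r => pderiv i r)^[a] p) =
      ((β i + 1).ascFactorial a : ℕ) * coeff (β + Finsupp.single i a) p := by
  induction a generalizing p with
  | zero => intro β; simp
  | succ a ih =>
    intro β
    rw [Function.iterate_succ_apply, ih, coeff_pderiv, Nat.ascFactorial_succ]
    have : β + Finsupp.single i a + Finsupp.single i 1 = β + Finsupp.single i (a+1) := by
      rw [Finsupp.single_add]; abel
    rw [this]
    simp only [Finsupp.add_apply, Finsupp.single_eq_same]
    push_cast; ring

theorem coeff_fold_pderiv (α : Fin n → ℕ) (p : MvPolynomial (Fin n) ℝ) (L : List (Fin n)) :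
    L.Nodup → ∀ β : Fin n →₀ ℕ, (∀ i ∈ L, β i = 0) →
    coeff β (L.foldr (fun i q => (fun r => pderiv i r)^[α i] q) p) =
      (L.map fun i => ((α i).factorial : ℝ)).prod *
        coeff (β + (L.map fun i => Finsupp.single i (α i)).sum) p := by
  induction L with
  | nil => intro _ β _; simp
  | cons i L ih =>
    intro hnd β hβ
    rw [List.foldr_cons, coeff_pderiv_iter, ih (List.nodup_cons.mp hnd).2, hβ i (by simp)]
    · simp only [List.map_cons, List.prod_cons, List.sum_cons, zero_add, Nat.one_ascFactorial]
      rw [add_assoc]; ring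
    · intro j hj
      have hne : i ≠ j := by
        rintro rfl; exact (List.nodup_cons.mp hnd).1 hj
      rw [Finsupp.add_apply, hβ j (by simp [hj]), Finsupp.single_apply, if_neg hne, add_zero]

theorem polyPDval_eq (α : Fin n → ℕ) (p : MvPolynomial (Fin n) ℝ) (x : En n) :
    polyPDval α p x = (∏ i, ((α i).factorial : ℝ)) *
      coeff (Finsupp.equivFunOnFinite.symm α) (shp x p) := by
  have h1 : ∀ q : MvPolynomial (Fin n) ℝ, eval (fun i => x i) q = coeff 0 (shp x q) := by
    intro q
    induction q using MvPolynomial.induction_on with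
    | C a => simp [shp_C]
    | add p q hp hq => simp [hp, hq]
    | mul_X p j hp =>
      rw [map_mul, map_mul, hp, shp_X, eval_X, mul_add, coeff_add, coeff_mul_X', mul_comm _ (C (x j)), coeff_C_mul]
      simp [mul_comm]
  have h2 : ∀ (i : Fin n) (a : ℕ) (q : MvPolynomial (Fin n) ℝ),
      shp x ((fun r => pderiv i r)^[a] q) = (fun r => pderiv i r)^[a] (shp x q) := by
    intro i a
    induction a with
    | zero => intro q; rfl
    | succ a ih => intro q; rw [Function.iterate_succ_apply, Function.iterate_succ_apply, ih, shp_pderiv]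
  have h3 : ∀ L : List (Fin n), shp x (L.foldr (fun i q => (fun r => pderiv i r)^[α i] q) p) =
      L.foldr (fun i q => (fun r => pderiv i r)^[α i] q) (shp x p) := by
    intro L
    induction L with
    | nil => rfl
    | cons i L ih => rw [List.foldr_cons, List.foldr_cons, h2, ih]
  rw [polyPDval, polyPD, h1, h3, coeff_fold_pderiv α _ _ (List.nodup_finRange n) 0 (by simp)]
  rw [zero_add]
  have e1 : (List.map (fun i => ((α i).factorial : ℝ)) (List.finRange n)).prod =
      ∏ i, ((α i).factorial : ℝ) := by rw [← List.ofFn_eq_map, List.prod_ofFn]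
  have e2 : (List.map (fun i => Finsupp.single i (α i)) (List.finRange n)).sum =
      Finsupp.equivFunOnFinite.symm α := by
    rw [← List.ofFn_eq_map, List.sum_ofFn]
    ext j
    rw [Finsupp.finset_sum_apply]
    simp [Finsupp.single_apply]
  rw [e1, e2]

end Poly

section Vec
open MvPolynomial
variable {n D k : ℕ}

theorem coeff_shp_Mi {K : ℕ} {q : MvPolynomial (Fin n) ℝ} (hD : Dk K q) (α : Fin n →₀ ℕ) (h : En n) :
    coeff α (shp h q) = ∑ γ : Mi K n, aco α γ.1 h * coeff γ.1 q := by
  have := cf_shift K 0 h α q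
  rw [cf_of_Dk _ _ hD] at this
  rw [this]
  apply Finset.sum_congr rfl
  intro γ _
  rw [cf_of_Dk _ _ hD, sub_zero]
  have : shp (0 : En n) q = q := by
    have : shp (0 : En n) = AlgHom.id ℝ _ := by
      apply algHom_ext; intro i; simp [shp_X]
    rw [this]; rfl
  rw [this]

abbrev Wv (n D : ℕ) := Fin D → MvPolynomial (Fin n) ℝ
abbrev Idx (k n D : ℕ) := Mi k n × Fin D

def dgI (β : Idx k n D) : ℕ := β.1.1.degree

theorem dgI_le (β : Idx k n D) : dgI β ≤ k := β.1.2

def cc (x : En n) (β : Idx k n D) : Wv n D →ₗ[ℝ] ℝ := cf k x β.1.1 ∘ₗ LinearMap.proj β.2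

theorem cc_apply (x : En n) (β : Idx k n D) (P : Wv n D) : cc x β P = cf k x β.1.1 (P β.2) := rfl

def NB (k : ℕ) (x : En n) (δ : ℝ) (P : Wv n D) (K : ℝ) : Prop :=
  ∀ β : Idx k n D, |cc x β P| ≤ K * δ ^ (k + 1 - dgI β)

def nu (k : ℕ) (x : En n) (δ : ℝ) (β : Idx k n D) : Wv n D →ₗ[ℝ] ℝ :=
  (δ ^ (k + 1 - dgI β))⁻¹ • cc x β

theorem nu_apply (x : En n) (δ : ℝ) (β : Idx k n D) (P : Wv n D) :
    nu k x δ β P = (δ ^ (k + 1 - dgI β))⁻¹ * cc x β P := rfl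

theorem NB_iff {x : En n} {δ : ℝ} (hδ : 0 < δ) {P : Wv n D} {K : ℝ} :
    NB k x δ P K ↔ ∀ β, |nu k x δ β P| ≤ K := by
  apply forall_congr'
  intro β
  have hp : 0 < δ ^ (k + 1 - dgI β) := by positivity
  rw [nu_apply, abs_mul, abs_of_pos (inv_pos.mpr hp), inv_mul_le_iff₀ hp, mul_comm]

theorem NB.mono {x : En n} {δ δ' K K' : ℝ} {P : Wv n D} (h : NB k x δ P K) (hδ : 0 ≤ δ)
    (hδ' : δ ≤ δ') (hK : K ≤ K') (hK0 : 0 ≤ K') : NB k x δ' P K' := by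
  intro β
  exact (h β).trans (mul_le_mul hK (pow_le_pow_left₀ hδ hδ' _) (pow_nonneg hδ _) hK0)

theorem NB.add {x : En n} {δ K K' : ℝ} {P Q : Wv n D} (h : NB k x δ P K) (h' : NB k x δ Q K') :
    NB k x δ (P + Q) (K + K') := by
  intro β
  rw [map_add, add_mul]
  exact (abs_add_le _ _).trans (add_le_add (h β) (h' β))

theorem NB.neg {x : En n} {δ K : ℝ} {P : Wv n D} (h : NB k x δ P K) : NB k x δ (-P) K := by
  intro β
  rw [map_neg, abs_neg]; exact h β

theorem NB.sub {x : En n} {δ K K' : ℝ} {P Q : Wv n D} (h : NB k x δ P K) (h' : NB k x δ Q K') :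
    NB k x δ (P - Q) (K + K') := by
  rw [sub_eq_add_neg]; exact h.add h'.neg

theorem NB.symm {x : En n} {δ K : ℝ} {P Q : Wv n D} (h : NB k x δ (P - Q) K) : NB k x δ (Q - P) K := by
  rw [← neg_sub]; exact h.neg

theorem NB.smul {x : En n} {δ K : ℝ} {P : Wv n D} (a : ℝ) (h : NB k x δ P K) :
    NB k x δ (a • P) (|a| * K) := by
  intro β
  rw [map_smul, smul_eq_mul, abs_mul, mul_assoc]
  exact mul_le_mul_of_nonneg_left (h β) (abs_nonneg _)

theorem NB.rescale {x : En n} {δ δ' K t : ℝ} {P : Wv n D} (h : NB k x δ P K) (hδ : 0 ≤ δ) (hδ' : 0 ≤ δ')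
    (ht : 1 ≤ t) (hK : 0 ≤ K) (hle : δ ≤ t * δ') : NB k x δ' P (t ^ (k + 1) * K) := by
  intro β
  calc |cc x β P| ≤ K * δ ^ (k + 1 - dgI β) := h β
    _ ≤ K * (t * δ') ^ (k + 1 - dgI β) := by gcongr
    _ = t ^ (k + 1 - dgI β) * K * δ' ^ (k + 1 - dgI β) := by rw [mul_pow]; ring
    _ ≤ t ^ (k + 1) * K * δ' ^ (k + 1 - dgI β) := by
      gcongr
      omega

theorem coord_le_dist (x y : En n) (i : Fin n) : |(y - x) i| ≤ dist x y := by
  rw [dist_comm, dist_eq_norm, ← Real.norm_eq_abs]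
  exact PiLp.norm_apply_le _ _

/-- constant for shifting base points -/
def Csh (k n : ℕ) : ℝ := (Fintype.card (Mi k n) : ℝ) * 2 ^ k

theorem one_le_Csh : 1 ≤ Csh k n := by
  unfold Csh
  have h1 : 0 < Fintype.card (Mi k n) := Fintype.card_pos_iff.mpr ⟨⟨0, by simp⟩⟩
  have h2 : (1:ℝ) ≤ (Fintype.card (Mi k n) : ℝ) := by exact_mod_cast h1
  have h3 : (1:ℝ) ≤ 2 ^ k := one_le_pow₀ (by norm_num)
  nlinarith

theorem aco_le {α γ : Fin n →₀ ℕ} {h : En n} {r δ : ℝ} (hr : ∀ i, |h i| ≤ r) (hr0 : 0 ≤ r)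
    (hrδ : r ≤ δ) {K : ℕ} (hK : γ.degree ≤ K) : |aco α γ h| * δ ^ (K - γ.degree) ≤ 2 ^ γ.degree * δ ^ (K - α.degree) := by
  have hδ : 0 ≤ δ := hr0.trans hrδ
  by_cases hle : α ≤ γ
  · have h4 := Finsupp.degree_mono hle
    calc |aco α γ h| * δ ^ (K - γ.degree) ≤ (2 ^ γ.degree * δ ^ (γ.degree - α.degree)) * δ ^ (K - γ.degree) := by
          gcongr
          refine (aco_bound h hr γ α hle).trans ?_
          gcongr
      _ = 2 ^ γ.degree * δ ^ (K - α.degree) := by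
          rw [mul_assoc, ← pow_add]
          congr 2
          omega
  · rw [aco_eq_zero h γ α hle, abs_zero, zero_mul]; positivity

theorem NB.shift {x y : En n} {δ K : ℝ} {P : Wv n D} (h : NB k x δ P K) (hK : 0 ≤ K)
    (hd : dist x y ≤ δ) : NB k y δ P (Csh k n * K) := by
  intro β
  have hδ : 0 ≤ δ := dist_nonneg.trans hd
  rw [cc_apply, cf_shift k x y]
  refine (Finset.abs_sum_le_sum_abs _ _).trans ?_
  calc ∑ γ : Mi k n, |aco β.1.1 γ.1 (y - x) * cf k x γ.1 (P β.2)|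
      ≤ ∑ γ : Mi k n, 2 ^ k * K * δ ^ (k + 1 - dgI β) := by
        apply Finset.sum_le_sum
        intro γ _
        rw [abs_mul]
        have h1 := h (γ, β.2)
        rw [cc_apply] at h1
        have h2 := aco_le (α := β.1.1) (γ := γ.1) (coord_le_dist x y) dist_nonneg hd
          (K := k + 1) (by have := γ.2; omega)
        calc _ ≤ |aco β.1.1 γ.1 (y - x)| * (K * δ ^ (k + 1 - dgI (γ, β.2))) :=
              mul_le_mul_of_nonneg_left h1 (abs_nonneg _)
          _ = K * (|aco β.1.1 γ.1 (y - x)| * δ ^ (k + 1 - γ.1.degree)) := by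
              unfold dgI; ring
          _ ≤ K * (2 ^ γ.1.degree * δ ^ (k + 1 - β.1.1.degree)) := by gcongr
          _ ≤ K * (2 ^ k * δ ^ (k + 1 - β.1.1.degree)) := by
              gcongr
              · norm_num
              · exact γ.2
          _ = _ := by unfold dgI; ring
    _ = _ := by
        rw [Finset.sum_const, Finset.card_univ, nsmul_eq_mul]; unfold Csh; ring

/-- degree condition for vectors -/
def DV (k : ℕ) (P : Wv n D) : Prop := ∀ j, Dk k (P j)

theorem DV.add {P Q : Wv n D} (hP : DV k P) (hQ : DV k Q) : DV k (P + Q) := fun j => (hP j).add (hQ j)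
theorem DV.sub {P Q : Wv n D} (hP : DV k P) (hQ : DV k Q) : DV k (P - Q) := fun j => (hP j).sub (hQ j)
theorem DV.smul {P : Wv n D} (a : ℝ) (hP : DV k P) : DV k (a • P) := fun j => (hP j).smul a

theorem eq_of_cc {x : En n} {P Q : Wv n D} (hP : DV k P) (hQ : DV k Q)
    (h : ∀ β : Idx k n D, cc x β P = cc x β Q) : P = Q := by
  funext j
  exact cf_ext x (hP j) (hQ j) (fun α => h (α, j))

/-- vector multiplication by `X i - x i`. -/
def mulV (k : ℕ) (D : ℕ) (x : En n) (i : Fin n) : Wv n D →ₗ[ℝ] Wv n D := (mulX k x i).compLeft (Fin D)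

theorem mulV_apply (x : En n) (i : Fin n) (P : Wv n D) (j : Fin D) :
    mulV k D x i P j = mulX k x i (P j) := rfl

def shI (i : Fin n) (β γ : Idx k n D) : Prop := γ.1.1 = β.1.1 + Finsupp.single i 1 ∧ γ.2 = β.2

theorem cc_mulV_sh {x : En n} {i : Fin n} {β γ : Idx k n D} (h : shI i β γ) (P : Wv n D) :
    cc x γ (mulV k D x i P) = cc x β P := by
  rw [cc_apply, cc_apply, mulV_apply, cf_mulX _ _ _ _ _ γ.1.2, if_pos, h.1, h.2, add_tsub_cancel_right]
  rw [h.1]; simp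

theorem cc_mulV_zero {x : En n} {i : Fin n} {γ : Idx k n D} (h : ∀ β, ¬ shI i β γ) (P : Wv n D) :
    cc x γ (mulV k D x i P) = 0 := by
  rw [cc_apply, mulV_apply, cf_mulX _ _ _ _ _ γ.1.2, if_neg]
  intro hi
  refine h (⟨γ.1.1 - Finsupp.single i 1, ?_⟩, γ.2) ⟨(sub_single_add hi).symm, rfl⟩
  have := degree_sub_single hi
  have := γ.1.2
  omega

theorem dgI_sh {i : Fin n} {β γ : Idx k n D} (h : shI i β γ) : dgI γ = dgI β + 1 := by
  unfold dgI; rw [h.1, degree_add_single]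

theorem NB.mulV {x : En n} {δ K : ℝ} {P : Wv n D} (h : NB k x δ P K) (hδ : 0 ≤ δ) (hK : 0 ≤ K)
    (i : Fin n) (β : Idx k n D) : |cc x β (mulV k D x i P)| ≤ δ * (K * δ ^ (k + 1 - dgI β)) := by
  by_cases hb : ∃ γ, shI i γ β
  · obtain ⟨γ, hγ⟩ := hb
    rw [cc_mulV_sh hγ]
    refine (h γ).trans (le_of_eq ?_)
    have h1 := dgI_sh hγ
    have h2 := dgI_le β
    rw [show k + 1 - dgI γ = (k + 1 - dgI β) + 1 by omega, pow_succ]; ring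
  · push Not at hb
    rw [cc_mulV_zero hb, abs_zero]; positivity

/-- the weight data -/
def lowW (β : Idx k n D) : ℕ := (∑ i : Fin n, β.1.1 i * (k+1) ^ (i : ℕ)) + β.2 * (k+1) ^ n

theorem mi_lt (α : Mi k n) (i : Fin n) : α.1 i < k + 1 := by
  have := Finsupp.le_degree i α.1
  have := α.2
  omega

theorem sum_lt (α : Mi k n) : ∑ i : Fin n, α.1 i * (k+1) ^ (i : ℕ) < (k+1) ^ n := by
  have := (finFunctionFinEquiv (fun i : Fin n => (⟨α.1 i, mi_lt α i⟩ : Fin (k+1)))).2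
  rwa [finFunctionFinEquiv_apply] at this

theorem sum_inj (α γ : Mi k n) (h : ∑ i : Fin n, α.1 i * (k+1) ^ (i : ℕ) =
    ∑ i : Fin n, γ.1 i * (k+1) ^ (i : ℕ)) : α = γ := by
  have h1 : finFunctionFinEquiv (fun i : Fin n => (⟨α.1 i, mi_lt α i⟩ : Fin (k+1))) =
      finFunctionFinEquiv (fun i : Fin n => (⟨γ.1 i, mi_lt γ i⟩ : Fin (k+1))) := by
    apply Fin.ext
    rw [finFunctionFinEquiv_apply, finFunctionFinEquiv_apply]
    exact h
  have h2 := finFunctionFinEquiv.injective h1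
  apply Subtype.ext
  ext i
  have := congrFun h2 i
  exact congrArg Fin.val this

theorem nat_aux1 (a b : ℕ) : b < (a + 1) * (b + 1) := by nlinarith [Nat.zero_le (a * b)]
theorem nat_aux2 (a b : ℕ) : a * b < (a + 1) * (b + 1) := by nlinarith [Nat.zero_le (a * b)]

theorem lowW_lt (β : Idx k n D) : lowW β < (k+1)^n * D := by
  unfold lowW
  have h1 := sum_lt β.1
  have h2 := β.2.2
  calc _ < (k+1)^n + β.2 * (k+1)^n := by omega
    _ = (k+1)^n * (β.2 + 1) := by ring
    _ ≤ _ := Nat.mul_le_mul_left _ h2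

theorem lowW_inj (β γ : Idx k n D) (h : lowW β = lowW γ) : β = γ := by
  unfold lowW at h
  have h1 := sum_lt β.1
  have h2 := sum_lt γ.1
  have hpos : 0 < (k+1)^n := by positivity
  have e1 : (β.2 : ℕ) = γ.2 := by
    have := congrArg (· / (k+1)^n) h
    simp only [Nat.add_mul_div_right _ _ hpos, Nat.div_eq_of_lt h1, Nat.div_eq_of_lt h2] at this
    omega
  rw [e1] at h
  have e2 := sum_inj β.1 γ.1 (by omega)
  exact Prod.ext e2 (Fin.ext e1)

def bigN (k n D : ℕ) : ℕ := (Fintype.card (Idx k n D) + 1) * ((k+1)^n * D + 1)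

def IX (k n D : ℕ) : IdxData (Idx k n D) n where
  m := k + 1
  dg := dgI
  w := fun β => bigN k n D * dgI β + lowW β
  wk := fun i => bigN k n D + (k+1) ^ (i:ℕ)
  sh := shI
  dg_le := fun β => (dgI_le β).trans (Nat.le_succ _)
  w_inj := by
    intro β γ h
    apply lowW_inj
    have hb : (k+1)^n * D < bigN k n D := nat_aux1 _ _
    have h1 := (lowW_lt β).trans hb
    have h2 := (lowW_lt γ).trans hb
    have h := congrArg (· % bigN k n D) h
    simpa [Nat.add_mod, Nat.mod_eq_of_lt h1, Nat.mod_eq_of_lt h2] using h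
  sh_w := by
    intro i β γ h
    have h1 := dgI_sh h
    have h2 : lowW γ = lowW β + (k+1)^(i:ℕ) := by
      unfold lowW
      rw [h.1, h.2]
      simp only [Finsupp.add_apply, add_mul, Finset.sum_add_distrib]
      have : ∑ x : Fin n, (Finsupp.single i 1 : Fin n →₀ ℕ) x * (k+1)^(x:ℕ) = (k+1)^(i:ℕ) := by
        rw [Finset.sum_eq_single i]
        · simp
        · intro b _ hb; simp [Finsupp.single_apply, hb.symm]
        · simp
      rw [this]; ring
    show bigN k n D * dgI γ + lowW γ = _
    rw [h1, h2]; ring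
  deg := by
    intro A f h
    by_contra hc
    push Not at hc
    simp only [Finset.sum_add_distrib, ← Finset.mul_sum] at h
    have h1 : ∑ a : A, lowW (f a) ≤ Fintype.card (Idx k n D) * ((k+1)^n * D) := by
      calc ∑ a : A, lowW (f a) ≤ ∑ a : A, (k+1)^n * D := Finset.sum_le_sum fun a _ => (lowW_lt _).le
        _ = A.card * ((k+1)^n * D) := by simp
        _ ≤ _ := Nat.mul_le_mul_right _ (Finset.card_le_univ _)
    have h2 : bigN k n D * (∑ a : A, dgI (f a) + 1) ≤ bigN k n D * ∑ a : A, dgI a.1 :=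
      Nat.mul_le_mul_left _ hc
    have h3 : Fintype.card (Idx k n D) * ((k+1)^n * D) < bigN k n D := nat_aux2 _ _
    have h4 : 0 ≤ ∑ a : A, lowW a.1 := Nat.zero_le _
    rw [mul_add, mul_one] at h2
    omega

theorem Mono_le {A : Finset (Idx k n D)} (hA : (IX k n D).Mono A) {β γ : Idx k n D} (hβ : β ∈ A)
    (hle : β.1.1 ≤ γ.1.1) (hj : γ.2 = β.2) : γ ∈ A := by
  obtain ⟨δ, hδ⟩ := le_iff_exists_add.mp hle
  suffices h : ∀ δ : Fin n →₀ ℕ, ∀ γ : Idx k n D, γ.1.1 = β.1.1 + δ → γ.2 = β.2 → γ ∈ A from h δ γ hδ hj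
  intro δ
  induction δ using finsupp_ind with
  | h0 =>
    intro γ h1 h2
    have : γ = β := Prod.ext (Subtype.ext (by simpa using h1)) h2
    rwa [this]
  | hs δ i ih =>
    intro γ h1 h2
    have hd : (β.1.1 + δ).degree ≤ k := by
      have h3 := γ.1.2
      rw [h1, ← add_assoc, degree_add_single] at h3
      omega
    exact hA i (⟨β.1.1 + δ, hd⟩, β.2) γ ⟨by rw [h1, add_assoc], h2⟩ (ih _ rfl rfl)

end Vec

section Shape
open MvPolynomial
variable {n D k : ℕ}

structure GH (k : ℕ) {n D : ℕ} (E : Finset (En n)) (δmax Cw : ℝ) (G : En n → ℝ → Set (Wv n D)) : Prop where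
  cm : ∀ x, CM (G x)
  deg : ∀ x K P, P ∈ G x K → DV k P
  pos : ∀ x K P, P ∈ G x K → 0 < K
  dpos : 0 < δmax
  Cw1 : 1 ≤ Cw
  wh : ∀ δ, 0 < δ → δ ≤ δmax → ∀ x ∈ E, ∀ K P1 P2, P1 ∈ G x K → P2 ∈ G x K →
    NB k x δ (P1 - P2) K → ∀ Q1 Q2 : MvPolynomial (Fin n) ℝ, Dk k Q1 → Dk k Q2 →
    (∀ α : Mi k n, |coeff α.1 (shp x Q1)| ≤ (δ ^ α.1.degree)⁻¹) →
    (∀ α : Mi k n, |coeff α.1 (shp x Q2)| ≤ (δ ^ α.1.degree)⁻¹) →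
    odot k x Q1 Q1 + odot k x Q2 Q2 = 1 →
    (fun j => odot k x (odot k x Q1 Q1) (P1 j) + odot k x (odot k x Q2 Q2) (P2 j)) ∈ G x (Cw * K)

theorem coef_rescale {Cb δ : ℝ} (hCb : 1 ≤ Cb) (hδ : 0 < δ) {c : ℝ} (d : ℕ) (h0 : d = 0 → |c| ≤ 1)
    (h1 : |c| ≤ Cb * (δ ^ d)⁻¹) : |c| ≤ ((δ / Cb) ^ d)⁻¹ := by
  by_cases hd : d = 0
  · subst hd; simpa using h0 rfl
  · refine h1.trans ?_
    have : 0 < Cb := by linarith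
    rw [div_pow, inv_div, div_eq_mul_inv]
    have : Cb ≤ Cb ^ d := le_self_pow₀ hCb hd
    gcongr

theorem GH.whC {E : Finset (En n)} {δmax Cw : ℝ} {G : En n → ℝ → Set (Wv n D)} (hG : GH k E δmax Cw G)
    {Cb : ℝ} (hCb : 1 ≤ Cb) {δ : ℝ} (hδ : 0 < δ) (hδm : δ ≤ Cb * δmax) {x : En n} (hx : x ∈ E) {K : ℝ}
    {P1 P2 : Wv n D} (h1 : P1 ∈ G x K) (h2 : P2 ∈ G x K) (hNB : NB k x δ (P1 - P2) (Cb * K))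
    {Q1 Q2 : MvPolynomial (Fin n) ℝ} (d1 : Dk k Q1) (d2 : Dk k Q2)
    (b1 : ∀ α : Mi k n, |coeff α.1 (shp x Q1)| ≤ Cb * (δ ^ α.1.degree)⁻¹)
    (b2 : ∀ α : Mi k n, |coeff α.1 (shp x Q2)| ≤ Cb * (δ ^ α.1.degree)⁻¹)
    (z1 : |coeff 0 (shp x Q1)| ≤ 1) (z2 : |coeff 0 (shp x Q2)| ≤ 1)
    (hs : odot k x Q1 Q1 + odot k x Q2 Q2 = 1) :
    (fun j => odot k x (odot k x Q1 Q1) (P1 j) + odot k x (odot k x Q2 Q2) (P2 j))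
      ∈ G x (Cw * Cb ^ (k + 2) * K) := by
  have hK := hG.pos _ _ _ h1
  have hCb0 : 0 < Cb := by linarith
  have hp : 1 ≤ Cb ^ (k + 2) := one_le_pow₀ hCb
  have hm : K ≤ Cb ^ (k + 2) * K := by nlinarith
  have key : ∀ {Q : MvPolynomial (Fin n) ℝ}, (∀ α : Mi k n, |coeff α.1 (shp x Q)| ≤ Cb * (δ ^ α.1.degree)⁻¹) →
      |coeff 0 (shp x Q)| ≤ 1 → ∀ α : Mi k n, |coeff α.1 (shp x Q)| ≤ ((δ / Cb) ^ α.1.degree)⁻¹ := by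
    intro Q hb hz α
    apply coef_rescale hCb hδ _ _ (hb α)
    intro h0
    rw [(Finsupp.degree_eq_zero_iff _).mp h0]; exact hz
  have := hG.wh (δ / Cb) (by positivity) (by rw [div_le_iff₀ hCb0, mul_comm]; exact hδm) x hx (Cb ^ (k+2) * K)
    P1 P2 ((hG.cm x).mono _ _ hm h1) ((hG.cm x).mono _ _ hm h2) ?_ Q1 Q2 d1 d2 (key b1 z1) (key b2 z2) hs
  · rwa [← mul_assoc] at this
  · have h3 := hNB.rescale (δ' := δ / Cb) (t := Cb) hδ.le (by positivity) hCb (by positivity)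
      (by rw [mul_div_cancel₀ _ hCb0.ne'])
    rwa [← mul_assoc, ← pow_succ] at h3

theorem sqrtPoly (k : ℕ) : ∃ a : Polynomial ℝ, a.natDegree ≤ k ∧ a.coeff 0 = √(1/2) ∧
    (Polynomial.X : Polynomial ℝ) ^ (k+1) ∣ a ^ 2 - Polynomial.C (1/2) * (1 + Polynomial.X) := by
  induction k with
  | zero =>
    refine ⟨Polynomial.C √(1/2), by simp, by simp, ?_⟩
    rw [← Polynomial.C_pow, Real.sq_sqrt (by norm_num)]
    refine ⟨-Polynomial.C (1/2), by ring⟩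
  | succ k ih =>
    obtain ⟨a, h1, h2, r, hr⟩ := ih
    set s := √(1/2:ℝ) with hs
    have hs0 : s ≠ 0 := by rw [hs]; positivity
    set c := - r.coeff 0 / (2 * s) with hc
    refine ⟨a + Polynomial.C c * Polynomial.X ^ (k+1), ?_, ?_, ?_⟩
    · refine (Polynomial.natDegree_add_le _ _).trans (max_le (by omega) ?_)
      exact Polynomial.natDegree_C_mul_X_pow_le _ _
    · simp [h2]
    · have e : (a + Polynomial.C c * Polynomial.X ^ (k+1)) ^ 2 - Polynomial.C (1/2) * (1 + Polynomial.X) =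
          Polynomial.X ^ (k+1) * (r + 2 * Polynomial.C c * a + Polynomial.C c ^ 2 * Polynomial.X ^ (k+1)) := by
        linear_combination hr
      rw [e, pow_succ _ (k+1)]
      apply mul_dvd_mul_left
      rw [Polynomial.X_dvd_iff]
      have e2 : (2 * Polynomial.C c * a).coeff 0 = 2 * c * s := by
        rw [Polynomial.mul_coeff_zero, Polynomial.mul_coeff_zero, h2]; simp
      simp only [Polynomial.coeff_add, e2]
      rw [Polynomial.mul_coeff_zero]
      simp [hc]
      field_simp; ring

theorem aeval_T (i : Fin n) (t : ℝ) (a : Polynomial ℝ) :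
    Polynomial.aeval (C t * X i : MvPolynomial (Fin n) ℝ) a =
      ∑ j ∈ Finset.range (a.natDegree + 1), monomial (Finsupp.single i j) (a.coeff j * t ^ j) := by
  rw [Polynomial.aeval_eq_sum_range]
  apply Finset.sum_congr rfl
  intro j _
  rw [mul_pow, ← C_pow, X_pow_eq_monomial, C_mul_monomial, smul_monomial]
  simp

theorem coeff_aeval_T (i : Fin n) {δ : ℝ} (hδ : 0 < δ) (a : Polynomial ℝ) (α : Fin n →₀ ℕ) :
    |coeff α (Polynomial.aeval (C δ⁻¹ * X i : MvPolynomial (Fin n) ℝ) a)| ≤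
      (∑ j ∈ Finset.range (a.natDegree + 1), |a.coeff j|) * (δ ^ α.degree)⁻¹ := by
  rw [aeval_T, coeff_sum, Finset.sum_mul]
  refine (Finset.abs_sum_le_sum_abs _ _).trans (Finset.sum_le_sum ?_)
  intro j _
  rw [coeff_monomial]
  split_ifs with h
  · rw [← h, Finsupp.degree_single, abs_mul, inv_pow, abs_of_pos (a := (δ ^ j)⁻¹) (by positivity)]
  · rw [abs_zero]; positivity

theorem Dk_aeval_T (i : Fin n) (t : ℝ) {a : Polynomial ℝ} (ha : a.natDegree ≤ k) :
    Dk k (Polynomial.aeval (C t * X i : MvPolynomial (Fin n) ℝ) a) := by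
  intro α hα
  rw [aeval_T, coeff_sum]
  apply Finset.sum_eq_zero
  intro j hj
  rw [coeff_monomial, if_neg]
  rintro rfl
  rw [Finsupp.degree_single] at hα
  have := Finset.mem_range.mp hj
  omega

theorem coeff_zero_aeval_T (i : Fin n) (t : ℝ) (a : Polynomial ℝ) :
    coeff 0 (Polynomial.aeval (C t * X i : MvPolynomial (Fin n) ℝ) a) = a.coeff 0 := by
  rw [aeval_T, coeff_sum, Finset.sum_eq_single 0]
  · simp
  · intro j _ hj
    rw [coeff_monomial, if_neg]
    intro h
    have := congrArg (fun f => f i) h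
    simp at this
    exact hj this
  · simp

theorem trk_aeval_T (i : Fin n) (t : ℝ) {p : Polynomial ℝ} (hp : (Polynomial.X : Polynomial ℝ) ^ (k+1) ∣ p) :
    trk k (Polynomial.aeval (C t * X i : MvPolynomial (Fin n) ℝ) p) = 0 := by
  obtain ⟨r, rfl⟩ := hp
  ext α
  rw [coeff_trk, coeff_zero]
  split_ifs with h
  · rw [map_mul, map_pow, Polynomial.aeval_X, mul_pow, ← C_pow, X_pow_eq_monomial, C_mul_monomial,
      coeff_monomial_mul', if_neg]
    intro hle
    have := Finsupp.degree_mono hle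
    rw [Finsupp.degree_single] at this
    omega
  · rfl

theorem mult_zero (k n D : ℕ) (Cw : ℝ) (hCw : 1 ≤ Cw) : ∃ Cm, 1 ≤ Cm ∧
    ∀ (E : Finset (En n)) (δmax : ℝ) (G : En n → ℝ → Set (Wv n D)), GH k E δmax Cw G →
    ∀ x ∈ E, ∀ δ, 0 < δ → δ ≤ δmax → ∀ i P Q K, P + Q ∈ G x K → P - Q ∈ G x K → NB k x δ Q K →
      P + δ⁻¹ • mulV k D x i Q ∈ G x (Cm * K) := by
  obtain ⟨a, ha1, ha2, ha3⟩ := sqrtPoly k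
  set b := a.comp (-Polynomial.X) with hb
  have hb1 : b.natDegree ≤ k := by
    rw [hb, Polynomial.natDegree_comp]; simp [ha1]
  have hb2 : b.coeff 0 = √(1/2) := by
    rw [← ha2, hb, Polynomial.coeff_zero_eq_eval_zero, Polynomial.coeff_zero_eq_eval_zero]; simp
  have hb3 : (Polynomial.X : Polynomial ℝ) ^ (k+1) ∣ b ^ 2 - Polynomial.C (1/2) * (1 - Polynomial.X) := by
    obtain ⟨r, hr⟩ := ha3
    have := congrArg (fun p => Polynomial.comp p (-Polynomial.X)) hr
    simp only [Polynomial.sub_comp, Polynomial.pow_comp, Polynomial.mul_comp, Polynomial.C_comp,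
      Polynomial.add_comp, Polynomial.one_comp, Polynomial.X_comp] at this
    rw [sub_eq_add_neg (1 : Polynomial ℝ) Polynomial.X, this, neg_pow]
    exact ⟨(-1) ^ (k+1) * r.comp (-Polynomial.X), by ring⟩
  set Sa := ∑ j ∈ Finset.range (a.natDegree + 1), |a.coeff j| with hSa
  set Sb := ∑ j ∈ Finset.range (b.natDegree + 1), |b.coeff j| with hSb
  have hSa0 : 0 ≤ Sa := Finset.sum_nonneg fun _ _ => abs_nonneg _
  have hSb0 : 0 ≤ Sb := Finset.sum_nonneg fun _ _ => abs_nonneg _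
  set Cb := 2 + Sa + Sb with hCb
  have hCb1 : 1 ≤ Cb := by linarith
  have hCbp : 1 ≤ Cb ^ (k+2) := one_le_pow₀ hCb1
  refine ⟨Cw * Cb ^ (k+2), by nlinarith, ?_⟩
  intro E δmax G hG x hx δ hδ hδm i P Q K h1 h2 hQ
  have hK := hG.pos _ _ _ h1
  set T : MvPolynomial (Fin n) ℝ := C δ⁻¹ * X i with hT
  have hs2 : |√(1/2:ℝ)| ≤ 1 := by
    rw [abs_of_nonneg (Real.sqrt_nonneg _)]
    exact Real.sqrt_le_one.mpr (by norm_num)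
  have hDP : DV k P := by
    have : P = (1/2:ℝ) • ((P + Q) + (P - Q)) := by module
    rw [this]; exact ((hG.deg _ _ _ h1).add (hG.deg _ _ _ h2)).smul _
  have hDQ : DV k Q := by
    have : Q = (1/2:ℝ) • ((P + Q) - (P - Q)) := by module
    rw [this]; exact ((hG.deg _ _ _ h1).sub (hG.deg _ _ _ h2)).smul _
  have hsum : trk k (Polynomial.aeval T a * Polynomial.aeval T a + Polynomial.aeval T b * Polynomial.aeval T b) = 1 := by
    have h3 : (Polynomial.X : Polynomial ℝ) ^ (k+1) ∣ (a * a + b * b) - 1 := by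
      have e : (a * a + b * b) - 1 = (a ^ 2 - Polynomial.C (1/2) * (1 + Polynomial.X)) +
        (b ^ 2 - Polynomial.C (1/2) * (1 - Polynomial.X)) := by
        have : (1 : Polynomial ℝ) = Polynomial.C (1/2) * 2 := by
          rw [show (2 : Polynomial ℝ) = Polynomial.C 2 from rfl, ← Polynomial.C_mul]; norm_num
        linear_combination -this
      rw [e]; exact dvd_add ha3 hb3
    have h4 := trk_aeval_T (n := n) (k := k) i δ⁻¹ h3
    rw [map_sub, map_sub, map_one, map_add, map_mul, map_mul, sub_eq_zero] at h4
    rw [h4]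
    apply trk_of_Dk
    intro α hα
    rw [coeff_one, if_neg]
    rintro rfl
    simp at hα
  have hdiff : trk k (Polynomial.aeval T a * Polynomial.aeval T a - Polynomial.aeval T b * Polynomial.aeval T b) = trk k T := by
    have h3 : (Polynomial.X : Polynomial ℝ) ^ (k+1) ∣ (a * a - b * b) - Polynomial.X := by
      have e : (a * a - b * b) - Polynomial.X = (a ^ 2 - Polynomial.C (1/2) * (1 + Polynomial.X)) -
        (b ^ 2 - Polynomial.C (1/2) * (1 - Polynomial.X)) := by
        have : (1 : Polynomial ℝ) = Polynomial.C (1/2) * 2 := by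
          rw [show (2 : Polynomial ℝ) = Polynomial.C 2 from rfl, ← Polynomial.C_mul]; norm_num
        linear_combination -Polynomial.X * this
      rw [e]; exact dvd_sub ha3 hb3
    have h4 := trk_aeval_T (n := n) (k := k) i δ⁻¹ h3
    rw [map_sub, map_sub, map_sub, map_mul, map_mul, Polynomial.aeval_X, sub_eq_zero] at h4
    exact h4
  have hw := hG.whC (Cb := Cb) hCb1 hδ (δ := δ) (by nlinarith [hG.dpos]) hx h1 h2
    (Q1 := ush x (Polynomial.aeval T a)) (Q2 := ush x (Polynomial.aeval T b)) ?_
    ((Dk_aeval_T i _ ha1).ush x) ((Dk_aeval_T i _ hb1).ush x) ?_ ?_ ?_ ?_ ?_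
  · convert hw using 1
    funext j
    apply shp_inj x
    rw [map_add, shp_odot, shp_odot, shp_odot, shp_odot, shp_ush, shp_ush, trk_mul_trk, trk_mul_trk,
      ← map_add]
    set A := Polynomial.aeval T a
    set B := Polynomial.aeval T b
    have e : A * A * shp x ((P + Q) j) + B * B * shp x ((P - Q) j) =
      (A * A + B * B) * shp x (P j) + (A * A - B * B) * shp x (Q j) := by
      simp only [Pi.add_apply, Pi.sub_apply, map_add, map_sub]; ring
    rw [e, map_add (trk k), ← trk_mul_trk k (A * A + B * B), hsum, ← trk_mul_trk k (A * A - B * B), hdiff,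
      trk_mul_trk, one_mul, trk_of_Dk ((hDP j).shp x), Pi.add_apply, map_add, Pi.smul_apply, map_smul, mulV_apply,
      mulX_apply, shp_ush, trk_of_Dk (hDQ j), hT, mul_assoc, ← smul_eq_C_mul, map_smul]
  · have e : (P + Q) - (P - Q) = (2:ℝ) • Q := by module
    rw [e]
    have := hQ.smul 2
    exact this.mono hδ.le le_rfl (by rw [abs_of_pos (by norm_num)]; nlinarith) (by positivity)
  · intro α
    rw [shp_ush]
    refine (coeff_aeval_T i hδ a α.1).trans ?_
    gcongr
    linarith
  · intro α
    rw [shp_ush]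
    refine (coeff_aeval_T i hδ b α.1).trans ?_
    gcongr
    linarith
  · rw [shp_ush, coeff_zero_aeval_T, ha2]; exact hs2
  · rw [shp_ush, coeff_zero_aeval_T, hb2]; exact hs2
  · apply shp_inj x
    rw [map_add, shp_odot, shp_odot, shp_ush, shp_ush, ← map_add, hsum, map_one]

end Shape

section Shape2
open MvPolynomial
variable {n D k : ℕ}

def Gl (k : ℕ) {n D : ℕ} (E : Finset (En n)) (G : En n → ℝ → Set (Wv n D)) : ℕ → En n → ℝ → Set (Wv n D)
  | 0 => G
  | l + 1 => fun x K => {P | P ∈ Gl k E G l x K ∧ ∀ y ∈ E, ∃ P' ∈ Gl k E G l y K, NB k x (dist x y) (P - P') K}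

theorem Gl_succ_sub {E : Finset (En n)} {G : En n → ℝ → Set (Wv n D)} {l : ℕ} {x : En n} {K : ℝ} {P : Wv n D}
    (h : P ∈ Gl k E G (l+1) x K) : P ∈ Gl k E G l x K := h.1

theorem Gl_sub {E : Finset (En n)} {G : En n → ℝ → Set (Wv n D)} {l l' : ℕ} (hl : l' ≤ l) {x : En n} {K : ℝ} {P : Wv n D}
    (h : P ∈ Gl k E G l x K) : P ∈ Gl k E G l' x K := by
  induction hl with
  | refl => exact h
  | step _ ih => exact ih h.1

theorem NB.convex {x : En n} {δ K : ℝ} {P Q : Wv n D} (hP : NB k x δ P K) (hQ : NB k x δ Q K) {a b : ℝ}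
    (ha : 0 ≤ a) (hb : 0 ≤ b) (hab : a + b = 1) : NB k x δ (a • P + b • Q) K := by
  have := (hP.smul a).add (hQ.smul b)
  rwa [abs_of_nonneg ha, abs_of_nonneg hb, ← add_mul, hab, one_mul] at this

theorem GH.cml {E : Finset (En n)} {δmax Cw : ℝ} {G : En n → ℝ → Set (Wv n D)} (hG : GH k E δmax Cw G)
    (l : ℕ) (x : En n) : CM (Gl k E G l x) := by
  induction l generalizing x with
  | zero => exact hG.cm x
  | succ l ih =>
    constructor
    · intro K P hP Q hQ a b ha hb hab
      refine ⟨(ih x).conv K hP.1 hQ.1 ha hb hab, ?_⟩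
      intro y hy
      obtain ⟨P', hP', h1⟩ := hP.2 y hy
      obtain ⟨Q', hQ', h2⟩ := hQ.2 y hy
      refine ⟨a • P' + b • Q', (ih y).conv K hP' hQ' ha hb hab, ?_⟩
      have := NB.convex h1 h2 ha hb hab
      convert this using 1
      module
    · intro K K' hK P hP
      refine ⟨(ih x).mono _ _ hK hP.1, ?_⟩
      intro y hy
      obtain ⟨P', hP', h1⟩ := hP.2 y hy
      have hK0 := hG.pos _ _ _ (Gl_sub (Nat.zero_le _) hP')
      exact ⟨P', (ih y).mono _ _ hK hP', h1.mono dist_nonneg le_rfl hK (by linarith)⟩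

theorem GH.degl {E : Finset (En n)} {δmax Cw : ℝ} {G : En n → ℝ → Set (Wv n D)} (hG : GH k E δmax Cw G)
    {l : ℕ} {x : En n} {K : ℝ} {P : Wv n D} (h : P ∈ Gl k E G l x K) : DV k P :=
  hG.deg _ _ _ (Gl_sub (Nat.zero_le _) h)

theorem GH.posl {E : Finset (En n)} {δmax Cw : ℝ} {G : En n → ℝ → Set (Wv n D)} (hG : GH k E δmax Cw G)
    {l : ℕ} {x : En n} {K : ℝ} {P : Wv n D} (h : P ∈ Gl k E G l x K) : 0 < K :=
  hG.pos _ _ _ (Gl_sub (Nat.zero_le _) h)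

/-- commutator estimate for the truncated multiplications at two points. -/
theorem mulX_diff {x y : En n} {i : Fin n} {p : MvPolynomial (Fin n) ℝ} (hp : Dk k p) {B d δ : ℝ} (hB : 0 ≤ B)
    (hd : dist y x ≤ d)
    (hb : ∀ γ : Mi k n, |cf k y γ.1 p| ≤ B * δ ^ (k + 1 - γ.1.degree)) (hδ : 0 ≤ δ)
    (α : Mi k n) :
    |cf k x α.1 (mulX k x i p - mulX k y i p - (y i - x i) • p)| ≤
      (Fintype.card (Mi (k+1) n) * 2 ^ (k+1)) * (B * δ * d ^ (k + 1 - α.1.degree)) := by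
  have hd0 : 0 ≤ d := dist_nonneg.trans hd
  set q := shp y p with hq
  have hDq : Dk k q := hp.shp y
  set h := x - y with hh
  set top := X i * q - trk k (X i * q) with htop
  have hDt : Dk (k+1) top := by
    intro γ hγ
    rw [htop, coeff_sub, coeff_trk, if_neg (by omega), sub_zero, coeff_X_mul']
    split_ifs with hi
    · have := degree_sub_single hi
      exact hDq _ (by omega)
    · rfl
  have hct : ∀ γ : Mi (k+1) n, |coeff γ.1 top| ≤ if γ.1.degree = k + 1 then B * δ else 0 := by
    intro γ
    by_cases hdg : γ.1.degree = k + 1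
    · rw [if_pos hdg, htop, coeff_sub, coeff_trk, if_neg (by omega), sub_zero, coeff_X_mul']
      split_ifs with hi
      · have h1 := degree_sub_single hi
        have h2 := hb ⟨γ.1 - Finsupp.single i 1, by omega⟩
        rw [cf_of_Dk _ _ hp] at h2
        have e : k + 1 - (γ.1 - Finsupp.single i 1).degree = 1 := by omega
        simp only [e, pow_one] at h2
        exact h2
      · rw [abs_zero]; positivity
    · rw [if_neg hdg, htop, coeff_sub, coeff_trk, if_pos (by have := γ.2; omega), sub_self, abs_zero]
  have hD3 : Dk k (mulX k x i p - mulX k y i p - (y i - x i) • p) :=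
    ((Dk_mulX _ _ _ _).sub (Dk_mulX _ _ _ _)).sub (hp.smul _)
  rw [cf_of_Dk _ _ hD3]
  have hqx : shp x p = shp h q := by rw [hq, hh, shp_shp]
  have e1 : coeff α.1 (shp x (mulX k x i p)) = coeff α.1 (X i * shp h q) := by
    rw [mulX_apply, shp_ush, coeff_trk, if_pos α.2, trk_of_Dk hp, hqx]
  have e2 : shp x (mulX k y i p) = (X i + C (h i)) * shp h q - shp h top := by
    rw [mulX_apply, ← shp_shp y x, shp_ush, trk_of_Dk hp, ← hq, ← hh]
    have : trk k (X i * q) = X i * q - top := by rw [htop]; ring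
    rw [this, map_sub, map_mul, shp_X]
  have e3 : coeff α.1 (shp x (mulX k x i p - mulX k y i p - (y i - x i) • p)) = coeff α.1 (shp h top) := by
    rw [map_sub, map_sub, coeff_sub, coeff_sub, e1, e2, map_smul, hqx, add_mul, coeff_sub, coeff_add,
      coeff_C_mul, coeff_smul]
    have : h i = x i - y i := by rw [hh]; rfl
    rw [this, smul_eq_mul]; ring
  rw [e3, coeff_shp_Mi hDt]
  refine (Finset.abs_sum_le_sum_abs _ _).trans ?_
  calc ∑ γ : Mi (k+1) n, |aco α.1 γ.1 h * coeff γ.1 top| ≤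
      ∑ γ : Mi (k+1) n, 2 ^ (k+1) * (B * δ * d ^ (k + 1 - α.1.degree)) := by
        apply Finset.sum_le_sum
        intro γ _
        rw [abs_mul]
        have h1 := hct γ
        by_cases hdg : γ.1.degree = k + 1
        · rw [if_pos hdg] at h1
          have h2 := aco_le (α := α.1) (γ := γ.1) (h := h) (coord_le_dist y x) dist_nonneg hd
            (K := k + 1) γ.2
          rw [hdg, Nat.sub_self, pow_zero, mul_one] at h2
          calc _ ≤ (2 ^ (k+1) * d ^ (k + 1 - α.1.degree)) * (B * δ) :=
                mul_le_mul h2 h1 (abs_nonneg _) (by positivity)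
            _ = _ := by ring
        · rw [if_neg hdg] at h1
          have : |coeff γ.1 top| = 0 := le_antisymm h1 (abs_nonneg _)
          rw [this, mul_zero]; positivity
    _ = _ := by rw [Finset.sum_const, Finset.card_univ, nsmul_eq_mul]; ring

theorem multProp (k n D : ℕ) (Cw : ℝ) (hCw : 1 ≤ Cw) (l : ℕ) : ∃ Cm, 1 ≤ Cm ∧
    ∀ (E : Finset (En n)) (δmax : ℝ) (G : En n → ℝ → Set (Wv n D)), GH k E δmax Cw G →
    ∀ x ∈ E, ∀ δ, 0 < δ → δ ≤ δmax → ∀ i P Q K, P + Q ∈ Gl k E G l x K → P - Q ∈ Gl k E G l x K → NB k x δ Q K →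
      P + δ⁻¹ • mulV k D x i Q ∈ Gl k E G l x (Cm * K) := by
  induction l with
  | zero => exact mult_zero k n D Cw hCw
  | succ l ih =>
    obtain ⟨Cm, hCm, H⟩ := ih
    have hsh := one_le_Csh (k := k) (n := n)
    set N : ℝ := Fintype.card (Mi (k+1) n) * 2 ^ (k+1) with hN
    have hN0 : 0 ≤ N := by positivity
    have hp2 : (1:ℝ) ≤ 2 ^ (k+1) := one_le_pow₀ (by norm_num)
    set t : ℝ := 2 ^ (k+1) * (2 * Csh k n) with ht
    have ht1 : 1 ≤ t := by rw [ht]; nlinarith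
    have hCt : Cm ≤ Cm * t := by nlinarith
    set Cf := Cm * t + (2 + 2 ^ (k+1) + N * (2 * Csh k n)) with hCf
    have hNC : 0 ≤ N * (2 * Csh k n) := by positivity
    refine ⟨Cf, by linarith, ?_⟩
    intro E δmax G hG x hx δ hδ hδm i P Q K h1 h2 hQ
    have hK := hG.posl h1
    have hmono : ∀ {a : ℝ}, a ≤ Cf → a * K ≤ Cf * K := fun h => mul_le_mul_of_nonneg_right h hK.le
    refine ⟨(hG.cml l x).mono _ _ (hmono (by linarith)) (H E δmax G hG x hx δ hδ hδm i P Q K h1.1 h2.1 hQ), ?_⟩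
    intro y hy
    obtain ⟨Pp, hPp, np⟩ := h1.2 y hy
    obtain ⟨Pm, hPm, nm⟩ := h2.2 y hy
    set d := dist x y with hd
    have hd0 : 0 ≤ d := dist_nonneg
    set P' := (1/2:ℝ) • Pp + (1/2:ℝ) • Pm with hP'
    set Q' := (1/2:ℝ) • Pp - (1/2:ℝ) • Pm with hQ'
    have nP : NB k x d (P - P') K := by
      have := NB.convex np nm (a := 1/2) (b := 1/2) (by norm_num) (by norm_num) (by norm_num)
      convert this using 1
      rw [hP']; module
    have nQ : NB k x d (Q - Q') K := by
      have := NB.convex np nm.neg (a := 1/2) (b := 1/2) (by norm_num) (by norm_num) (by norm_num)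
      convert this using 1
      rw [hQ']; module
    by_cases hdδ : δ / 2 ≤ d
    · refine ⟨P', (hG.cml l y).mono _ _ ?_ ((hG.cml l y).conv K hPp hPm (by norm_num) (by norm_num) (by norm_num)), ?_⟩
      · have := hmono (a := 1) (by linarith); linarith
      · have n1 : NB k x δ (δ⁻¹ • mulV k D x i Q) K := by
          intro β
          rw [map_smul, smul_eq_mul, abs_mul, abs_of_pos (by positivity), inv_mul_le_iff₀ hδ]
          exact hQ.mulV hδ.le hK.le i β
        have n2 := n1.rescale (δ' := d) (t := 2) hδ.le hd0 (by norm_num) hK.le (by linarith)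
        have n3 := nP.add n2
        have e : P - P' + δ⁻¹ • mulV k D x i Q = P + δ⁻¹ • mulV k D x i Q - P' := by abel
        rw [e] at n3
        refine n3.mono hd0 le_rfl ?_ (by positivity)
        have := hmono (a := 1 + 2 ^ (k+1)) (by nlinarith)
        linarith
    · push Not at hdδ
      have hDQ' : DV k Q' := ((hG.degl hPp).smul _).sub ((hG.degl hPm).smul _)
      have nQ' : NB k x δ Q' (2 * K) := by
        have n1 := hQ.sub (nQ.mono hd0 (by linarith : d ≤ δ) le_rfl hK.le)
        have e : Q - (Q - Q') = Q' := by abel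
        rw [e] at n1
        convert n1 using 1; ring
      have nQy : NB k y δ Q' (Csh k n * (2 * K)) := nQ'.shift (by positivity) (by linarith)
      have nQy2 : NB k y (δ/2) Q' (t * K) := by
        have := nQy.rescale (δ' := δ/2) (t := 2) hδ.le (by positivity) (by norm_num) (by positivity) (by linarith)
        convert this using 1
        rw [ht]; ring
      have htK : K ≤ t * K := by nlinarith
      have ep : P' + Q' = Pp := by rw [hP', hQ']; module
      have em : P' - Q' = Pm := by rw [hP', hQ']; module
      have m1 := H E δmax G hG y hy (δ/2) (by positivity) (by linarith) i P' Q' (t * K)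
        (by rw [ep]; exact (hG.cml l y).mono _ _ htK hPp) (by rw [em]; exact (hG.cml l y).mono _ _ htK hPm) nQy2
      set θ := (y i - x i) / δ with hθ
      have hθ1 : |2 * θ| ≤ 1 := by
        have := coord_le_dist x y i
        have e : (y - x) i = y i - x i := rfl
        rw [e] at this
        rw [hθ, abs_mul, abs_div, abs_of_pos hδ, abs_of_pos (by norm_num : (0:ℝ) < 2), ← mul_div_assoc,
          div_le_one hδ]
        linarith
      have m2 : P' + (2 * θ) • Q' ∈ Gl k E G l y K := by
        rw [abs_le] at hθ1
        have := (hG.cml l y).conv K hPp hPm (a := (1 + 2 * θ)/2) (b := (1 - 2 * θ)/2) (by linarith) (by linarith) (by ring)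
        convert this using 1
        rw [hP', hQ']; module
      have m3 := (hG.cml l y).conv (Cm * (t * K)) m1 ((hG.cml l y).mono _ _ (by nlinarith) m2)
        (a := 1/2) (b := 1/2) (by norm_num) (by norm_num) (by norm_num)
      refine ⟨_, (hG.cml l y).mono _ _ (by rw [← mul_assoc]; exact hmono (by linarith)) m3, ?_⟩
      have e : P + δ⁻¹ • mulV k D x i Q -
          ((1/2:ℝ) • (P' + (δ/2)⁻¹ • mulV k D y i Q') + (1/2:ℝ) • (P' + (2 * θ) • Q')) =
          (P - P') + δ⁻¹ • mulV k D x i (Q - Q') +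
            δ⁻¹ • (mulV k D x i Q' - mulV k D y i Q' - (y i - x i) • Q') := by
        have hms : mulV k D x i (Q - Q') = mulV k D x i Q - mulV k D x i Q' := map_sub _ _ _
        rw [hms, hθ]
        have h5 : (δ/2)⁻¹ = 2 * δ⁻¹ := by field_simp
        have h6 : 2 * ((y i - x i) / δ) = 2 * (δ⁻¹ * (y i - x i)) := by field_simp
        rw [h5, h6]; module
      rw [e]
      have n1 : NB k x d (δ⁻¹ • mulV k D x i (Q - Q')) K := by
        intro β
        rw [map_smul, smul_eq_mul, abs_mul, abs_of_pos (by positivity), inv_mul_le_iff₀ hδ]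
        refine (nQ.mulV hd0 hK.le i β).trans ?_
        apply mul_le_mul_of_nonneg_right (by linarith)
        positivity
      have n2 : NB k x d (δ⁻¹ • (mulV k D x i Q' - mulV k D y i Q' - (y i - x i) • Q')) (N * (2 * Csh k n) * K) := by
        intro β
        rw [map_smul, smul_eq_mul, abs_mul, abs_of_pos (by positivity), inv_mul_le_iff₀ hδ]
        have := mulX_diff (k := k) (x := x) (y := y) (i := i) (hDQ' β.2) (B := Csh k n * (2 * K)) (d := d) (δ := δ)
          (by positivity) (by rw [hd, dist_comm]) (fun γ => nQy (γ, β.2)) hδ.le β.1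
        refine le_trans this (le_of_eq ?_)
        unfold dgI
        rw [← hN]; ring
      refine ((nP.add n1).add n2).mono hd0 le_rfl ?_ (by positivity)
      have := hmono (a := 2 + N * (2 * Csh k n)) (by nlinarith)
      linarith

theorem multAt (k n D : ℕ) (Cw : ℝ) (hCw : 1 ≤ Cw) (l : ℕ) : ∃ Cm, 1 ≤ Cm ∧
    ∀ (E : Finset (En n)) (δmax : ℝ) (G : En n → ℝ → Set (Wv n D)), GH k E δmax Cw G →
    ∀ x ∈ E, ∀ δ, 0 < δ → δ ≤ δmax →
      MultAt (IX k n D) (Gl k E G l x) (nu k x δ) (fun i => δ⁻¹ • mulV k D x i) Cm := by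
  obtain ⟨Cm, hCm, H⟩ := multProp k n D Cw hCw l
  refine ⟨Cm, hCm, ?_⟩
  intro E δmax G hG x hx δ hδ hδm
  constructor
  · intro i β γ hs Q
    have h1 := dgI_sh hs
    have h2 := dgI_le γ
    rw [LinearMap.smul_apply, nu_apply, nu_apply, map_smul, cc_mulV_sh hs, smul_eq_mul,
      show k + 1 - dgI β = (k + 1 - dgI γ) + 1 by omega, pow_succ, mul_inv]
    ring
  · intro i γ hs Q
    rw [LinearMap.smul_apply, nu_apply, map_smul, cc_mulV_zero hs, smul_zero, mul_zero]
  · intro i P Q K hK h1 h2 hQ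
    have hNB := (NB_iff hδ).mpr hQ
    refine ⟨H E δmax G hG x hx δ hδ hδm i P Q K h1 h2 hNB, ?_⟩
    have := H E δmax G hG x hx δ hδ hδm i P (-Q) K (by rw [← sub_eq_add_neg]; exact h2)
      (by rw [sub_neg_eq_add]; exact h1) hNB.neg
    rwa [map_neg, smul_neg, ← sub_eq_add_neg] at this

def sco (k : ℕ) (x y : En n) (δ : ℝ) (β γ : Idx k n D) : ℝ :=
  if γ.2 = β.2 then (δ ^ (k + 1 - dgI β))⁻¹ * aco β.1.1 γ.1.1 (y - x) * δ ^ (k + 1 - dgI γ) else 0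

theorem nu_shift (x y : En n) {δ : ℝ} (hδ : 0 < δ) (β : Idx k n D) (P : Wv n D) :
    nu k y δ β P = ∑ γ, sco k x y δ β γ * nu k x δ γ P := by
  rw [nu_apply, cc_apply, cf_shift k x y, Fintype.sum_prod_type, Finset.mul_sum]
  apply Finset.sum_congr rfl
  intro γ _
  rw [Finset.sum_eq_single β.2]
  · rw [sco, if_pos rfl, nu_apply, cc_apply]
    have : δ ^ (k + 1 - dgI (γ, β.2)) ≠ 0 := by positivity
    field_simp
  · intro j _ hj
    rw [sco, if_neg hj, zero_mul]
  · intro h; exact absurd (Finset.mem_univ _) h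

theorem transportG (k n D : ℕ) (A : Finset (Idx k n D)) (hA : (IX k n D).Mono A) (C : ℝ) (hC : 1 ≤ C) :
    ∃ AT, 1 ≤ AT ∧ ∃ CT, 1 ≤ CT ∧ ∀ (E : Finset (En n)) (δmax Cw : ℝ) (G : En n → ℝ → Set (Wv n D)),
      GH k E δmax Cw G → ∀ l, ∀ x, ∀ y ∈ E, ∀ δ, 0 < δ → AT * dist x y ≤ δ → ∀ P0,
      Strong (Gl k E G (l+1) x) (nu k x δ) A P0 C →
      ∃ P', (∀ α ∈ A, nu k y δ α (P' - P0) = 0) ∧ (∀ β, |nu k y δ β (P' - P0)| ≤ CT) ∧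
        Strong (Gl k E G l y) (nu k y δ) A P' CT := by
  obtain ⟨ε, hε, hε1, CT, hCT, H⟩ := transport (W := Wv n D) A C hC
  have hsh := one_le_Csh (k := k) (n := n)
  have hp : (1:ℝ) ≤ 2 ^ k := one_le_pow₀ (by norm_num)
  refine ⟨(Csh k n + 2 ^ k) / ε, ?_, CT, hCT, ?_⟩
  · rw [le_div_iff₀ hε]; linarith
  intro E δmax Cw G hG l x y hy δ hδ hd P0 hS
  have hd2 : (Csh k n + 2 ^ k) * dist x y ≤ ε * δ := by
    rw [div_mul_eq_mul_div, div_le_iff₀ hε] at hd; linarith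
  have hd0 : 0 ≤ dist x y := dist_nonneg
  have hcd : Csh k n * dist x y ≤ ε * δ := by nlinarith
  have hpd : 2 ^ k * dist x y ≤ ε * δ := by nlinarith
  have hdδ : dist x y ≤ δ := by nlinarith
  refine H (Gl k E G (l+1) x) (Gl k E G l y) (nu k x δ) (nu k y δ) (sco k x y δ) P0 (hG.cml l y)
    (fun β Q => nu_shift x y hδ β Q) ?_ ?_ ?_ ?_ hS
  · intro β
    rw [sco, if_pos rfl, aco_self, mul_one, inv_mul_cancel₀ (by positivity)]
  · intro β γ hne
    rw [sco]
    split_ifs with hj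
    · by_cases hle : β.1.1 ≤ γ.1.1
      · have hlt : β.1.1.degree < γ.1.1.degree := by
          rcases (Finsupp.degree_mono hle).lt_or_eq with h | h
          · exact h
          · exfalso
            apply hne
            refine Prod.ext (Subtype.ext ?_) hj
            obtain ⟨c, hc⟩ := le_iff_exists_add.mp hle
            rw [hc, map_add] at h
            have : c.degree = 0 := by omega
            rw [hc, (Finsupp.degree_eq_zero_iff _).mp this, add_zero]
        have hb := aco_bound (y - x) (coord_le_dist x y) γ.1.1 β.1.1 hle
        set e := γ.1.1.degree - β.1.1.degree with he
        have hγ := γ.1.2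
        have e1 : k + 1 - dgI β = (k + 1 - dgI γ) + (e - 1) + 1 := by
          have : e = Finsupp.degree γ.1.1 - Finsupp.degree β.1.1 := he
          unfold dgI; omega
        have hpos : 0 < δ ^ (k + 1 - dgI γ) := by positivity
        rw [abs_mul, abs_mul, abs_of_pos hpos, abs_of_pos (inv_pos.mpr (by positivity)), mul_assoc,
          inv_mul_le_iff₀ (by positivity), e1, pow_succ, pow_add]
        calc |aco β.1.1 γ.1.1 (y - x)| * δ ^ (k + 1 - dgI γ) ≤
            (2 ^ γ.1.1.degree * dist x y ^ e) * δ ^ (k + 1 - dgI γ) := by gcongr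
          _ ≤ (2 ^ k * (dist x y ^ (e - 1) * dist x y)) * δ ^ (k + 1 - dgI γ) := by
            rw [← pow_succ, show e - 1 + 1 = e by omega]
            gcongr
            norm_num
          _ = (2 ^ k * dist x y) * dist x y ^ (e - 1) * δ ^ (k + 1 - dgI γ) := by ring
          _ ≤ (ε * δ) * δ ^ (e - 1) * δ ^ (k + 1 - dgI γ) := by gcongr
          _ = _ := by ring
      · rw [aco_eq_zero _ _ _ hle]; simp [hε.le]
    · rw [abs_zero]; exact hε.le
  · intro β hβ γ hγ
    rw [sco]
    split_ifs with hj
    · have hle : ¬ β.1.1 ≤ γ.1.1 := fun h => hγ (Mono_le hA hβ h hj)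
      rw [aco_eq_zero _ _ _ hle, mul_zero, zero_mul]
    · rfl
  · intro P hP
    obtain ⟨P', hP', h1⟩ := hP.2 y hy
    refine ⟨P', hP', ?_⟩
    have h2 := h1.symm.shift (by linarith) le_rfl
    intro β
    have h3 := h2 β
    have hp : 0 < δ ^ (k + 1 - dgI β) := by positivity
    rw [nu_apply, abs_mul, abs_of_pos (inv_pos.mpr hp), inv_mul_le_iff₀ hp]
    refine h3.trans ?_
    have hβ := dgI_le β
    rw [show k + 1 - dgI β = (k - dgI β) + 1 by omega, pow_succ, pow_succ]
    calc Csh k n * C * (dist x y ^ (k - dgI β) * dist x y) =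
        C * dist x y ^ (k - dgI β) * (Csh k n * dist x y) := by ring
      _ ≤ C * δ ^ (k - dgI β) * (ε * δ) := by gcongr
      _ = _ := by ring

end Shape2

section HellyPart
open MvPolynomial
variable {n D k : ℕ}

abbrev Vf (k n D : ℕ) := Fin D → restrictTotalDegree (Fin n) ℝ k

def vin (k n D : ℕ) : Vf k n D →ₗ[ℝ] Wv n D := (restrictTotalDegree (Fin n) ℝ k).subtype.compLeft (Fin D)

theorem vin_surj {P : Wv n D} (h : DV k P) : ∃ v : Vf k n D, vin k n D v = P := by
  refine ⟨fun j => ⟨P j, ?_⟩, ?_⟩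
  · rw [mem_restrictTotalDegree, ← Dk_iff]; exact h j
  · rfl

def dV (k n D : ℕ) : ℕ := Module.finrank ℝ (Vf k n D) + 1

theorem helly_fin {ι : Type*} (E : Finset ι) (T : Finset ι → Set (Wv n D)) (κ : ℕ)
    (hconv : ∀ S, Convex ℝ (T S)) (hanti : ∀ S S', S ⊆ S' → T S' ⊆ T S)
    (hex : ∀ S, S ⊆ E → S.card ≤ dV k n D * κ → ∃ P, DV k P ∧ P ∈ T S) :
    ∃ P, ∀ S, S ⊆ E → S.card ≤ κ → P ∈ T S := by
  have := Convex.helly_theorem' (𝕜 := ℝ) (E := Vf k n D) (F := fun S : Finset ι => (vin k n D) ⁻¹' (T S))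
    (s := E.powerset.filter (fun S => S.card ≤ κ)) (fun S _ => (hconv S).linear_preimage (vin k n D)) ?_
  · obtain ⟨v, hv⟩ := this
    refine ⟨vin k n D v, fun S hS hc => ?_⟩
    simp only [Set.mem_iInter, Finset.mem_filter, Finset.mem_powerset] at hv
    exact hv S ⟨hS, hc⟩
  · intro I hI hc
    obtain ⟨P, hP, hP2⟩ := hex (I.biUnion id) (by
      intro z hz
      simp only [Finset.mem_biUnion, id] at hz
      obtain ⟨S, hS, hz⟩ := hz
      have := hI hS
      simp only [Finset.mem_filter, Finset.mem_powerset] at this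
      exact this.1 hz) (by
      refine (Finset.card_biUnion_le_card_mul I id κ ?_).trans (Nat.mul_le_mul_right _ hc)
      intro S hS
      have := hI hS
      simp only [Finset.mem_filter, Finset.mem_powerset] at this
      exact this.2)
    obtain ⟨v, hv⟩ := vin_surj hP
    refine ⟨v, ?_⟩
    simp only [Set.mem_iInter, Set.mem_preimage]
    intro S hS
    rw [hv]
    exact hanti S _ (Finset.subset_biUnion_of_mem id hS) hP2

def Valid (k : ℕ) (G : En n → ℝ → Set (Wv n D)) (S : Finset (En n)) (f : En n → Wv n D) : Prop :=
  (∀ z ∈ S, f z ∈ G z 1) ∧ ∀ z ∈ S, ∀ w ∈ S, NB k z (dist z w) (f z - f w) 1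

theorem Valid.sub {G : En n → ℝ → Set (Wv n D)} {S S' : Finset (En n)} {f : En n → Wv n D}
    (h : Valid k G S' f) (hS : S ⊆ S') : Valid k G S f :=
  ⟨fun z hz => h.1 z (hS hz), fun z hz w hw => h.2 z (hS hz) w (hS hw)⟩

theorem Valid.convex {G : En n → ℝ → Set (Wv n D)} (hG : ∀ x, Convex ℝ (G x 1)) {S : Finset (En n)} {f g : En n → Wv n D}
    (hf : Valid k G S f) (hg : Valid k G S g) {a b : ℝ} (ha : 0 ≤ a) (hb : 0 ≤ b) (hab : a + b = 1) :
    Valid k G S (fun z => a • f z + b • g z) := by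
  refine ⟨fun z hz => hG z (hf.1 z hz) (hg.1 z hz) ha hb hab, fun z hz w hw => ?_⟩
  have := NB.convex (hf.2 z hz w hw) (hg.2 z hz w hw) ha hb hab
  convert this using 1
  module

def Gk (k : ℕ) (E : Finset (En n)) (G : En n → ℝ → Set (Wv n D)) (κ : ℕ) (x : En n) : Set (Wv n D) :=
  {P | ∀ S, S ⊆ E → S.card ≤ κ → ∃ f, f x = P ∧ Valid k G (insert x S) f}

theorem Gk_step {E : Finset (En n)} {δmax Cw : ℝ} {G : En n → ℝ → Set (Wv n D)} (hG : GH k E δmax Cw G) {κ : ℕ}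
    {x : En n} {P : Wv n D} (hP : P ∈ Gk k E G (dV k n D * κ + 1) x) {y : En n} (hy : y ∈ E) :
    ∃ P' ∈ Gk k E G κ y, NB k x (dist x y) (P - P') 1 := by
  have key := helly_fin (k := k) (n := n) (D := D) E
    (fun S => {P' | ∃ f, f x = P ∧ f y = P' ∧ Valid k G (insert x (insert y S)) f}) κ ?_ ?_ ?_
  · obtain ⟨P', hP'⟩ := key
    refine ⟨P', ?_, ?_⟩
    · intro S hS hc
      obtain ⟨f, h1, h2, h3⟩ := hP' S hS hc
      exact ⟨f, h2, h3.sub (Finset.subset_insert _ _)⟩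
    · obtain ⟨f, h1, h2, h3⟩ := hP' ∅ (by simp) (by simp)
      have := h3.2 x (by simp) y (by simp)
      rwa [h1, h2] at this
  · rintro S P1 ⟨f, f1, f2, f3⟩ P2 ⟨g, g1, g2, g3⟩ a b ha hb hab
    refine ⟨fun z => a • f z + b • g z, ?_, ?_, Valid.convex (fun x => (hG.cm x).conv 1) f3 g3 ha hb hab⟩
    · simp only [f1, g1]
      rw [← add_smul, hab, one_smul]
    · simp only [f2, g2]
  · rintro S S' hS P1 ⟨f, f1, f2, f3⟩
    exact ⟨f, f1, f2, f3.sub (Finset.insert_subset_insert _ (Finset.insert_subset_insert _ hS))⟩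
  · intro S hS hc
    obtain ⟨f, f1, f2⟩ := hP (insert y S) (Finset.insert_subset hy hS) ((Finset.card_insert_le _ _).trans (by omega))
    exact ⟨f y, hG.deg _ _ _ (f2.1 y (by simp)), f, f1, rfl, f2⟩

theorem Gk_nonempty {E : Finset (En n)} {δmax Cw : ℝ} {G : En n → ℝ → Set (Wv n D)} (hG : GH k E δmax Cw G) {κ : ℕ}
    (hV : ∀ S, S ⊆ E → S.card ≤ dV k n D * κ + 1 → ∃ f, Valid k G S f) {x : En n} (hx : x ∈ E) :
    ∃ P, P ∈ Gk k E G κ x := by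
  have key := helly_fin (k := k) (n := n) (D := D) E
    (fun S => {P' | ∃ f, f x = P' ∧ Valid k G (insert x S) f}) κ ?_ ?_ ?_
  · obtain ⟨P', hP'⟩ := key
    exact ⟨P', fun S hS hc => hP' S hS hc⟩
  · rintro S P1 ⟨f, f1, f3⟩ P2 ⟨g, g1, g3⟩ a b ha hb hab
    refine ⟨fun z => a • f z + b • g z, ?_, Valid.convex (fun x => (hG.cm x).conv 1) f3 g3 ha hb hab⟩
    simp only [f1, g1]
  · rintro S S' hS P1 ⟨f, f1, f3⟩
    exact ⟨f, f1, f3.sub (Finset.insert_subset_insert _ hS)⟩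
  · intro S hS hc
    obtain ⟨f, f2⟩ := hV (insert x S) (Finset.insert_subset hx hS) ((Finset.card_insert_le _ _).trans (by omega))
    exact ⟨f x, hG.deg _ _ _ (f2.1 x (by simp)), f, rfl, f2⟩

def kap (k n D : ℕ) : ℕ → ℕ
  | 0 => 0
  | l + 1 => dV k n D * kap k n D l + 1

theorem Gk_sub_Gl {E : Finset (En n)} {δmax Cw : ℝ} {G : En n → ℝ → Set (Wv n D)} (hG : GH k E δmax Cw G) (l : ℕ)
    {x : En n} {P : Wv n D} (h : P ∈ Gk k E G (kap k n D l) x) : P ∈ Gl k E G l x 1 := by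
  induction l generalizing x P with
  | zero =>
    obtain ⟨f, h1, h2⟩ := h ∅ (by simp) (by simp)
    rw [← h1]; exact h2.1 x (by simp)
  | succ l ih =>
    refine ⟨ih fun S hS hc => h S hS (hc.trans ?_), fun y hy => ?_⟩
    · show _ ≤ dV k n D * kap k n D l + 1
      have : 1 ≤ dV k n D := by unfold dV; omega
      nlinarith
    · obtain ⟨P', h1, h2⟩ := Gk_step hG h hy
      exact ⟨P', ih h1, h2⟩

theorem Gl_nonempty {E : Finset (En n)} {δmax Cw : ℝ} {G : En n → ℝ → Set (Wv n D)} (hG : GH k E δmax Cw G) (l : ℕ)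
    (hV : ∀ S, S ⊆ E → S.card ≤ kap k n D (l+1) → ∃ f, Valid k G S f) {x : En n} (hx : x ∈ E) :
    ∃ P, P ∈ Gl k E G l x 1 := by
  obtain ⟨P, hP⟩ := Gk_nonempty hG (κ := kap k n D l) hV hx
  exact ⟨P, Gk_sub_Gl hG l hP⟩

end HellyPart

section Calc
variable {n : ℕ}

/-- smooth functions -/
def Sm (f : En n → ℝ) : Prop := ContDiff ℝ ((⊤ : ℕ∞) : WithTop ℕ∞) f

theorem Sm.diff {f : En n → ℝ} (h : Sm f) : Differentiable ℝ f := ContDiff.differentiable h (by simp)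

theorem Sm.add {f g : En n → ℝ} (hf : Sm f) (hg : Sm g) : Sm (f + g) := ContDiff.add hf hg
theorem Sm.sub {f g : En n → ℝ} (hf : Sm f) (hg : Sm g) : Sm (f - g) := ContDiff.sub hf hg
theorem Sm.mul {f g : En n → ℝ} (hf : Sm f) (hg : Sm g) : Sm (f * g) := ContDiff.mul hf hg
theorem Sm.const (c : ℝ) : Sm (fun _ : En n => c) := contDiff_const
theorem Sm.coord (i : Fin n) : Sm (fun x : En n => x i) :=
  (EuclideanSpace.proj (𝕜 := ℝ) i : En n →L[ℝ] ℝ).contDiff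

theorem Sm.fd {f : En n → ℝ} (h : Sm f) : ContDiff ℝ ((⊤ : ℕ∞) : WithTop ℕ∞) (fderiv ℝ f) :=
  ContDiff.fderiv_right (m := ((⊤ : ℕ∞) : WithTop ℕ∞)) h (by simp)

theorem Sm.pd1 {f : En n → ℝ} (h : Sm f) (i : Fin n) : Sm (pd1 i f) :=
  h.fd.clm_apply contDiff_const

theorem pd1_comm {f : En n → ℝ} (h : Sm f) (i j : Fin n) : pd1 i (pd1 j f) = pd1 j (pd1 i f) := by
  have key : ∀ (i j : Fin n) x, pd1 i (pd1 j f) x =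
      fderiv ℝ (fderiv ℝ f) x (EuclideanSpace.single i 1) (EuclideanSpace.single j 1) := by
    intro i j x
    have h1 : HasFDerivAt (fderiv ℝ f) (fderiv ℝ (fderiv ℝ f) x) x :=
      (h.fd.differentiable (by simp) x).hasFDerivAt
    have h2 := h1.clm_apply (hasFDerivAt_const (EuclideanSpace.single j (1:ℝ)) x)
    show fderiv ℝ (fun y => fderiv ℝ f y (EuclideanSpace.single j 1)) x _ = _
    rw [h2.fderiv]
    simp
  funext x
  rw [key, key]
  exact (ContDiff.contDiffAt h).isSymmSndFDerivAt (by rw [minSmoothness_of_isRCLikeNormedField]; exact WithTop.coe_le_coe.mpr le_top) _ _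

theorem Sm.pd1_iter {f : En n → ℝ} (h : Sm f) (i : Fin n) (a : ℕ) : Sm ((_root_.pd1 i)^[a] f) := by
  induction a generalizing f with
  | zero => exact h
  | succ a ih => rw [Function.iterate_succ_apply]; exact ih (h.pd1 i)

theorem pd1_iter_comm {f : En n → ℝ} (h : Sm f) (i j : Fin n) (a : ℕ) :
    pd1 i ((pd1 j)^[a] f) = (pd1 j)^[a] (pd1 i f) := by
  induction a generalizing f with
  | zero => rfl
  | succ a ih => rw [Function.iterate_succ_apply, Function.iterate_succ_apply, ih (h.pd1 j), pd1_comm h]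

theorem Sm.fold {f : En n → ℝ} (h : Sm f) (α : Fin n → ℕ) (L : List (Fin n)) :
    Sm (L.foldr (fun i g => (_root_.pd1 i)^[α i] g) f) := by
  induction L with
  | nil => exact h
  | cons i L ih => exact ih.pd1_iter i _

theorem fold_comm {f : En n → ℝ} (h : Sm f) (α : Fin n → ℕ) (i : Fin n) (L : List (Fin n)) :
    pd1 i (L.foldr (fun i g => (pd1 i)^[α i] g) f) = L.foldr (fun i g => (pd1 i)^[α i] g) (pd1 i f) := by
  induction L with
  | nil => rfl
  | cons j L ih =>
    simp only [List.foldr_cons]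
    rw [pd1_iter_comm (h.fold α L), ih]

theorem fold_succ {f : En n → ℝ} (h : Sm f) (α : Fin n →₀ ℕ) (i : Fin n) (L : List (Fin n)) (hL : L.Nodup) :
    L.foldr (fun j g => (pd1 j)^[(α + Finsupp.single i 1 : Fin n →₀ ℕ) j] g) f =
      L.foldr (fun j g => (pd1 j)^[α j] g) (if i ∈ L then pd1 i f else f) := by
  induction L with
  | nil => simp
  | cons j L ih =>
    rw [List.nodup_cons] at hL
    simp only [List.foldr_cons]
    rw [ih hL.2]
    by_cases hj : j = i
    · subst hj
      rw [if_neg hL.1, if_pos (by simp)]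
      rw [Finsupp.add_apply, Finsupp.single_eq_same, Function.iterate_succ_apply, fold_comm h]
    · have : (α + Finsupp.single i 1 : Fin n →₀ ℕ) j = α j := by
        rw [Finsupp.add_apply, Finsupp.single_apply, if_neg (fun h => hj h.symm), add_zero]
      rw [this]
      have e : (i ∈ j :: L) ↔ i ∈ L := by
        simp only [List.mem_cons]
        exact ⟨fun h => h.resolve_left (fun h => hj h.symm), Or.inr⟩
      simp only [e]

theorem pdalpha_succ {f : En n → ℝ} (h : Sm f) (α : Fin n →₀ ℕ) (i : Fin n) :
    pdalpha (α + Finsupp.single i 1 : Fin n →₀ ℕ) f = pdalpha α (pd1 i f) := by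
  unfold pdalpha
  rw [fold_succ h α i _ (List.nodup_finRange n), if_pos (List.mem_finRange i)]

theorem pdalpha_zero (f : En n → ℝ) : pdalpha (0 : Fin n →₀ ℕ) f = f := by
  unfold pdalpha
  have : ∀ L : List (Fin n), L.foldr (fun i g => (pd1 i)^[(0 : Fin n →₀ ℕ) i] g) f = f := by
    intro L
    induction L with
    | nil => rfl
    | cons j L ih => simp only [List.foldr_cons]; rw [ih]; rfl
  exact this _

theorem Sm.pdalpha {f : En n → ℝ} (h : Sm f) (α : Fin n → ℕ) : Sm (pdalpha α f) := h.fold α _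

/-- factorial of a multi-index -/
def fac (α : Fin n →₀ ℕ) : ℝ := ∏ i, ((α i).factorial : ℝ)

theorem fac_pos (α : Fin n →₀ ℕ) : 0 < fac α := Finset.prod_pos fun i _ => by positivity

theorem one_le_fac (α : Fin n →₀ ℕ) : 1 ≤ fac α := by
  unfold fac
  have : ∀ i ∈ (Finset.univ : Finset (Fin n)), (1:ℝ) ≤ ((α i).factorial : ℝ) := fun i _ => by
    exact_mod_cast Nat.one_le_iff_ne_zero.mpr (Nat.factorial_ne_zero _)
  calc (1:ℝ) = ∏ i : Fin n, 1 := by simp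
    _ ≤ _ := Finset.prod_le_prod (fun _ _ => by norm_num) this

theorem fac_succ (α : Fin n →₀ ℕ) (i : Fin n) : fac (α + Finsupp.single i 1) = (α i + 1) * fac α := by
  unfold fac
  rw [← Finset.mul_prod_erase _ _ (Finset.mem_univ i), ← Finset.mul_prod_erase _ (fun i => ((α i).factorial : ℝ)) (Finset.mem_univ i)]
  have : ∏ x ∈ Finset.univ.erase i, (((α + Finsupp.single i 1 : Fin n →₀ ℕ) x).factorial : ℝ) =
      ∏ x ∈ Finset.univ.erase i, ((α x).factorial : ℝ) := by
    apply Finset.prod_congr rfl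
    intro j hj
    rw [Finsupp.add_apply, Finsupp.single_apply, if_neg (fun h => (Finset.ne_of_mem_erase hj) h.symm), add_zero]
  rw [this, Finsupp.add_apply, Finsupp.single_eq_same, Nat.factorial_succ]
  push_cast; ring

theorem fac_zero : fac (0 : Fin n →₀ ℕ) = 1 := by simp [fac]

/-- the Taylor series of a function at a point -/
def Tj (x : En n) (f : En n → ℝ) : MvPowerSeries (Fin n) ℝ := fun α => pdalpha α f x / fac α

theorem coeff_Tj (x : En n) (f : En n → ℝ) (α : Fin n →₀ ℕ) :
    MvPowerSeries.coeff α (Tj x f) = pdalpha α f x / fac α := rfl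

theorem coeff_Tj_zero (x : En n) (f : En n → ℝ) : MvPowerSeries.coeff 0 (Tj x f) = f x := by
  rw [coeff_Tj, pdalpha_zero, fac_zero, div_one]

theorem Tj_pd1 {f : En n → ℝ} (h : Sm f) (x : En n) (i : Fin n) :
    Tj x (pd1 i f) = MvPowerSeries.pderiv ℝ i (Tj x f) := by
  ext α
  rw [MvPowerSeries.coeff_pderiv, coeff_Tj, coeff_Tj, pdalpha_succ h, fac_succ]
  have := fac_pos α
  have : (0:ℝ) < α i + 1 := by positivity
  field_simp

theorem coeff_Tj_succ {f : En n → ℝ} (h : Sm f) (x : En n) (i : Fin n) (α : Fin n →₀ ℕ) :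
    MvPowerSeries.coeff (α + Finsupp.single i 1) (Tj x f) =
      MvPowerSeries.coeff α (Tj x (pd1 i f)) / (α i + 1) := by
  rw [Tj_pd1 h, MvPowerSeries.coeff_pderiv]
  have : (0:ℝ) < α i + 1 := by positivity
  field_simp

theorem pd1_add {f g : En n → ℝ} (hf : Sm f) (hg : Sm g) (i : Fin n) : pd1 i (f + g) = pd1 i f + pd1 i g := by
  funext x
  show fderiv ℝ (f + g) x _ = _
  rw [fderiv_add (hf.diff x) (hg.diff x)]; rfl

theorem pd1_sub {f g : En n → ℝ} (hf : Sm f) (hg : Sm g) (i : Fin n) : pd1 i (f - g) = pd1 i f - pd1 i g := by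
  funext x
  show fderiv ℝ (f - g) x _ = _
  rw [fderiv_sub (hf.diff x) (hg.diff x)]; rfl

theorem pd1_mul {f g : En n → ℝ} (hf : Sm f) (hg : Sm g) (i : Fin n) :
    pd1 i (f * g) = pd1 i f * g + f * pd1 i g := by
  funext x
  show fderiv ℝ (f * g) x _ = _
  rw [fderiv_mul (hf.diff x) (hg.diff x)]
  simp [pd1]; ring

theorem pd1_const (c : ℝ) (i : Fin n) : pd1 i (fun _ : En n => c) = fun _ => 0 := by
  funext x
  simp [pd1]

theorem Tj_add {f g : En n → ℝ} (hf : Sm f) (hg : Sm g) (x : En n) : Tj x (f + g) = Tj x f + Tj x g := by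
  ext α
  induction α using finsupp_ind generalizing f g with
  | h0 => rw [map_add, coeff_Tj_zero, coeff_Tj_zero, coeff_Tj_zero]; rfl
  | hs γ i ih =>
    rw [map_add, coeff_Tj_succ (hf.add hg), coeff_Tj_succ hf, coeff_Tj_succ hg, pd1_add hf hg, ih (hf.pd1 i) (hg.pd1 i), map_add, add_div]

theorem Tj_sub {f g : En n → ℝ} (hf : Sm f) (hg : Sm g) (x : En n) : Tj x (f - g) = Tj x f - Tj x g := by
  have := Tj_add (hf.sub hg) hg x
  rw [sub_add_cancel] at this
  rw [this, add_sub_cancel_right]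

theorem Tj_zero (x : En n) : Tj x (fun _ => 0) = 0 := by
  have := Tj_sub (Sm.const 0) (Sm.const 0) x
  rw [sub_self, sub_self] at this
  exact this

theorem Tj_const (c : ℝ) (x : En n) : Tj x (fun _ => c) = MvPowerSeries.C c := by
  ext α
  induction α using finsupp_ind with
  | h0 => rw [coeff_Tj_zero]; simp
  | hs γ i ih =>
    rw [coeff_Tj_succ (Sm.const c), pd1_const, Tj_zero, MvPowerSeries.coeff_add_single_C]
    simp

theorem Tj_mul {f g : En n → ℝ} (hf : Sm f) (hg : Sm g) (x : En n) : Tj x (f * g) = Tj x f * Tj x g := by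
  ext α
  induction α using finsupp_ind generalizing f g with
  | h0 =>
    rw [MvPowerSeries.coeff_mul]
    rw [Finset.HasAntidiagonal.antidiagonal_zero, Finset.sum_singleton, coeff_Tj_zero, coeff_Tj_zero, coeff_Tj_zero]
    rfl
  | hs γ i ih =>
    have h : (0:ℝ) < γ i + 1 := by positivity
    rw [coeff_Tj_succ (hf.mul hg), pd1_mul hf hg, Tj_add ((hf.pd1 i).mul hg) (hf.mul (hg.pd1 i)), map_add,
      ih (hf.pd1 i) hg, ih hf (hg.pd1 i), Tj_pd1 hf, Tj_pd1 hg, ← map_add, div_eq_iff h.ne',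
      ← MvPowerSeries.coeff_pderiv, Derivation.leibniz]
    simp only [smul_eq_mul]
    congr 1; ring

theorem Tj_congr {f g : En n → ℝ} {x : En n} (h : f =ᶠ[nhds x] g) : Tj x f = Tj x g := by
  have h1 : ∀ (i : Fin n) (f g : En n → ℝ), f =ᶠ[nhds x] g → pd1 i f =ᶠ[nhds x] pd1 i g := by
    intro i f g h
    filter_upwards [h.fderiv (𝕜 := ℝ)] with y hy
    simp [pd1, hy]
  have h2 : ∀ (i : Fin n) (a : ℕ) (f g : En n → ℝ), f =ᶠ[nhds x] g → (pd1 i)^[a] f =ᶠ[nhds x] (pd1 i)^[a] g := by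
    intro i a
    induction a with
    | zero => intro f g h; exact h
    | succ a ih => intro f g h; exact ih _ _ (h1 i _ _ h)
  ext α
  rw [coeff_Tj, coeff_Tj]
  have : ∀ L : List (Fin n), L.foldr (fun i g => (pd1 i)^[α i] g) f =ᶠ[nhds x] L.foldr (fun i g => (pd1 i)^[α i] g) g := by
    intro L
    induction L with
    | nil => exact h
    | cons i L ih => exact h2 i _ _ _ ih
  have := (this (List.finRange n)).eq_of_nhds
  unfold pdalpha
  rw [this]

/-- polynomial as a function -/
def pev (p : MvPolynomial (Fin n) ℝ) : En n → ℝ := fun x => MvPolynomial.eval (fun i => x i) p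

theorem Sm.pev (p : MvPolynomial (Fin n) ℝ) : Sm (pev p) := by
  induction p using MvPolynomial.induction_on with
  | C a =>
    have : _root_.pev (MvPolynomial.C a : MvPolynomial (Fin n) ℝ) = fun _ => a := by funext x; simp [_root_.pev]
    rw [this]; exact Sm.const a
  | add p q hp hq =>
    have : _root_.pev (p + q) = _root_.pev p + _root_.pev q := by funext x; simp [_root_.pev]
    rw [this]; exact hp.add hq
  | mul_X p i hp =>
    have : _root_.pev (p * MvPolynomial.X i) = _root_.pev p * fun x => x i := by funext x; simp [_root_.pev]
    rw [this]; exact hp.mul (Sm.coord i)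

theorem pd1_pev (p : MvPolynomial (Fin n) ℝ) (i : Fin n) : pd1 i (pev p) = pev (MvPolynomial.pderiv i p) := by
  induction p using MvPolynomial.induction_on with
  | C a =>
    have : pev (MvPolynomial.C a : MvPolynomial (Fin n) ℝ) = fun _ => a := by funext x; simp [pev]
    rw [this, pd1_const]; funext x; simp [pev]
  | add p q hp hq =>
    have : pev (p + q) = pev p + pev q := by funext x; simp [pev]
    rw [this, pd1_add (Sm.pev p) (Sm.pev q), hp, hq]; funext x; simp [pev]
  | mul_X p j hp =>
    have : pev (p * MvPolynomial.X j) = pev p * fun x => x j := by funext x; simp [pev]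
    rw [this, pd1_mul (Sm.pev p) (Sm.coord j), hp]
    have e : pd1 i (fun x : En n => x j) = fun _ => if j = i then 1 else 0 := by
      funext x
      have h := (EuclideanSpace.proj (𝕜 := ℝ) j : En n →L[ℝ] ℝ).hasFDerivAt (x := x)
      show fderiv ℝ (fun x : En n => (EuclideanSpace.proj (𝕜 := ℝ) j : En n →L[ℝ] ℝ) x) x _ = _
      rw [h.fderiv]
      simp [EuclideanSpace.single_apply]
    rw [e]
    funext x
    by_cases hj : j = i
    · subst hj; simp [pev]; ring
    · simp [pev, hj, Pi.single_apply, MvPolynomial.pderiv_X]; ring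

theorem pdalpha_pev (α : Fin n → ℕ) (p : MvPolynomial (Fin n) ℝ) (x : En n) :
    pdalpha α (pev p) x = polyPDval α p x := by
  have h2 : ∀ (i : Fin n) (a : ℕ) (p : MvPolynomial (Fin n) ℝ),
      (pd1 i)^[a] (pev p) = pev ((fun r => MvPolynomial.pderiv i r)^[a] p) := by
    intro i a
    induction a with
    | zero => intro p; rfl
    | succ a ih => intro p; rw [Function.iterate_succ_apply, pd1_pev, ih]; rfl
  have : ∀ L : List (Fin n), L.foldr (fun i g => (pd1 i)^[α i] g) (pev p) =
      pev (L.foldr (fun i q => (fun r => MvPolynomial.pderiv i r)^[α i] q) p) := by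
    intro L
    induction L with
    | nil => rfl
    | cons i L ih => simp only [List.foldr_cons]; rw [ih, h2]
  unfold pdalpha polyPDval polyPD
  rw [this]; rfl

theorem coeff_Tj_pev (x : En n) (p : MvPolynomial (Fin n) ℝ) (α : Fin n →₀ ℕ) :
    MvPowerSeries.coeff α (Tj x (pev p)) = MvPolynomial.coeff α (shp x p) := by
  rw [coeff_Tj, pdalpha_pev, polyPDval_eq]
  have : Finsupp.equivFunOnFinite.symm ⇑α = α := by ext; rfl
  rw [this]
  have := fac_pos α
  unfold fac at this ⊢
  field_simp

end Calc

section Jets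
open MvPolynomial
variable {n k D : ℕ}

theorem coeff_jet (x : En n) (f : En n → ℝ) (β : Fin n →₀ ℕ) :
    coeff β (shp x (jetScalar (k+1) f x)) = if β.degree ≤ k then MvPowerSeries.coeff β (Tj x f) else 0 := by
  have h1 : ∀ α : Fin n → Fin (k+1), shp x (C (pdalpha (fun i => (α i : ℕ)) f x / ((∏ i, Nat.factorial (α i : ℕ) : ℕ) : ℝ))
      * ∏ i, (X i - C (x i)) ^ ((α i : ℕ))) =
      monomial (Finsupp.equivFunOnFinite.symm (fun i => (α i : ℕ)))
        (MvPowerSeries.coeff (Finsupp.equivFunOnFinite.symm (fun i => (α i : ℕ))) (Tj x f)) := by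
    intro α
    rw [map_mul, map_prod, shp_C, monomial_eq, Finsupp.prod_fintype _ _ (by simp)]
    congr 1
    · rw [coeff_Tj]; unfold fac; push_cast; rfl
    · apply Finset.prod_congr rfl
      intro i _
      rw [map_pow, map_sub, shp_X, shp_C]
      simp
  unfold jetScalar
  rw [map_sum, coeff_sum, Finset.sum_congr rfl (fun α _ => by rw [h1 α])]
  simp only [coeff_monomial]
  have hdeg : ∀ γ : Fin n →₀ ℕ, γ.degree = ∑ i, γ i := fun γ => Finsupp.degree_eq_sum γ
  split_ifs with hβ
  · have hlt : ∀ i, β i < k + 1 := by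
      intro i
      have := Finset.single_le_sum (f := fun i => β i) (fun _ _ => Nat.zero_le _) (Finset.mem_univ i)
      rw [hdeg] at hβ
      omega
    have e : Finsupp.equivFunOnFinite.symm (fun i => (((⟨β i, hlt i⟩ : Fin (k+1)) : Fin (k+1)) : ℕ)) = β := by
      ext i; rfl
    rw [Finset.sum_eq_single (fun i => ⟨β i, hlt i⟩)]
    · rw [if_pos e, e]
    · intro α _ hα
      rw [if_neg]
      intro h
      apply hα
      funext i
      apply Fin.ext
      show _ = β i
      rw [← h]; rfl
    · intro h
      exfalso; apply h
      simp only [Finset.mem_filter, Finset.mem_univ, true_and]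
      rw [hdeg] at hβ
      simpa using hβ
  · apply Finset.sum_eq_zero
    intro α hα
    rw [if_neg]
    intro h
    apply hβ
    simp only [Finset.mem_filter, Finset.mem_univ, true_and] at hα
    rw [hdeg, ← h]
    simpa using hα

theorem Dk_of_shp {p : MvPolynomial (Fin n) ℝ} {x : En n} (h : Dk k (shp x p)) : Dk k p := by
  have := h.ush x
  rwa [ush_shp] at this

theorem Dk_jet (x : En n) (f : En n → ℝ) : Dk k (jetScalar (k+1) f x) := by
  apply Dk_of_shp (x := x)
  intro α hα
  rw [coeff_jet, if_neg (by omega)]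

theorem jet_ext {x : En n} {p : MvPolynomial (Fin n) ℝ} {f : En n → ℝ} (hp : Dk k p)
    (h : ∀ α : Fin n →₀ ℕ, α.degree ≤ k → MvPowerSeries.coeff α (Tj x f) = coeff α (shp x p)) :
    jetScalar (k+1) f x = p := by
  apply shp_inj (x := x)
  ext α
  rw [coeff_jet]
  split_ifs with hα
  · exact h α hα
  · exact (hp.shp x α (by omega)).symm

theorem jet_mul {f g : En n → ℝ} (hf : Sm f) (hg : Sm g) (x : En n) :
    jetScalar (k+1) (f * g) x = odot k x (jetScalar (k+1) f x) (jetScalar (k+1) g x) := by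
  apply jet_ext (Dk_odot _ _ _ _)
  intro α hα
  rw [shp_odot, coeff_trk, if_pos hα, Tj_mul hf hg, MvPowerSeries.coeff_mul, coeff_mul]
  apply Finset.sum_congr rfl
  intro p hp
  rw [Finset.HasAntidiagonal.mem_antidiagonal] at hp
  have : p.1.degree + p.2.degree = α.degree := by rw [← hp, map_add]
  rw [coeff_jet, coeff_jet, if_pos (by omega), if_pos (by omega)]

theorem jet_add {f g : En n → ℝ} (hf : Sm f) (hg : Sm g) (x : En n) :
    jetScalar (k+1) (f + g) x = jetScalar (k+1) f x + jetScalar (k+1) g x := by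
  apply jet_ext ((Dk_jet _ _).add (Dk_jet _ _))
  intro α hα
  rw [Tj_add hf hg, map_add, map_add, coeff_add, coeff_jet, coeff_jet, if_pos hα, if_pos hα]

theorem jet_congr {f g : En n → ℝ} {x : En n} (h : f =ᶠ[nhds x] g) : jetScalar (k+1) f x = jetScalar (k+1) g x := by
  apply jet_ext (Dk_jet _ _)
  intro α hα
  rw [coeff_jet, if_pos hα, Tj_congr h]

theorem jet_pev {p : MvPolynomial (Fin n) ℝ} (hp : Dk k p) (x : En n) : jetScalar (k+1) (pev p) x = p := by
  apply jet_ext hp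
  intro α hα
  rw [coeff_Tj_pev]

theorem jet_one (x : En n) : jetScalar (k+1) (fun _ => 1) x = 1 := by
  have e : (fun _ : En n => (1:ℝ)) = pev 1 := by funext x; simp [pev]
  rw [e]
  apply jet_pev
  intro α hα
  rw [coeff_one, if_neg]
  rintro rfl
  simp at hα

/-- function bound, order m homogeneous -/
def FB (k : ℕ) (x : En n) (ρ : ℝ) (f : En n → ℝ) (K : ℝ) : Prop :=
  ∀ α : Fin n →₀ ℕ, α.degree ≤ k + 1 → |MvPowerSeries.coeff α (Tj x f)| ≤ K * ρ ^ (k + 1 - α.degree)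

/-- cutoff bound -/
def CB (k : ℕ) (x : En n) (ρ : ℝ) (f : En n → ℝ) (K : ℝ) : Prop :=
  ∀ α : Fin n →₀ ℕ, α.degree ≤ k + 1 → |MvPowerSeries.coeff α (Tj x f)| ≤ K * (ρ ^ α.degree)⁻¹

theorem FB.mono {x : En n} {ρ ρ' K K' : ℝ} {f : En n → ℝ} (h : FB k x ρ f K) (hρ : 0 ≤ ρ) (hρ' : ρ ≤ ρ')
    (hK : K ≤ K') (hK' : 0 ≤ K') : FB k x ρ' f K' := fun α hα =>
  (h α hα).trans (mul_le_mul hK (pow_le_pow_left₀ hρ hρ' _) (by positivity) hK')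

theorem FB.add {x : En n} {ρ K K' : ℝ} {f g : En n → ℝ} (hf : FB k x ρ f K) (hg : FB k x ρ g K') (sf : Sm f) (sg : Sm g) :
    FB k x ρ (f + g) (K + K') := by
  intro α hα
  rw [Tj_add sf sg, map_add, add_mul]
  exact (abs_add_le _ _).trans (add_le_add (hf α hα) (hg α hα))

theorem FB.symm {x : En n} {ρ K : ℝ} {f g : En n → ℝ} (hf : FB k x ρ (f - g) K) (sf : Sm f) (sg : Sm g) :
    FB k x ρ (g - f) K := by
  intro α hα
  have := hf α hα
  rw [Tj_sub sf sg, map_sub] at this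
  rw [Tj_sub sg sf, map_sub, abs_sub_comm]
  exact this

/-- triangle inequality -/
theorem FB.tri {x : En n} {ρ K K' : ℝ} {f g h : En n → ℝ} (h1 : FB k x ρ (f - g) K) (h2 : FB k x ρ (g - h) K')
    (sf : Sm f) (sg : Sm g) (sh : Sm h) : FB k x ρ (f - h) (K + K') := by
  have := h1.add h2 (sf.sub sg) (sg.sub sh)
  rwa [sub_add_sub_cancel] at this

theorem FB.congr {x : En n} {ρ K : ℝ} {f g : En n → ℝ} (h : FB k x ρ f K) (e : g =ᶠ[nhds x] f) : FB k x ρ g K := by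
  intro α hα
  rw [Tj_congr e]; exact h α hα

theorem FB.rescale {x : En n} {ρ ρ' K t : ℝ} {f : En n → ℝ} (h : FB k x ρ f K) (hρ : 0 ≤ ρ) (hρ' : 0 ≤ ρ')
    (ht : 1 ≤ t) (hK : 0 ≤ K) (hle : ρ ≤ t * ρ') : FB k x ρ' f (t ^ (k + 1) * K) := by
  intro α hα
  refine (h α hα).trans ?_
  calc K * ρ ^ (k + 1 - α.degree) ≤ K * (t * ρ') ^ (k + 1 - α.degree) := by gcongr
    _ = t ^ (k + 1 - α.degree) * K * ρ' ^ (k + 1 - α.degree) := by rw [mul_pow]; ring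
    _ ≤ _ := by
      have : t ^ (k + 1 - α.degree) ≤ t ^ (k+1) := pow_le_pow_right₀ ht (by omega)
      gcongr

/-- antidiagonal cardinality -/
def acd (α : Fin n →₀ ℕ) : ℝ := ((Finset.HasAntidiagonal.antidiagonal α).card : ℝ)

theorem acd_nonneg (α : Fin n →₀ ℕ) : 0 ≤ acd α := Nat.cast_nonneg _

/-- Leibniz constant -/
def Clb (k n : ℕ) : ℝ := ∑ α : Mi (k+1) n, acd α.1

theorem card_le_Clb {α : Fin n →₀ ℕ} (h : α.degree ≤ k + 1) :
    acd α ≤ Clb k n := by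
  obtain ⟨a, ha⟩ : ∃ a : Mi (k+1) n, a.1 = α := ⟨⟨α, h⟩, rfl⟩
  rw [← ha]
  have := Finset.single_le_sum (f := fun α : Mi (k+1) n => acd α.1) (s := Finset.univ)
    (fun α _ => acd_nonneg α.1) (Finset.mem_univ a)
  exact this

theorem one_le_Clb : 1 ≤ Clb k n := by
  have := card_le_Clb (k := k) (n := n) (α := 0) (by simp)
  unfold acd at this
  rw [Finset.HasAntidiagonal.antidiagonal_zero] at this
  simpa using this

theorem CB.mulFB {x : En n} {ρ K L : ℝ} {s f : En n → ℝ} (hs : CB k x ρ s K) (hf : FB k x ρ f L) (ss : Sm s) (sf : Sm f)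
    (hρ : 0 < ρ) (hK : 0 ≤ K) (hL : 0 ≤ L) : FB k x ρ (s * f) (Clb k n * K * L) := by
  intro α hα
  rw [Tj_mul ss sf, MvPowerSeries.coeff_mul]
  refine (Finset.abs_sum_le_sum_abs _ _).trans ?_
  have : ∀ p ∈ Finset.HasAntidiagonal.antidiagonal α, |MvPowerSeries.coeff p.1 (Tj x s) * MvPowerSeries.coeff p.2 (Tj x f)| ≤
      K * L * ρ ^ (k + 1 - α.degree) := by
    intro p hp
    rw [Finset.HasAntidiagonal.mem_antidiagonal] at hp
    have hd : p.1.degree + p.2.degree = α.degree := by rw [← hp, map_add]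
    rw [abs_mul]
    refine (mul_le_mul (hs p.1 (by omega)) (hf p.2 (by omega)) (abs_nonneg _) (by positivity)).trans (le_of_eq ?_)
    have e : k + 1 - p.2.degree = (k + 1 - α.degree) + p.1.degree := by omega
    rw [e, pow_add]
    have := pow_pos hρ p.1.degree
    field_simp
  refine (Finset.sum_le_card_nsmul _ _ _ this).trans ?_
  rw [nsmul_eq_mul]
  have := card_le_Clb (k := k) hα
  unfold acd at this
  have h2 := mul_le_mul_of_nonneg_right this (show 0 ≤ K * L * ρ ^ (k + 1 - α.degree) by positivity)
  linarith

/-- vector jet -/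
def JV (k : ℕ) (x : En n) (F : Fin D → En n → ℝ) : Wv n D := fun j => jetScalar (k+1) (F j) x

theorem DV_JV (x : En n) (F : Fin D → En n → ℝ) : DV k (JV k x F) := fun j => Dk_jet _ _

theorem FB.of_NB {x : En n} {ρ K : ℝ} {P : Wv n D} (hP : DV k P) (h : NB k x ρ P K) (hρ : 0 ≤ ρ) (hK : 0 ≤ K) (j : Fin D) :
    FB k x ρ (pev (P j)) K := by
  intro α hα
  rw [coeff_Tj_pev]
  by_cases h1 : α.degree ≤ k
  · have := h (⟨α, h1⟩, j)
    rw [cc_apply, cf_of_Dk _ _ (hP j)] at this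
    exact this
  · rw [(hP j).shp x α (by omega), abs_zero]
    positivity

theorem pev_sub (p q : MvPolynomial (Fin n) ℝ) : pev (p - q) = pev p - pev q := by funext x; simp [pev]

theorem NB.of_FB {x : En n} {ρ K : ℝ} {F G : Fin D → En n → ℝ} (sF : ∀ j, Sm (F j)) (sG : ∀ j, Sm (G j))
    (h : ∀ j, FB k x ρ (F j - G j) K) : NB k x ρ (JV k x F - JV k x G) K := by
  rintro ⟨⟨α, hα⟩, j⟩
  have h1 := h j α (by omega)
  rw [cc_apply, cf_of_Dk _ _ ((DV_JV x F).sub (DV_JV x G) j)]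
  show |coeff α (shp x (jetScalar (k+1) (F j) x - jetScalar (k+1) (G j) x))| ≤ _
  rw [map_sub, coeff_sub, coeff_jet, coeff_jet, if_pos hα, if_pos hα]
  rw [Tj_sub (sF j) (sG j), map_sub] at h1
  exact h1

theorem CB.jet {x : En n} {ρ K : ℝ} {s : En n → ℝ} (hs : CB k x ρ s K) (α : Mi k n) :
    |coeff α.1 (shp x (jetScalar (k+1) s x))| ≤ K * (ρ ^ α.1.degree)⁻¹ := by
  rw [coeff_jet, if_pos α.2]
  exact hs _ (by have := α.2; omega)

theorem coeff_zero_jet (x : En n) (s : En n → ℝ) : coeff 0 (shp x (jetScalar (k+1) s x)) = s x := by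
  rw [coeff_jet, if_pos (by simp), coeff_Tj_zero]

/-! scaling -/
theorem Tj_scale {f : En n → ℝ} (hf : Sm f) (z : En n) (a : ℝ) (x : En n) (α : Fin n →₀ ℕ) :
    MvPowerSeries.coeff α (Tj x (fun y => f (a • (y - z)))) = a ^ α.degree * MvPowerSeries.coeff α (Tj (a • (x - z)) f) := by
  have hA : ContDiff ℝ ((⊤ : ℕ∞) : WithTop ℕ∞) (fun y : En n => a • (y - z)) := (contDiff_id.sub contDiff_const).const_smul a
  induction α using finsupp_ind generalizing f with
  | h0 => rw [coeff_Tj_zero, coeff_Tj_zero]; simp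
  | hs γ i ih =>
    have sc : Sm (fun y => f (a • (y - z))) := ContDiff.comp hf hA
    have e : pd1 i (fun y => f (a • (y - z))) = (fun _ => a) * (fun y => (pd1 i f) (a • (y - z))) := by
      funext y
      have h1 : HasFDerivAt (fun y : En n => a • (y - z)) (a • ContinuousLinearMap.id ℝ (En n)) y :=
        ((hasFDerivAt_id y).sub_const z).const_smul a
      have h2 := ((hf.diff (a • (y - z))).hasFDerivAt).comp y h1
      show fderiv ℝ (f ∘ fun y => a • (y - z)) y _ = _
      rw [h2.fderiv]
      simp [pd1]
    have s2 : Sm (fun y => (pd1 i f) (a • (y - z))) := ContDiff.comp (hf.pd1 i) hA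
    rw [coeff_Tj_succ sc, e, Tj_mul (Sm.const a) s2, Tj_const, MvPowerSeries.coeff_C_mul, ih (hf.pd1 i), coeff_Tj_succ hf,
      degree_add_single, pow_succ]
    ring

theorem CB_unit {f : En n → ℝ} (hf : Sm f) : ∃ C : ℝ, 1 ≤ C ∧ ∀ x, ‖x‖ ≤ 2 → CB k x 1 f C := by
  have h1 : ∀ α : Mi (k+1) n, ∃ C : ℝ, 0 ≤ C ∧ ∀ x : En n, ‖x‖ ≤ 2 → |MvPowerSeries.coeff α.1 (Tj x f)| ≤ C := by
    intro α
    have hc : Continuous (fun x => MvPowerSeries.coeff α.1 (Tj x f)) := by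
      simp only [coeff_Tj]
      exact (ContDiff.continuous (hf.pdalpha α.1)).div_const _
    obtain ⟨C, hC⟩ := (isCompact_closedBall (0 : En n) 2).exists_bound_of_continuousOn hc.continuousOn
    refine ⟨max C 0, le_max_right _ _, fun x hx => (hC x (by simpa using hx)).trans (le_max_left _ _)⟩
  choose C hC0 hC using h1
  refine ⟨1 + ∑ α, C α, by linarith [Finset.sum_nonneg (fun α (_ : α ∈ Finset.univ) => hC0 α)], fun x hx α hα => ?_⟩
  have := Finset.single_le_sum (f := C) (fun α _ => hC0 α) (Finset.mem_univ ⟨α, hα⟩)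
  have h2 := hC ⟨α, hα⟩ x hx
  simp only [one_pow, inv_one, mul_one]
  simp only at h2
  linarith

/-- cutoff pairs -/
theorem exists_cutoff (k n : ℕ) : ∃ Cb : ℝ, 1 ≤ Cb ∧ ∀ (z : En n) (ρ : ℝ), 0 < ρ → ∃ s c : En n → ℝ, Sm s ∧ Sm c ∧
    (∀ x, s x * s x + c x * c x = 1) ∧
    (∀ x, dist x z ≤ ρ → s =ᶠ[nhds x] (fun _ => 1) ∧ c =ᶠ[nhds x] (fun _ => 0)) ∧
    (∀ x, 3/2 * ρ < dist x z → s =ᶠ[nhds x] (fun _ => 0) ∧ c =ᶠ[nhds x] (fun _ => 1)) ∧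
    (∀ x, dist x z ≤ 3/2 * ρ → CB k x ρ s Cb ∧ CB k x ρ c Cb) := by
  let b : ContDiffBump (0 : En n) := ⟨5/4, 3/2, by norm_num, by norm_num⟩
  have hb : Sm (fun x => b x) := b.contDiff
  have hb2 : ContDiff ℝ ((⊤ : ℕ∞) : WithTop ℕ∞) (fun x => Real.pi / 2 * b x) := contDiff_const.mul hb
  set s0 : En n → ℝ := fun x => Real.sin (Real.pi / 2 * b x) with hs0
  set c0 : En n → ℝ := fun x => Real.cos (Real.pi / 2 * b x) with hc0
  have ss : Sm s0 := Real.contDiff_sin.comp hb2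
  have sc : Sm c0 := Real.contDiff_cos.comp hb2
  obtain ⟨C1, hC1, h1⟩ := CB_unit (k := k) ss
  obtain ⟨C2, hC2, h2⟩ := CB_unit (k := k) sc
  refine ⟨max C1 C2, hC1.trans (le_max_left _ _), fun z ρ hρ => ?_⟩
  have hA : ContDiff ℝ ((⊤ : ℕ∞) : WithTop ℕ∞) (fun y : En n => ρ⁻¹ • (y - z)) := (contDiff_id.sub contDiff_const).const_smul _
  have hnorm : ∀ x : En n, ‖ρ⁻¹ • (x - z)‖ = dist x z / ρ := by
    intro x
    rw [norm_smul, Real.norm_eq_abs, abs_of_pos (by positivity), ← dist_eq_norm]; field_simp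
  refine ⟨fun y => s0 (ρ⁻¹ • (y - z)), fun y => c0 (ρ⁻¹ • (y - z)), ContDiff.comp (g := s0) ss hA, ContDiff.comp (g := c0) sc hA, ?_, ?_, ?_, ?_⟩
  · intro x
    have := Real.sin_sq_add_cos_sq (Real.pi / 2 * b (ρ⁻¹ • (x - z)))
    simp only [hs0, hc0]
    linarith
  · intro x hx
    have ho : IsOpen {y : En n | dist y z < 5/4 * ρ} := isOpen_lt (by fun_prop) (by fun_prop)
    have hn := ho.mem_nhds (show x ∈ {y : En n | dist y z < 5/4 * ρ} by simp only [Set.mem_setOf_eq]; linarith)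
    have : ∀ y ∈ {y : En n | dist y z < 5/4 * ρ}, b (ρ⁻¹ • (y - z)) = 1 := by
      intro y hy
      apply b.one_of_mem_closedBall
      rw [mem_closedBall_zero_iff, hnorm]
      show _ ≤ (5/4:ℝ)
      rw [div_le_iff₀ hρ]; exact hy.le
    constructor
    · filter_upwards [hn] with y hy
      simp only [hs0, this y hy, mul_one, Real.sin_pi_div_two]
    · filter_upwards [hn] with y hy
      simp only [hc0, this y hy, mul_one, Real.cos_pi_div_two]
  · intro x hx
    have ho : IsOpen {y : En n | 3/2 * ρ < dist y z} := isOpen_lt (by fun_prop) (by fun_prop)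
    have hn := ho.mem_nhds (show x ∈ {y : En n | 3/2 * ρ < dist y z} from hx)
    have : ∀ y ∈ {y : En n | 3/2 * ρ < dist y z}, b (ρ⁻¹ • (y - z)) = 0 := by
      intro y hy
      apply b.zero_of_le_dist
      rw [dist_zero_right, hnorm]
      show (3/2:ℝ) ≤ _
      rw [le_div_iff₀ hρ]; exact le_of_lt hy
    constructor
    · filter_upwards [hn] with y hy
      simp only [hs0, this y hy, mul_zero, Real.sin_zero]
    · filter_upwards [hn] with y hy
      simp only [hc0, this y hy, mul_zero, Real.cos_zero]
  · intro x hx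
    have hx2 : ‖ρ⁻¹ • (x - z)‖ ≤ 2 := by
      rw [hnorm, div_le_iff₀ hρ]; linarith
    have key : ∀ (f : En n → ℝ) (C : ℝ), Sm f → CB k (ρ⁻¹ • (x - z)) 1 f C → C ≤ max C1 C2 →
        CB k x ρ (fun y => f (ρ⁻¹ • (y - z))) (max C1 C2) := by
      intro f C sf hf hC α hα
      rw [Tj_scale sf, abs_mul, abs_of_pos (by positivity), inv_pow, mul_comm]
      have := hf α hα
      simp only [one_pow, inv_one, mul_one] at this
      gcongr
      exact this.trans hC
    exact ⟨key s0 C1 ss (h1 _ hx2) (le_max_left _ _), key c0 C2 sc (h2 _ hx2) (le_max_right _ _)⟩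

end Jets

section Glue
open MvPolynomial
variable {n k D : ℕ}

set_option maxHeartbeats 1000000 in
theorem glue (k n D : ℕ) (Cw : ℝ) (hCw : 1 ≤ Cw) (N : ℕ) (K : ℝ) (hK : 1 ≤ K) : ∃ K' : ℝ, K ≤ K' ∧
    ∀ (E : Finset (En n)) (δmax : ℝ) (G : En n → ℝ → Set (Wv n D)), GH k E δmax Cw G →
    ∀ (B : Set (En n)) (T : Finset (En n)) (ρ : En n → ℝ) (F : En n → Fin D → En n → ℝ),
    (∀ ν ∈ T, 0 < ρ ν ∧ ρ ν ≤ δmax) → (∀ ν ∈ T, ∀ j, Sm (F ν j)) →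
    (∀ x ∈ B, ∀ ν ∈ T, dist x ν ≤ 3/2 * ρ ν → x ∈ E → JV k x (F ν) ∈ G x K) →
    (∀ x ∈ B, ∀ ν ∈ T, ∀ μ ∈ T, dist x ν ≤ 3/2 * ρ ν → dist x μ ≤ 3/2 * ρ μ →
      ρ ν ≤ 2 * ρ μ ∧ ∀ j, FB k x (ρ ν) (F ν j - F μ j) K) →
    (∀ x ∈ B, (T.filter (fun ν => dist x ν ≤ 3/2 * ρ ν)).card ≤ N) →
    (∀ x ∈ B, ∃ ν ∈ T, dist x ν ≤ ρ ν) →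
    ∃ H : Fin D → En n → ℝ, (∀ j, Sm (H j)) ∧ ∀ x ∈ B, (x ∈ E → JV k x H ∈ G x K') ∧
      ∀ ν ∈ T, dist x ν ≤ 3/2 * ρ ν → ∀ j, FB k x (ρ ν) (H j - F ν j) K' := by
  obtain ⟨Cb, hCb, hcut⟩ := exists_cutoff k n
  have hClb := one_le_Clb (k := k) (n := n)
  set Λ : ℝ := Cw * Cb ^ (k+2) + 1 + 2 ^ (k+1) * (Clb k n * Cb * (Clb k n * Cb)) with hΛ
  have hp1 : (1:ℝ) ≤ Cb ^ (k+2) := one_le_pow₀ hCb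
  have hp2 : (0:ℝ) ≤ 2 ^ (k+1) * (Clb k n * Cb * (Clb k n * Cb)) := by
    have : 0 ≤ Clb k n := by linarith
    have : 0 ≤ Cb := by linarith
    positivity
  have hp3 : 1 ≤ Cw * Cb ^ (k+2) := by nlinarith
  have hΛ1 : 1 ≤ Λ := by linarith
  have hpow : ∀ a b : ℕ, a ≤ b → Λ ^ a * K ≤ Λ ^ b * K := fun a b h =>
    mul_le_mul_of_nonneg_right (pow_le_pow_right₀ hΛ1 h) (by linarith)
  have hpow0 : ∀ a : ℕ, K ≤ Λ ^ a * K := fun a => by simpa using hpow 0 a (Nat.zero_le _)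
  refine ⟨Λ ^ N * K, hpow0 N, ?_⟩
  intro E δmax G hG B T ρ F hρ sF hin hcomp hN hcov
  suffices hS : ∀ S : Finset (En n), S ⊆ T → ∃ H : Fin D → En n → ℝ, (∀ j, Sm (H j)) ∧ ∀ x ∈ B,
      (∃ ν ∈ S, dist x ν ≤ ρ ν) → 
      (x ∈ E → JV k x H ∈ G x (Λ ^ (S.filter (fun ν => dist x ν ≤ 3/2 * ρ ν)).card * K)) ∧
      ∀ ν ∈ T, dist x ν ≤ 3/2 * ρ ν → ∀ j, FB k x (ρ ν) (H j - F ν j)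
        (Λ ^ (S.filter (fun ν => dist x ν ≤ 3/2 * ρ ν)).card * K) by
    obtain ⟨H, sH, hH⟩ := hS T (Finset.Subset.refl _)
    refine ⟨H, sH, fun x hx => ?_⟩
    obtain ⟨h1, h2⟩ := hH x hx (hcov x hx)
    refine ⟨fun hxE => (hG.cm x).mono _ _ (hpow _ _ (hN x hx)) (h1 hxE), fun ν hν hd j => ?_⟩
    exact (h2 ν hν hd j).mono (hρ ν hν).1.le le_rfl (hpow _ _ (hN x hx)) (by linarith [hpow0 N])
  intro S
  induction S using Finset.induction_on with
  | empty =>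
    intro _
    exact ⟨fun _ _ => 0, fun _ => Sm.const 0, fun x _ ⟨ν, hν, _⟩ => absurd hν (by simp)⟩
  | insert ν S hνS ih =>
    intro hST
    obtain ⟨H, sH, hH⟩ := ih ((Finset.subset_insert _ _).trans hST)
    have hνT : ν ∈ T := hST (Finset.mem_insert_self _ _)
    obtain ⟨hρ0, hρm⟩ := hρ ν hνT
    obtain ⟨s, c, ss, sc, hsc, hcore, hout, hCBs⟩ := hcut ν (ρ ν) hρ0
    have sFν := sF ν hνT
    set H' : Fin D → En n → ℝ := fun j => c * c * H j + s * s * F ν j with hH'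
    refine ⟨H', fun j => ((sc.mul sc).mul (sH j)).add ((ss.mul ss).mul (sFν j)), fun x hx hex => ?_⟩
    have hmonoK : Λ ^ (S.filter (fun ν => dist x ν ≤ 3/2 * ρ ν)).card * K ≤
        Λ ^ ((insert ν S).filter (fun ν => dist x ν ≤ 3/2 * ρ ν)).card * K :=
      hpow _ _ (Finset.card_le_card (Finset.filter_subset_filter _ (Finset.subset_insert _ _)))
    by_cases hc1 : dist x ν ≤ ρ ν
    · -- core
      obtain ⟨e1, e2⟩ := hcore x hc1
      have e : ∀ j, H' j =ᶠ[nhds x] F ν j := by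
        intro j
        filter_upwards [e1, e2] with y h1 h2
        simp [hH', h1, h2]
      have hact : dist x ν ≤ 3/2 * ρ ν := by linarith
      constructor
      · intro hxE
        have : JV k x H' = JV k x (F ν) := by
          funext j; exact jet_congr (e j)
        rw [this]
        exact (hG.cm x).mono _ _ (hpow0 _) (hin x hx ν hνT hact hxE)
      · intro μ hμ hμa j
        have h1 := (hcomp x hx μ hμ ν hνT hμa hact).2 j
        have h2 := h1.symm (sF μ hμ j) (sFν j)
        refine (h2.congr ?_).mono (hρ μ hμ).1.le le_rfl (hpow0 _) (by linarith [hpow0 ((insert ν S).filter (fun ν => dist x ν ≤ 3/2 * ρ ν)).card])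
        filter_upwards [e j] with y hy
        simp [hy]
    · have hex' : ∃ ν ∈ S, dist x ν ≤ ρ ν := by
        obtain ⟨μ, hμ, hd⟩ := hex
        rcases Finset.mem_insert.mp hμ with rfl | h
        · exact absurd hd hc1
        · exact ⟨μ, h, hd⟩
      obtain ⟨g1, g2⟩ := hH x hx hex'
      by_cases hact : dist x ν ≤ 3/2 * ρ ν
      · -- active
        set a := (S.filter (fun ν => dist x ν ≤ 3/2 * ρ ν)).card with ha
        have hcard : ((insert ν S).filter (fun ν => dist x ν ≤ 3/2 * ρ ν)).card = a + 1 := by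
          rw [Finset.filter_insert, if_pos hact, Finset.card_insert_of_notMem]
          simp [hνS]
        rw [hcard, pow_succ]
        have hL0 : 0 < Λ ^ a * K := by have := hpow0 a; linarith
        obtain ⟨cs, cc'⟩ := hCBs x hact
        have hν2 := g2 ν hνT hact
        constructor
        · intro hxE
          have j1 : ∀ f : En n → ℝ, Sm f → jetScalar (k+1) (f * f) x = odot k x (jetScalar (k+1) f x) (jetScalar (k+1) f x) :=
            fun f hf => jet_mul hf hf x
          have ej : JV k x H' = fun j => odot k x (odot k x (jetScalar (k+1) c x) (jetScalar (k+1) c x)) (JV k x H j) +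
              odot k x (odot k x (jetScalar (k+1) s x) (jetScalar (k+1) s x)) (JV k x (F ν) j) := by
            funext j
            show jetScalar (k+1) (c * c * H j + s * s * F ν j) x = _
            rw [jet_add ((sc.mul sc).mul (sH j)) ((ss.mul ss).mul (sFν j)), jet_mul (sc.mul sc) (sH j),
              jet_mul (ss.mul ss) (sFν j), j1 c sc, j1 s ss]
            rfl
          have hone : odot k x (jetScalar (k+1) c x) (jetScalar (k+1) c x) +
              odot k x (jetScalar (k+1) s x) (jetScalar (k+1) s x) = 1 := by
            rw [← j1 c sc, ← j1 s ss, ← jet_add (sc.mul sc) (ss.mul ss), ← jet_one (k := k) x]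
            congr 1
            funext y
            have := hsc y
            simp only [Pi.add_apply, Pi.mul_apply]
            linarith
          have z : |c x| ≤ 1 ∧ |s x| ≤ 1 := by
            have := hsc x
            constructor
            · rw [abs_le_one_iff_mul_self_le_one]; nlinarith [mul_self_nonneg (s x)]
            · rw [abs_le_one_iff_mul_self_le_one]; nlinarith [mul_self_nonneg (c x)]
          have hw := hG.whC hCb hρ0 (hρm.trans (by nlinarith [hG.dpos])) hxE (g1 hxE)
            ((hG.cm x).mono _ _ (hpow0 a) (hin x hx ν hνT hact hxE))
            (NB.mono (NB.of_FB sH sFν hν2) hρ0.le le_rfl (by nlinarith) (by nlinarith))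
            (Dk_jet x c) (Dk_jet x s) (fun α => cc'.jet α) (fun α => cs.jet α)
            (by rw [coeff_zero_jet]; exact z.1) (by rw [coeff_zero_jet]; exact z.2) hone
          rw [ej]
          refine (hG.cm x).mono _ _ ?_ hw
          have : Cw * Cb ^ (k+2) ≤ Λ := by linarith
          nlinarith
        · intro μ hμ hμa j
          have h1 := g2 μ hμ hμa j
          have h2 := (hν2 j).symm (sH j) (sFν j)
          have h3 := cs.mulFB (cs.mulFB h2 ss ((sFν j).sub (sH j)) hρ0 (by linarith) hL0.le) ss (ss.mul ((sFν j).sub (sH j)))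
            hρ0 (by linarith) (by have := hL0.le; have : 0 ≤ Clb k n := by linarith
                                  have : 0 ≤ Cb := by linarith
                                  positivity)
          have h4 := h3.rescale (ρ' := ρ μ) (t := 2) hρ0.le (hρ μ hμ).1.le (by norm_num)
            (by have := hL0.le; have : 0 ≤ Clb k n := by linarith
                have : 0 ≤ Cb := by linarith
                positivity) (hcomp x hx ν hνT μ hμ hact hμa).1
          have h5 := h1.add h4 ((sH j).sub (sF μ hμ j)) (ss.mul (ss.mul ((sFν j).sub (sH j))))
          have e : H' j - F μ j = (H j - F μ j) + s * (s * (F ν j - H j)) := by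
            funext y
            have := hsc y
            have e2 : c y * c y = 1 - s y * s y := by linarith
            simp only [hH', Pi.add_apply, Pi.mul_apply, Pi.sub_apply]
            rw [e2]; ring
          rw [e]
          refine h5.mono (hρ μ hμ).1.le le_rfl ?_ (by nlinarith)
          have : Λ ^ a * K + 2 ^ (k + 1) * (Clb k n * Cb * (Clb k n * Cb * (Λ ^ a * K))) =
            (1 + 2 ^ (k+1) * (Clb k n * Cb * (Clb k n * Cb))) * (Λ ^ a * K) := by ring
          rw [this]
          have : 1 + 2 ^ (k+1) * (Clb k n * Cb * (Clb k n * Cb)) ≤ Λ := by linarith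
          nlinarith
      · -- inactive
        push Not at hact
        obtain ⟨e1, e2⟩ := hout x hact
        have e : ∀ j, H' j =ᶠ[nhds x] H j := by
          intro j
          filter_upwards [e1, e2] with y h1 h2
          simp [hH', h1, h2]
        constructor
        · intro hxE
          have : JV k x H' = JV k x H := by
            funext j; exact jet_congr (e j)
          rw [this]
          exact (hG.cm x).mono _ _ hmonoK (g1 hxE)
        · intro μ hμ hμa j
          refine ((g2 μ hμ hμa j).congr ?_).mono (hρ μ hμ).1.le le_rfl hmonoK (by linarith [hpow0 ((insert ν S).filter (fun ν => dist x ν ≤ 3/2 * ρ ν)).card])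
          filter_upwards [e j] with y hy
          simp [hy]

/-! the net -/

theorem exists_net (x0 : En n) (r ε : ℝ) (hε : 0 < ε) (δ : En n → ℝ) (hδ : ∀ x ∈ Metric.closedBall x0 r, ε ≤ δ x) :
    ∃ T : Finset (En n), (∀ x ∈ T, x ∈ Metric.closedBall x0 r) ∧
      (∀ x ∈ T, ∀ y ∈ T, x ≠ y → min (δ x) (δ y) ≤ dist x y) ∧
      ∀ x ∈ Metric.closedBall x0 r, ∃ y ∈ T, dist x y ≤ δ y := by
  let good : Finset (En n) → Prop := fun T => (∀ x ∈ T, x ∈ Metric.closedBall x0 r) ∧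
      (∀ x ∈ T, ∀ y ∈ T, x ≠ y → min (δ x) (δ y) ≤ dist x y)
  have hbd : ∃ N : ℕ, ∀ T, good T → T.card ≤ N := by
    obtain ⟨t, _, ht, hcov⟩ := Metric.totallyBounded_iff.mp (isCompact_closedBall x0 r).totallyBounded (ε/2) (by positivity) |>.imp
      fun t h => (⟨trivial, h⟩ : True ∧ _)
    refine ⟨ht.toFinset.card, fun T hT => ?_⟩
    have hch : ∀ x ∈ T, ∃ y ∈ ht.toFinset, dist x y < ε/2 := by
      intro x hx
      have := hcov (hT.1 x hx)
      simp only [Set.mem_iUnion, Metric.mem_ball] at this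
      obtain ⟨y, hy, hd⟩ := this
      exact ⟨y, by simpa using hy, hd⟩
    choose! g hg1 hg2 using hch
    apply Finset.card_le_card_of_injOn g (fun x hx => hg1 x hx)
    intro x hx y hy hxy
    by_contra hne
    have h1 := hT.2 x hx y hy hne
    have h2 := hδ x (hT.1 x hx)
    have h3 := hδ y (hT.1 y hy)
    have h4 : ε ≤ min (δ x) (δ y) := le_min h2 h3
    have h5 := hg2 x hx
    have h6 := hg2 y hy
    rw [← hxy, dist_comm] at h6
    linarith [dist_triangle x (g x) y]
  obtain ⟨N, hN⟩ := hbd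
  have hg0 : good ∅ := ⟨by simp, by simp⟩
  have hex : ∃ T, good T ∧ ∀ T', good T' → T'.card ≤ T.card := by
    by_contra hcon
    push Not at hcon
    have : ∀ m : ℕ, ∃ T, good T ∧ m ≤ T.card := by
      intro m
      induction m with
      | zero => exact ⟨∅, hg0, by simp⟩
      | succ m ih =>
        obtain ⟨T, hT, hm⟩ := ih
        obtain ⟨T', hT', hlt⟩ := hcon T hT
        exact ⟨T', hT', by omega⟩
    obtain ⟨T, hT, hm⟩ := this (N+1)
    have := hN T hT
    omega
  obtain ⟨T, hT, hmax⟩ := hex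
  refine ⟨T, hT.1, hT.2, fun x hx => ?_⟩
  by_contra hcon
  push Not at hcon
  have hxT : x ∉ T := by
    intro h
    have := hcon x h
    rw [dist_self] at this
    linarith [hδ x hx]
  have : good (insert x T) := by
    constructor
    · intro y hy
      rcases Finset.mem_insert.mp hy with rfl | h
      · exact hx
      · exact hT.1 y h
    · intro y hy z hz hne
      rcases Finset.mem_insert.mp hy with rfl | h <;> rcases Finset.mem_insert.mp hz with rfl | h'
      · exact absurd rfl hne
      · exact (min_le_right _ _).trans (hcon z h').le
      · rw [dist_comm]; exact (min_le_left _ _).trans (hcon y h).le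
      · exact hT.2 y h z h' hne
  have := hmax _ this
  rw [Finset.card_insert_of_notMem hxT] at this
  omega

theorem overlap (T : Finset (En n)) (δ : En n → ℝ) (x : En n) (a : ℝ) (ha : 0 < a)
    (h1 : ∀ y ∈ T, dist x y ≤ 2 * a) (h2 : ∀ y ∈ T, ∀ z ∈ T, y ≠ z → a ≤ dist y z) : T.card ≤ 5 ^ n := by
  have inj : Function.Injective (fun y : En n => a⁻¹ • (y - x)) := by
    intro y z h
    have : y - x = z - x := smul_right_injective _ (inv_ne_zero ha.ne') h
    simpa using this
  have := Besicovitch.card_le_of_separated (E := En n) (T.image (fun y => a⁻¹ • (y - x))) ?_ ?_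
  · rw [Finset.card_image_of_injective _ inj] at this
    simpa using this
  · intro c hc
    obtain ⟨y, hy, rfl⟩ := Finset.mem_image.mp hc
    rw [norm_smul, Real.norm_eq_abs, abs_of_pos (by positivity), inv_mul_le_iff₀ ha, ← dist_eq_norm, dist_comm]
    linarith [h1 y hy]
  · intro c hc d hd hne
    obtain ⟨y, hy, rfl⟩ := Finset.mem_image.mp hc
    obtain ⟨z, hz, rfl⟩ := Finset.mem_image.mp hd
    have : y ≠ z := by rintro rfl; exact hne rfl
    rw [← smul_sub, norm_smul, Real.norm_eq_abs, abs_of_pos (by positivity), sub_sub_sub_cancel_right, ← dist_eq_norm]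
    rw [le_inv_mul_iff₀ ha]
    linarith [h2 y hy z hz this]

end Glue

section Main
variable {n k D : ℕ}

theorem Strong.sub {W : Type} [AddCommGroup W] [Module ℝ W] {I : Type} [Fintype I] {G G' : ℝ → Set W}
    {u : I → W →ₗ[ℝ] ℝ} {A : Finset I} {P : W} {C : ℝ} (h : Strong G u A P C) (hs : ∀ K Q, Q ∈ G K → Q ∈ G' K) :
    Strong G' u A P C := by
  obtain ⟨h1, h2, h3⟩ := h
  refine ⟨h1, hs _ _ h2, fun α hα => ?_⟩
  obtain ⟨Q, q1, q2⟩ := h3 α hα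
  exact ⟨Q, ⟨hs _ _ q1.1, hs _ _ q1.2⟩, q2⟩

theorem nu_scale (x : En n) {s s0 : ℝ} (hs0 : 0 < s0) (β : Idx k n D) (Q : Wv n D) :
    nu k x s β Q = ((s / s0) ^ ((IX k n D).m - (IX k n D).dg β))⁻¹ * nu k x s0 β Q := by
  change nu k x s β Q = ((s / s0) ^ (k + 1 - dgI β))⁻¹ * nu k x s0 β Q
  rw [nu_apply, nu_apply, div_pow]
  have : s0 ^ (k + 1 - dgI β) ≠ 0 := by positivity
  field_simp

theorem nu_eq_zero {x : En n} {s : ℝ} (hs : 0 < s) {β : Idx k n D} {Q : Wv n D} :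
    nu k x s β Q = 0 ↔ cc x β Q = 0 := by
  rw [nu_apply]
  have : s ^ (k + 1 - dgI β) ≠ 0 := by positivity
  simp [this]

theorem vanish_shift {A : Finset (Idx k n D)} (hA : (IX k n D).Mono A) {x y : En n} {P : Wv n D}
    (h : ∀ α ∈ A, cc x α P = 0) : ∀ α ∈ A, cc y α P = 0 := by
  intro α hα
  rw [← nu_eq_zero one_pos, nu_shift x y one_pos]
  apply Finset.sum_eq_zero
  intro γ _
  rw [sco]
  split_ifs with hj
  · by_cases hle : α.1.1 ≤ γ.1.1
    · rw [(nu_eq_zero one_pos).mpr (h γ (Mono_le hA hα hle hj)), mul_zero]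
    · rw [aco_eq_zero _ _ _ hle]; simp
  · rw [zero_mul]

theorem lengths (OK : En n → ℝ → Prop) (r ε : ℝ) (hε : 0 < ε) (hεr : ε ≤ r)
    (hmono : ∀ x y r1 r2, r2 + dist x y ≤ r1 → OK x r1 → OK y r2) (hOK : ∀ x, OK x ε) :
    ∃ δ : En n → ℝ, (∀ x, ε ≤ δ x ∧ δ x ≤ r ∧ OK x (δ x / 2) ∧ (2 * δ x ≤ r → ¬ OK x (2 * δ x))) ∧
      ∀ x y, δ x ≤ δ y + dist x y := by
  set S : En n → Set ℝ := fun x => {t | t ≤ r ∧ OK x t} with hS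
  have hbd : ∀ x, BddAbove (S x) := fun x => ⟨r, fun t ht => ht.1⟩
  have hne : ∀ x, (S x).Nonempty := fun x => ⟨ε, hεr, hOK x⟩
  have hge : ∀ x, ε ≤ sSup (S x) := fun x => le_csSup (hbd x) ⟨hεr, hOK x⟩
  refine ⟨fun x => sSup (S x), fun x => ⟨hge x, csSup_le (hne x) fun t ht => ht.1, ?_, ?_⟩, ?_⟩
  · have h0 := hge x
    obtain ⟨t, ht, hlt⟩ := exists_lt_of_lt_csSup (hne x) (show sSup (S x) / 2 < sSup (S x) by linarith)
    exact hmono x x t _ (by rw [dist_self]; linarith) ht.2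
  · intro h2 hok
    have := le_csSup (hbd x) (show 2 * sSup (S x) ∈ S x from ⟨h2, hok⟩)
    have h0 := hge x
    linarith
  · intro x y
    apply csSup_le (hne x)
    intro t ht
    have : t - dist x y ∈ S y := ⟨by linarith [ht.1, dist_nonneg (x := x) (y := y)], hmono x y t _ (by linarith) ht.2⟩
    linarith [le_csSup (hbd y) this]

theorem compatCore (k n D : ℕ) (Cw : ℝ) (hCw : 1 ≤ Cw) (A : Finset (Idx k n D)) (l : ℕ) (CT : ℝ) (hCT : 1 ≤ CT) :
    ∃ Cg, 1 ≤ Cg ∧ ∃ Cc, 1 ≤ Cc ∧ ∀ (E : Finset (En n)) (δmax : ℝ) (G : En n → ℝ → Set (Wv n D)),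
    GH k E δmax Cw G → ∀ y ∈ E, ∀ s s0, 0 < s → s ≤ s0 → s ≤ δmax → ∀ P,
    Strong (Gl k E G (l+1) y) (nu k y s0) A P CT →
    (¬ ∃ A' P', (IX k n D).Mono A' ∧ (IX k n D).rank A' < (IX k n D).rank A ∧ (∀ α ∈ A, cc y α (P' - P) = 0) ∧
      Strong (Gl k E G l y) (nu k y s) A' P' Cg) →
    ∀ z, dist z y ≤ s → ∀ Pz ∈ Gl k E G (l+1) z CT, (∀ α ∈ A, cc y α (Pz - P) = 0) →
      NB k y s (Pz - P) Cc := by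
  obtain ⟨Cm, hCm, hmult⟩ := multAt k n D Cw hCw l
  obtain ⟨Cd, hCd, hdich⟩ := dichotomy (W := Wv n D) (IX k n D) A CT Cm hCT hCm
  have hsh := one_le_Csh (k := k) (n := n)
  set C2 := Csh k n * CT with hC2
  have hC21 : 1 ≤ C2 := by nlinarith
  have hCTC2 : CT ≤ C2 := by nlinarith
  have hcard : (0:ℝ) ≤ A.card := by positivity
  have hK : 1 ≤ (A.card + 1) * Cd + C2 := by nlinarith
  obtain ⟨Cg, hCg, H⟩ := hdich _ hK
  have hb : 0 ≤ (A.card + 1) * Cd * C2 := by positivity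
  refine ⟨Cg, hCg, C2 + 2 * (1 + (A.card + 1) * Cd * C2), by linarith, ?_⟩
  intro E δmax G hG y hy s s0 hs hss0 hsm P hP hbad z hz Pz hPz hvan
  have hs0 : 0 < s0 := by linarith
  obtain ⟨P'', hP'', hNB⟩ := hPz.2 y hy
  have hN1 : NB k y s (Pz - P'') C2 :=
    NB.shift (hNB.mono dist_nonneg hz le_rfl (by linarith)) (by linarith) hz
  rcases H (Gl k E G l y) (nu k y s0) (nu k y s) _ P (s / s0) (hG.cml l y) (by positivity)
    ((div_le_one hs0).mpr hss0) (fun β Q => nu_scale y hs0 β Q) (hmult E δmax G hG y hy s hs hsm)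
    (hP.sub fun K Q hQ => hQ.1) with h | ⟨h1, h2⟩
  · obtain ⟨A', P', a1, a2, a3, -, a5⟩ := h
    exact absurd ⟨A', P', a1, a2, fun α hα => (nu_eq_zero hs).mp (a3 α hα), a5⟩ hbad
  · have key := uniqBound (hG.cml l y) h1 hC21 le_rfl h2 ((hG.cml l y).mono _ _ hCTC2 hP'') (by
      intro α hα
      have e : P'' - P = (Pz - P) - (Pz - P'') := by abel
      rw [e, map_sub, (nu_eq_zero hs).mpr (hvan α hα), zero_sub, abs_neg]
      exact (NB_iff hs).mp hN1 α)
    have := hN1.add ((NB_iff hs).mpr key)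
    rwa [sub_add_sub_cancel] at this

/-- conclusion of the main lemma -/
def Concl (k : ℕ) {n D : ℕ} (E : Finset (En n)) (G : En n → ℝ → Set (Wv n D)) (x0 : En n) (r : ℝ) (P0 : Wv n D)
    (C : ℝ) (F : Fin D → En n → ℝ) : Prop :=
  (∀ j, Sm (F j)) ∧ (∀ z ∈ E, dist z x0 ≤ r → JV k z F ∈ G z C) ∧
    ∀ x, dist x x0 ≤ r → ∀ j, FB k x r (F j - pev (P0 j)) C

def MLP (k n D : ℕ) (Cw CB : ℝ) (l : ℕ) (A : Finset (Idx k n D)) (Ah C : ℝ) : Prop :=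
  ∀ (E : Finset (En n)) (δmax : ℝ) (G : En n → ℝ → Set (Wv n D)), GH k E δmax Cw G →
    ∀ x0 ∈ E, ∀ r, 0 < r → r ≤ δmax → ∀ P0, Strong (Gl k E G l x0) (nu k x0 (Ah * r)) A P0 CB →
    ∃ F, Concl k E G x0 r P0 C F

def lev (k n D : ℕ) (A : Finset (Idx k n D)) : ℕ := 2 * (IX k n D).rank A + 2

theorem localCore (k n D : ℕ) (Cw : ℝ) (hCw : 1 ≤ Cw) (A : Finset (Idx k n D)) (l : ℕ) (hl : l + 2 = lev k n D A)
    (IH : ∀ A', (IX k n D).Mono A' → (IX k n D).rank A' < (IX k n D).rank A → ∀ CB, 1 ≤ CB → ∃ A0, 1 ≤ A0 ∧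
      ∀ Ah, A0 ≤ Ah → ∃ C, 1 ≤ C ∧ MLP k n D Cw CB (lev k n D A') A' Ah C)
    (CT : ℝ) (hCT : 1 ≤ CT) (C1 : ℝ) (hC1 : 1 ≤ C1) :
    ∃ A2, 1 ≤ A2 ∧ ∃ CL, 1 ≤ CL ∧ ∀ (E : Finset (En n)) (δmax : ℝ) (G : En n → ℝ → Set (Wv n D)),
    GH k E δmax Cw G → ∀ y ∈ E, ∀ δ s0, 0 < δ → A2 * δ ≤ s0 → ∀ P, Strong (Gl k E G (l+1) y) (nu k y s0) A P CT →
    ∀ s, A2 * δ ≤ s → s ≤ δmax →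
    (∃ A' P', (IX k n D).Mono A' ∧ (IX k n D).rank A' < (IX k n D).rank A ∧ (∀ α ∈ A, cc y α (P' - P) = 0) ∧
      Strong (Gl k E G l y) (nu k y s) A' P' C1) →
    ∃ F, Concl k E G y δ P CL F := by
  obtain ⟨Cm, hCm, hmult⟩ := multAt k n D Cw hCw l
  obtain ⟨Cd, hCd, hdich⟩ := dichotomy (W := Wv n D) (IX k n D) A CT Cm hCT hCm
  obtain ⟨C3, hC3, hdich⟩ := hdich C1 hC1
  have hR : ∃ R, 1 ≤ R ∧ ∀ B : Finset (Idx k n D), ∀ (E : Finset (En n)) (δmax : ℝ) (G : En n → ℝ → Set (Wv n D)),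
    GH k E δmax Cw G → ∀ y ∈ E, ∀ s s0, 0 < s → s ≤ s0 → s ≤ δmax → ∀ P,
      Strong (Gl k E G l y) (nu k y s0) B P C1 → ∃ A', (IX k n D).Mono A' ∧
        (IX k n D).rank A' ≤ (IX k n D).rank B ∧ Strong (Gl k E G l y) (nu k y s) A' P R := by
    apply exists_unif
    · intro B C C' hCC h E δmax G hG y hy s s0 hs hss0 hsm P hP
      obtain ⟨A', a1, a2, a3⟩ := h E δmax G hG y hy s s0 hs hss0 hsm P hP
      exact ⟨A', a1, a2, a3.mono (hG.cml l y) hCC⟩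
    · intro B
      obtain ⟨R, -, h⟩ := relabel (W := Wv n D) (IX k n D) B C1 Cm hC1 hCm
      refine ⟨R, fun E δmax G hG y hy s s0 hs hss0 hsm P hP => ?_⟩
      have hs0 : 0 < s0 := by linarith
      obtain ⟨A', a1, a2, -, a4⟩ := h (Gl k E G l y) (nu k y s0) (nu k y s) _ P (s / s0) (hG.cml l y) (by positivity)
        ((div_le_one hs0).mpr hss0) (fun β Q => nu_scale y hs0 β Q) (hmult E δmax G hG y hy s hs hsm) hP
      exact ⟨A', a1, a2, a4⟩
  obtain ⟨R, hR1, hR⟩ := hR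
  set C2 := max C3 R with hC2
  have hC21 : 1 ≤ C2 := le_max_of_le_left hC3
  have hA2 : ∃ A2, 1 ≤ A2 ∧ ∀ A', (IX k n D).Mono A' → (IX k n D).rank A' < (IX k n D).rank A →
      ∀ Ah, A2 ≤ Ah → ∃ C, 1 ≤ C ∧ MLP k n D Cw C2 (lev k n D A') A' Ah C := by
    apply exists_unif
    · intro A' a b hab h h1 h2 Ah hAh
      exact h h1 h2 Ah (hab.trans hAh)
    · intro A'
      by_cases h : (IX k n D).Mono A' ∧ (IX k n D).rank A' < (IX k n D).rank A
      · obtain ⟨A0, -, h0⟩ := IH A' h.1 h.2 C2 hC21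
        exact ⟨A0, fun _ _ => h0⟩
      · exact ⟨0, fun h1 h2 => absurd ⟨h1, h2⟩ h⟩
  obtain ⟨A2, hA21, hA2⟩ := hA2
  have hCI : ∃ CI, 1 ≤ CI ∧ ∀ A', (IX k n D).Mono A' → (IX k n D).rank A' < (IX k n D).rank A →
      MLP k n D Cw C2 (lev k n D A') A' A2 CI := by
    apply exists_unif
    · intro A' a b hab h h1 h2 E δmax G hG x0 hx0 r hr hrm P0 hP0
      obtain ⟨F, f1, f2, f3⟩ := h h1 h2 E δmax G hG x0 hx0 r hr hrm P0 hP0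
      have ha : 0 < a := hG.pos _ _ _ (f2 x0 hx0 (by rw [dist_self]; exact hr.le))
      exact ⟨F, f1, fun z hz hd => (hG.cm z).mono _ _ hab (f2 z hz hd),
        fun x hx j => (f3 x hx j).mono hr.le le_rfl hab (by linarith)⟩
    · intro A'
      by_cases h : (IX k n D).Mono A' ∧ (IX k n D).rank A' < (IX k n D).rank A
      · obtain ⟨C, -, h0⟩ := hA2 A' h.1 h.2 A2 le_rfl
        exact ⟨C, fun _ _ => h0⟩
      · exact ⟨0, fun h1 h2 => absurd ⟨h1, h2⟩ h⟩
  obtain ⟨CI, hCI1, hCI⟩ := hCI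
  have hsh := one_le_Csh (k := k) (n := n)
  have hsh1 : 0 ≤ A2 ^ (k+1) * (Csh k n * 1) := by positivity
  refine ⟨A2, hA21, CI + A2 ^ (k+1) * (Csh k n * 1), by linarith, ?_⟩
  intro E δmax G hG y hy δ s0 hδ hδs0 P hP s hs hsm hgood
  have hsc : 0 < A2 * δ := by positivity
  have hs0 : 0 < s0 := by linarith
  have hδA : δ ≤ A2 * δ := by nlinarith
  have hkey : ∃ A' P', (IX k n D).Mono A' ∧ (IX k n D).rank A' < (IX k n D).rank A ∧
      NB k y (A2 * δ) (P' - P) 1 ∧ Strong (Gl k E G l y) (nu k y (A2 * δ)) A' P' C2 := by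
    rcases hdich (Gl k E G l y) (nu k y s0) (nu k y (A2 * δ)) _ P ((A2 * δ) / s0) (hG.cml l y) (by positivity)
      ((div_le_one hs0).mpr hδs0) (fun β Q => nu_scale y hs0 β Q) (hmult E δmax G hG y hy _ hsc (by linarith))
      (hP.sub fun K Q hQ => hQ.1) with h | ⟨h1, h2⟩
    · obtain ⟨A', P', a1, a2, -, a4, a5⟩ := h
      exact ⟨A', P', a1, a2, (NB_iff hsc).mpr a4, a5.mono (hG.cml l y) (le_max_left _ _)⟩
    · obtain ⟨A', P', a1, a2, a3, a4⟩ := hgood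
      obtain ⟨A'', b1, b2, b3⟩ := hR A' E δmax G hG y hy (A2 * δ) s hsc hs (by linarith) P' a4
      exact ⟨A'', P', b1, lt_of_le_of_lt b2 a2,
        (NB_iff hsc).mpr (h2 P' a4.2.1 fun α hα => (nu_eq_zero hsc).mpr (a3 α hα)),
        b3.mono (hG.cml l y) (le_max_right _ _)⟩
  obtain ⟨A', P', a1, a2, a3, a4⟩ := hkey
  obtain ⟨F, f1, f2, f3⟩ := hCI A' a1 a2 E δmax G hG y hy δ hδ (by linarith) P'
    (a4.sub fun K Q hQ => Gl_sub (by unfold lev at *; omega) hQ)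
  have dP : DV k P := hG.degl hP.2.1
  have dP' : DV k P' := hG.degl a4.2.1
  refine ⟨F, f1, fun z hz hd => (hG.cm z).mono _ _ (by linarith) (f2 z hz hd), fun x hx j => ?_⟩
  have n1 : NB k x (A2 * δ) (P' - P) (Csh k n * 1) := a3.shift zero_le_one (by rw [dist_comm]; linarith)
  have n2 : NB k x δ (P' - P) (A2 ^ (k+1) * (Csh k n * 1)) :=
    n1.rescale hsc.le hδ.le hA21 (by linarith) le_rfl
  have n3 := FB.of_NB (dP'.sub dP) n2 hδ.le hsh1 j
  rw [Pi.sub_apply, pev_sub] at n3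
  exact (f3 x hx j).tri n3 (f1 j) (Sm.pev _) (Sm.pev _)

end Main

section Main
variable {n k D : ℕ}

theorem NB.shift8 {x y : En n} {δ K : ℝ} {P : Wv n D} (h : NB k y δ P K) (hδ : 0 < δ) (hK : 0 ≤ K)
    (hd : dist y x ≤ 8 * δ) : NB k x δ P (8 ^ (k+1) * (Csh k n * K)) := by
  have h1 : NB k y (8 * δ) P K := h.mono hδ.le (by linarith) le_rfl hK
  have hsh := one_le_Csh (k := k) (n := n)
  exact (h1.shift hK hd).rescale (by positivity) hδ.le (by norm_num) (by positivity) le_rfl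

/-- minimal separation of a finite set -/
theorem exists_sep (E : Finset (En n)) (r : ℝ) (hr : 0 < r) : ∃ ε, 0 < ε ∧ ε ≤ r ∧
    ∀ x, ∀ y ∈ E, ∀ z ∈ E, dist x y ≤ ε → dist x z ≤ ε → y = z := by
  have h : ∀ p : (En n) × (En n), ∃ ε : ℝ, 0 < ε ∧ (p.1 ≠ p.2 → 2 * ε < dist p.1 p.2) := by
    intro p
    by_cases hp : p.1 = p.2
    · exact ⟨1, one_pos, fun h => absurd hp h⟩
    · have := dist_pos.mpr hp
      exact ⟨dist p.1 p.2 / 4, by positivity, fun _ => by linarith⟩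
  choose e he1 he2 using h
  have hex : ∃ ε, 0 < ε ∧ ∀ p ∈ E ×ˢ E, ε ≤ e p := by
    induction (E ×ˢ E) using Finset.induction_on with
    | empty => exact ⟨1, one_pos, by simp⟩
    | insert a s ha ih =>
      obtain ⟨ε, h1, h2⟩ := ih
      refine ⟨min ε (e a), lt_min h1 (he1 a), fun p hp => ?_⟩
      rcases Finset.mem_insert.mp hp with rfl | hp
      · exact min_le_right _ _
      · exact (min_le_left _ _).trans (h2 p hp)
  obtain ⟨ε, h1, h2⟩ := hex
  refine ⟨min ε r, lt_min h1 hr, min_le_right _ _, fun x y hy z hz hxy hxz => ?_⟩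
  by_contra hne
  have a1 := h2 (y, z) (Finset.mk_mem_product hy hz)
  have a2 := he2 (y, z) hne
  have a3 := dist_triangle_left y z x
  have a4 := min_le_left ε r
  simp only at a2
  linarith

set_option maxHeartbeats 1000000 in
theorem mainStep (k n D : ℕ) (Cw : ℝ) (hCw : 1 ≤ Cw) (A : Finset (Idx k n D)) (hA : (IX k n D).Mono A)
    (IH : ∀ A', (IX k n D).Mono A' → (IX k n D).rank A' < (IX k n D).rank A → ∀ CB, 1 ≤ CB → ∃ A0, 1 ≤ A0 ∧
      ∀ Ah, A0 ≤ Ah → ∃ C, 1 ≤ C ∧ MLP k n D Cw CB (lev k n D A') A' Ah C)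
    (CB : ℝ) (hCB : 1 ≤ CB) : ∃ A0, 1 ≤ A0 ∧
      ∀ Ah, A0 ≤ Ah → ∃ C, 1 ≤ C ∧ MLP k n D Cw CB (lev k n D A) A Ah C := by
  obtain ⟨AT, hAT, CT, hCT, htr⟩ := transportG k n D A hA CB hCB
  obtain ⟨l, hl⟩ : ∃ l, l + 2 = lev k n D A := ⟨_, rfl⟩
  obtain ⟨Cg, hCg, Cc, hCc, hcomp⟩ := compatCore k n D Cw hCw A l CT hCT
  obtain ⟨A2, hA2, CL, hCL, hloc⟩ := localCore k n D Cw hCw A l hl IH CT hCT Cg hCg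
  obtain ⟨A1, hA1⟩ : ∃ A1, A1 = 2 * A2 + 8 := ⟨_, rfl⟩
  have hsh := one_le_Csh (k := k) (n := n)
  refine ⟨AT + 2 * A1, by linarith, fun Ah hAh => ?_⟩
  obtain ⟨CR, hCR⟩ : ∃ CR, CR = (2 * A1 * Ah) ^ (k+1) * CT + (2 * A1) ^ (k+1) * (Csh k n * Cc) := ⟨_, rfl⟩
  have hA10 : 0 < A1 := by linarith
  have hAh0 : 0 < Ah := by linarith
  have hCR1 : 0 ≤ (2 * A1 * Ah) ^ (k+1) * CT := by positivity
  have hCR2 : 0 ≤ (2 * A1) ^ (k+1) * (Csh k n * Cc) := by positivity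
  have hCR0 : 0 ≤ CR := by linarith
  obtain ⟨CX, hCX⟩ : ∃ CX, CX = 8 ^ (k+1) * (Csh k n * CR) := ⟨_, rfl⟩
  have hCX0 : 0 ≤ CX := by rw [hCX]; positivity
  obtain ⟨K0, hK0⟩ : ∃ K0, K0 = (20:ℝ) ^ (k+1) * (CL + (CX + CX) + 2 ^ (k+1) * CL) := ⟨_, rfl⟩
  have hK00 : 0 ≤ K0 := by rw [hK0]; positivity
  obtain ⟨K', hK', hglue⟩ := glue k n D Cw hCw (5 ^ n) (K0 + CL + CT) (by linarith)
  obtain ⟨Cz, hCz⟩ : ∃ Cz, Cz = Ah ^ (k+1) * (Csh k n * CT) := ⟨_, rfl⟩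
  have hCz0 : 0 ≤ Cz := by rw [hCz]; positivity
  refine ⟨K' + CL + Cz, by linarith, ?_⟩
  intro E δmax G hG x0 hx0 r hr hrm P0 hP0
  rw [← hl] at hP0
  have hs0 : 0 < Ah * r := by positivity
  have dP0 : DV k P0 := hG.degl hP0.2.1
  -- auxiliary polynomials
  have haux : ∀ y, ∃ P', y ∈ E → dist y x0 ≤ r → (∀ α ∈ A, cc y α (P' - P0) = 0) ∧
      NB k y (Ah * r) (P' - P0) CT ∧ Strong (Gl k E G (l+1) y) (nu k y (Ah * r)) A P' CT := by
    intro y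
    by_cases hy : y ∈ E ∧ dist y x0 ≤ r
    · obtain ⟨P', p1, p2, p3⟩ := htr E δmax Cw G hG (l+1) x0 y hy.1 (Ah * r) hs0 (by
        have h1 : AT * dist x0 y ≤ AT * r := mul_le_mul_of_nonneg_left (by rw [dist_comm]; exact hy.2) (by linarith)
        have h2 : AT * r ≤ Ah * r := mul_le_mul_of_nonneg_right (by linarith) hr.le
        linarith) P0 hP0
      exact ⟨P', fun _ _ => ⟨fun α hα => (nu_eq_zero hs0).mp (p1 α hα), (NB_iff hs0).mpr p2, p3⟩⟩
    · exact ⟨0, fun h1 h2 => absurd ⟨h1, h2⟩ hy⟩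
  choose Py hPy using haux
  have dPy : ∀ y ∈ E, dist y x0 ≤ r → DV k (Py y) := fun y h1 h2 => hG.degl (hPy y h1 h2).2.2.2.1
  have hvan : ∀ y ∈ E, dist y x0 ≤ r → ∀ z ∈ E, dist z x0 ≤ r → ∀ w, ∀ α ∈ A, cc w α (Py y - Py z) = 0 := by
    intro y h1 h2 z h3 h4 w α hα
    have e : Py y - Py z = (Py y - P0) - (Py z - P0) := by abel
    rw [e, map_sub, vanish_shift hA (hPy y h1 h2).1 α hα, vanish_shift hA (hPy z h3 h4).1 α hα, sub_zero]
  -- good points and length scales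
  obtain ⟨good, hgood⟩ : ∃ good : En n → ℝ → Prop, ∀ y s, good y s ↔ s ≤ δmax ∧
    ∃ A' P', (IX k n D).Mono A' ∧ (IX k n D).rank A' < (IX k n D).rank A ∧ (∀ α ∈ A, cc y α (P' - Py y) = 0) ∧
      Strong (Gl k E G l y) (nu k y s) A' P' Cg := ⟨_, fun _ _ => Iff.rfl⟩
  obtain ⟨OK, hOK⟩ : ∃ OK : En n → ℝ → Prop, ∀ x t, OK x t ↔
      (∀ y ∈ E, dist y x0 ≤ r → dist x y ≤ t → ∃ s, A1 * t ≤ s ∧ good y s) ∨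
      (∀ y ∈ E, dist y x0 ≤ r → ∀ z ∈ E, dist z x0 ≤ r → dist x y ≤ t → dist x z ≤ t → y = z) :=
    ⟨_, fun _ _ => Iff.rfl⟩
  obtain ⟨ε, hε, hεr, hsep⟩ := exists_sep E r hr
  obtain ⟨δ, hδ, hLip⟩ := lengths OK r ε hε hεr (by
      intro x y r1 r2 h12 h
      rw [hOK] at h ⊢
      have hd := dist_nonneg (x := x) (y := y)
      rcases h with h | h
      · left
        intro z hz hz0 hyz
        obtain ⟨s, s1, s2⟩ := h z hz hz0 (by linarith [dist_triangle x y z])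
        exact ⟨s, by nlinarith, s2⟩
      · right
        intro z hz hz0 w hw hw0 hyz hyw
        exact h z hz hz0 w hw hw0 (by linarith [dist_triangle x y z]) (by linarith [dist_triangle x y w]))
    (by
      intro x
      rw [hOK]
      right
      intro y hy _ z hz _ h1 h2
      exact hsep x y hy z hz h1 h2)
  -- local solutions
  have hlocal : ∀ x, ∃ y F, dist x x0 ≤ r → (y ∈ E ∧ dist y x0 ≤ r ∧ dist x y ≤ 2 * δ x ∧ (∀ j, Sm (F j)) ∧
      (∀ z ∈ E, dist z x0 ≤ r → dist z x ≤ δ x / 2 → JV k z F ∈ G z (CL + CT)) ∧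
      ∀ z, dist z x ≤ δ x / 2 → ∀ j, FB k z (δ x) (F j - pev (Py y j)) CL) := by
    intro x
    by_cases hx : dist x x0 ≤ r
    swap
    · exact ⟨x, fun _ _ => 0, fun h => absurd h hx⟩
    obtain ⟨d1, d2, d3, d4⟩ := hδ x
    have hd0 : 0 < δ x := by linarith
    have hpoly : ∀ y ∈ E, dist y x0 ≤ r → dist x y ≤ 2 * δ x →
        (∀ z ∈ E, dist z x0 ≤ r → dist z x ≤ δ x / 2 → z = y) →
        ∃ y F, dist x x0 ≤ r → (y ∈ E ∧ dist y x0 ≤ r ∧ dist x y ≤ 2 * δ x ∧ (∀ j, Sm (F j)) ∧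
      (∀ z ∈ E, dist z x0 ≤ r → dist z x ≤ δ x / 2 → JV k z F ∈ G z (CL + CT)) ∧
      ∀ z, dist z x ≤ δ x / 2 → ∀ j, FB k z (δ x) (F j - pev (Py y j)) CL) := by
      intro y hy hy0 hxy huniq
      refine ⟨y, fun j => pev (Py y j), fun _ => ⟨hy, hy0, hxy, fun j => Sm.pev _, ?_, ?_⟩⟩
      · intro z hz hz0 hzx
        obtain rfl := huniq z hz hz0 hzx
        have e : JV k z (fun j => pev (Py z j)) = Py z := by
          funext j
          exact jet_pev (dPy z hz hz0 j) z
        rw [e]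
        exact (hG.cm z).mono _ _ (by linarith) (Gl_sub (Nat.zero_le _) (hPy z hz hz0).2.2.2.1)
      · intro z hzx j
        rw [sub_self]
        intro α hα
        have e0 : Tj z (0 : En n → ℝ) = 0 := Tj_zero z
        rw [e0, map_zero, abs_zero]
        positivity
    by_cases hne : ∃ y ∈ E, dist y x0 ≤ r ∧ dist x y ≤ δ x / 2
    · obtain ⟨y, hy, hy0, hxy⟩ := hne
      rcases (hOK _ _).mp d3 with h | h
      · obtain ⟨s, s1, s2⟩ := h y hy hy0 hxy
        obtain ⟨s3, s4⟩ := (hgood _ _).mp s2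
        have hA2s : A2 * δ x ≤ s := by nlinarith
        obtain ⟨F, f1, f2, f3⟩ := hloc E δmax G hG y hy (δ x) (Ah * r) hd0 (by
            calc A2 * δ x ≤ A2 * r := mul_le_mul_of_nonneg_left d2 (by linarith)
              _ ≤ Ah * r := mul_le_mul_of_nonneg_right (by linarith) hr.le) (Py y)
          (hPy y hy hy0).2.2 s hA2s s3 s4
        have hb : ∀ z, dist z x ≤ δ x / 2 → dist z y ≤ δ x := fun z hz => by linarith [dist_triangle z x y]
        exact ⟨y, F, fun _ => ⟨hy, hy0, by linarith, f1,
          fun z hz _ hzx => (hG.cm z).mono _ _ (by linarith) (f2 z hz (hb z hzx)), fun z hzx j => f3 z (hb z hzx) j⟩⟩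
      · exact hpoly y hy hy0 (by linarith) fun z hz hz0 hzx => h z hz hz0 y hy hy0 (by rw [dist_comm]; exact hzx) hxy
    · have hex : ∃ y ∈ E, dist y x0 ≤ r ∧ dist x y ≤ 2 * δ x := by
        by_cases h2 : 2 * δ x ≤ r
        · have h3 := d4 h2
          rw [hOK] at h3
          push Not at h3
          obtain ⟨y, hy, hy0, -, -, -, hxy, -⟩ := h3.2
          exact ⟨y, hy, hy0, hxy⟩
        · exact ⟨x0, hx0, by rw [dist_self]; exact hr.le, by linarith⟩
      obtain ⟨y, hy, hy0, hxy⟩ := hex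
      exact hpoly y hy hy0 hxy fun z hz hz0 hzx => absurd ⟨z, hz, hz0, by rw [dist_comm]; exact hzx⟩ hne
  choose yy Fl hFl using hlocal
  -- comparison
  have hcmp : ∀ x, dist x x0 ≤ r → ∃ R, ∀ y ∈ E, dist y x0 ≤ r → dist x y ≤ 8 * δ x →
      NB k y (δ x) (Py y - R) CR := by
    intro x hx
    obtain ⟨d1, d2, d3, d4⟩ := hδ x
    have hd0 : 0 < δ x := by linarith
    by_cases hcase : 2 * δ x ≤ r ∧ 2 * A1 * δ x ≤ δmax
    · have h3 := d4 hcase.1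
      rw [hOK] at h3
      push Not at h3
      obtain ⟨⟨yb, hyb, hyb0, hxyb, hbad⟩, -⟩ := h3
      have hb1 := hbad (2 * A1 * δ x) (by linarith)
      rw [hgood] at hb1
      push Not at hb1
      have hb2 := hb1 hcase.2
      refine ⟨Py yb, fun y hy hy0 hxy => ?_⟩
      have hsc : 0 < 2 * A1 * δ x := by positivity
      have hdd : dist y yb ≤ 2 * A1 * δ x := by
        have h5 : dist y yb ≤ 10 * δ x := by linarith [dist_triangle_left y yb x]
        nlinarith
      have key := hcomp E δmax G hG yb hyb (2 * A1 * δ x) (Ah * r) hsc (by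
          calc 2 * A1 * δ x ≤ 2 * A1 * r := mul_le_mul_of_nonneg_left d2 (by linarith)
            _ ≤ Ah * r := mul_le_mul_of_nonneg_right (by linarith) hr.le) hcase.2 (Py yb) (hPy yb hyb hyb0).2.2
        (by
          rintro ⟨A', P', a1, a2, a3, a4⟩
          exact hb2 A' P' a1 a2 a3 a4) y hdd (Py y) (hPy y hy hy0).2.2.2.1
        (hvan y hy hy0 yb hyb hyb0 yb)
      have k2 := (key.shift (by linarith) (by rw [dist_comm]; exact hdd)).rescale hsc.le hd0.le (t := 2 * A1) (by linarith)
        (by positivity) le_rfl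
      exact k2.mono hd0.le le_rfl (by linarith) hCR0
    · refine ⟨P0, fun y hy hy0 hxy => ?_⟩
      have hle : Ah * r ≤ (2 * A1 * Ah) * δ x := by
        have : r ≤ 2 * A1 * δ x := by
          by_contra hlt
          push Not at hlt
          apply hcase
          constructor
          · nlinarith
          · linarith
        nlinarith
      have k2 := (hPy y hy hy0).2.1.rescale hs0.le hd0.le (t := 2 * A1 * Ah) (by nlinarith) (by linarith) hle
      exact k2.mono hd0.le le_rfl (by linarith) hCR0
  -- net
  obtain ⟨T, hT1, hT2, hT3⟩ := exists_net x0 r (ε / 20) (by positivity) (fun x => δ x / 20)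
    (fun x _ => by linarith [(hδ x).1])
  have hT0 : ∀ ν ∈ T, dist ν x0 ≤ r := fun ν hν => Metric.mem_closedBall.mp (hT1 ν hν)
  have hratio : ∀ x ν, dist x ν ≤ 3/2 * (δ ν / 20) → δ ν ≤ (1000/925) * δ x ∧ δ x ≤ (1075/1000) * δ ν := by
    intro x ν h
    have h1 := hLip x ν
    have h2 := hLip ν x
    rw [dist_comm] at h2
    constructor <;> linarith
  have hpos : ∀ x, 0 < δ x := fun x => by linarith [(hδ x).1]
  obtain ⟨H, hH1, hH2⟩ := hglue E δmax G hG (Metric.closedBall x0 r) T (fun x => δ x / 20) Fl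
    (fun ν hν => ⟨by linarith [hpos ν], by linarith [hpos ν, (hδ ν).2.1]⟩)
    (fun ν hν => (hFl ν (hT0 ν hν)).2.2.2.1)
    (by
      intro x hx ν hν hxν hxE
      exact (hG.cm x).mono _ _ (by linarith) ((hFl ν (hT0 ν hν)).2.2.2.2.1 x hxE (Metric.mem_closedBall.mp hx)
        (by linarith [hpos ν])))
    (by
      intro x hx ν hν μ hμ hxν hxμ
      obtain ⟨r1, r2⟩ := hratio x ν hxν
      obtain ⟨r3, r4⟩ := hratio x μ hxμ
      have hνμ : δ ν ≤ 2 * δ μ := by linarith [hpos μ, hpos ν]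
      have hμν : δ μ ≤ 2 * δ ν := by linarith [hpos μ, hpos ν]
      refine ⟨by linarith, fun j => ?_⟩
      obtain ⟨a1, a2, a3, a4, a5, a6⟩ := hFl ν (hT0 ν hν)
      obtain ⟨b1, b2, b3, b4, b5, b6⟩ := hFl μ (hT0 μ hμ)
      have hp := hpos ν
      have hq := hpos μ
      obtain ⟨R, hR⟩ := hcmp ν (hT0 ν hν)
      have hxν2 := dist_comm x ν
      have hxμ2 := dist_comm x μ
      have hνyμ : dist ν (yy μ) ≤ 8 * δ ν := by
        linarith [dist_triangle ν x (yy μ), dist_triangle x μ (yy μ)]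
      have n1 := (hR (yy ν) a1 a2 (by linarith)).shift8 (x := x) hp hCR0 (by
        rw [dist_comm]; linarith [dist_triangle x ν (yy ν)])
      have n2 := (hR (yy μ) b1 b2 hνyμ).shift8 (x := x) hp hCR0 (by
        rw [dist_comm]; linarith [dist_triangle x μ (yy μ)])
      rw [← hCX] at n1 n2
      have n3 := n1.sub n2
      rw [sub_sub_sub_cancel_right] at n3
      have n4 := FB.of_NB ((dPy _ a1 a2).sub (dPy _ b1 b2)) n3 hp.le (by linarith) j
      rw [Pi.sub_apply, pev_sub] at n4
      have f1 := a6 x (by linarith) j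
      have f2 := ((b6 x (by linarith) j).symm (b4 j) (Sm.pev _)).rescale hq.le hp.le (t := 2) (by norm_num)
        (by linarith) hμν
      have f3 := (f1.tri n4 (a4 j) (Sm.pev _) (Sm.pev _)).tri f2 (a4 j) (Sm.pev _) (b4 j)
      have f4 := f3.rescale (ρ' := δ ν / 20) hp.le (by linarith) (t := 20) (by norm_num) (by positivity) (by linarith)
      rw [← hK0] at f4
      exact f4.mono (by linarith) le_rfl (by linarith) (by linarith))
    (by
      intro x hx
      have hp := hpos x
      apply overlap _ δ x (δ x * (46/1000)) (by positivity)
      · intro y hy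
        have h1 := (Finset.mem_filter.mp hy).2
        obtain ⟨r1, r2⟩ := hratio x y h1
        linarith
      · intro y hy z hz hyz
        obtain ⟨y1, y2⟩ := Finset.mem_filter.mp hy
        obtain ⟨z1, z2⟩ := Finset.mem_filter.mp hz
        refine le_trans (le_min ?_ ?_) (hT2 y y1 z z1 hyz)
        · have := (hratio x y y2).2
          linarith
        · have := (hratio x z z2).2
          linarith)
    hT3
  refine ⟨H, hH1, fun z hz hz0 => ?_, fun x hx j => ?_⟩
  · exact (hG.cm z).mono _ _ (by linarith) ((hH2 z (Metric.mem_closedBall.mpr hz0)).1 hz)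
  · have hxB := Metric.mem_closedBall.mpr hx
    obtain ⟨ν, hν, hxν⟩ := hT3 x hxB
    have hp := hpos ν
    obtain ⟨a1, a2, a3, a4, a5, a6⟩ := hFl ν (hT0 ν hν)
    have g1 := ((hH2 x hxB).2 ν hν (by linarith) j).mono (by linarith)
      (show δ ν / 20 ≤ r by linarith [(hδ ν).2.1]) le_rfl (by linarith)
    have g2 := (a6 x (by linarith) j).mono hp.le (hδ ν).2.1 le_rfl (by linarith)
    have g3 := ((hPy (yy ν) a1 a2).2.1.shift (y := x) (by linarith) (by
      have : dist (yy ν) x ≤ 2 * r := by linarith [dist_triangle_right (yy ν) x x0]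
      nlinarith)).rescale hs0.le hr.le (t := Ah) (by linarith) (by positivity) le_rfl
    rw [← hCz] at g3
    have g4 := FB.of_NB ((dPy _ a1 a2).sub dP0) g3 hr.le hCz0 j
    rw [Pi.sub_apply, pev_sub] at g4
    exact (g1.tri g2 (hH1 j) (a4 j) (Sm.pev _)).tri g4 (hH1 j) (Sm.pev _) (Sm.pev _)

theorem mainLemma (k n D : ℕ) (Cw : ℝ) (hCw : 1 ≤ Cw) : ∀ N, ∀ A : Finset (Idx k n D), (IX k n D).Mono A →
    (IX k n D).rank A = N → ∀ CB, 1 ≤ CB → ∃ A0, 1 ≤ A0 ∧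
      ∀ Ah, A0 ≤ Ah → ∃ C, 1 ≤ C ∧ MLP k n D Cw CB (lev k n D A) A Ah C := by
  intro N
  induction N using Nat.strong_induction_on with
  | _ N ih =>
    intro A hA hN CB hCB
    apply mainStep k n D Cw hCw A hA _ CB hCB
    intro A' hA' hr
    exact ih _ (hN ▸ hr) A' hA' rfl

end Main

section Final
open MvPolynomial
variable {n k D : ℕ}

theorem deg_symm (α : Fin n → ℕ) : (Finsupp.equivFunOnFinite.symm α).degree = ∑ i, α i := by
  rw [Finsupp.degree_eq_sum]; rfl

theorem fac_le_pow (L : ℝ) (k : ℕ) (α : Fin n → ℕ) (hα : ∑ i, α i ≤ k) (hL : (k:ℝ) ≤ L) :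
    (∏ i, ((α i).factorial : ℝ)) ≤ L ^ (∑ i, α i) := by
  have h1 : (∏ i, (α i).factorial) ≤ (∑ i, α i).factorial :=
    Nat.le_of_dvd (Nat.factorial_pos _) (Nat.prod_factorial_dvd_factorial_sum _ _)
  have h2 : (∑ i, α i).factorial ≤ (∑ i, α i) ^ (∑ i, α i) := Nat.factorial_le_pow _
  calc (∏ i, ((α i).factorial : ℝ)) = ((∏ i, (α i).factorial : ℕ) : ℝ) := by push_cast; rfl
    _ ≤ (((∑ i, α i) ^ (∑ i, α i) : ℕ) : ℝ) := by exact_mod_cast h1.trans h2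
    _ = ((∑ i, α i : ℕ) : ℝ) ^ (∑ i, α i) := by rw [Nat.cast_pow]
    _ ≤ L ^ (∑ i, α i) := by
      apply pow_le_pow_left₀ (by positivity)
      exact le_trans (by exact_mod_cast hα) hL

theorem cube_convex (a : En n) (δ : ℝ) : Convex ℝ (cube a δ) := by
  intro x hx y hy s t hs ht hst i
  have h1 := hx i
  have h2 := hy i
  simp only [PiLp.add_apply, PiLp.smul_apply, smul_eq_mul]
  obtain rfl : s = 1 - t := by linarith
  constructor <;> nlinarith

theorem cube_interior (a : En n) (δ : ℝ) (hδ : 0 < δ) : (interior (cube a δ)).Nonempty := by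
  have ho : IsOpen {y : En n | ∀ i, a i < y i ∧ y i < a i + δ} := by
    have : {y : En n | ∀ i, a i < y i ∧ y i < a i + δ} = ⋂ i, {y : En n | a i < y i ∧ y i < a i + δ} := by
      ext; simp
    rw [this]
    apply isOpen_iInter_of_finite
    intro i
    have hc : Continuous (fun y : En n => y i) := (Sm.coord i).continuous
    exact (isOpen_lt continuous_const hc).inter (isOpen_lt hc continuous_const)
  refine ⟨WithLp.toLp 2 (fun i => a i + δ / 2), ?_⟩
  apply interior_maximal (s := cube a δ) (t := {y : En n | ∀ i, a i < y i ∧ y i < a i + δ}) _ ho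
  · intro i
    simp only
    constructor <;> linarith
  · intro y hy i
    exact ⟨(hy i).1.le, (hy i).2.le⟩

theorem cube_dist {a x y : En n} {δ : ℝ} (hx : x ∈ cube a δ) (hy : y ∈ cube a δ) : dist x y ≤ n * δ := by
  rw [EuclideanSpace.dist_eq]
  have h1 : ∀ i, dist (x i) (y i) ≤ δ := by
    intro i
    rw [Real.dist_eq, abs_le]
    have := hx i
    have := hy i
    constructor <;> linarith
  have h2 : ∑ i, dist (x i) (y i) ≤ n * δ := by
    calc ∑ i, dist (x i) (y i) ≤ ∑ i : Fin n, δ := Finset.sum_le_sum fun i _ => h1 i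
      _ = n * δ := by simp
  have h3 : ∑ i, dist (x i) (y i) ^ 2 ≤ (∑ i, dist (x i) (y i)) ^ 2 :=
    Finset.sum_sq_le_sq_sum_of_nonneg fun i _ => dist_nonneg
  calc √(∑ i, dist (x i) (y i) ^ 2) ≤ √((∑ i, dist (x i) (y i)) ^ 2) := Real.sqrt_le_sqrt h3
    _ = ∑ i, dist (x i) (y i) := Real.sqrt_sq (Finset.sum_nonneg fun i _ => dist_nonneg)
    _ ≤ _ := h2

theorem pd1W_iter {s : Set (En n)} (hs : UniqueDiffOn ℝ s) (i : Fin n) (a : ℕ) {f g : En n → ℝ} (hg : Sm g)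
    (h : Set.EqOn f g s) : Set.EqOn ((pd1W s i)^[a] f) ((pd1 i)^[a] g) s := by
  induction a generalizing f g with
  | zero => exact h
  | succ a ih =>
    rw [Function.iterate_succ_apply, Function.iterate_succ_apply]
    apply ih (hg.pd1 i)
    intro x hx
    simp only [pd1W, pd1]
    rw [fderivWithin_congr h (h hx), fderivWithin_eq_fderiv (hs x hx) (hg.diff x)]

theorem pdalphaW_eq {s : Set (En n)} (hs : UniqueDiffOn ℝ s) (α : Fin n → ℕ) {f : En n → ℝ} (hf : Sm f)
    {x : En n} (hx : x ∈ s) : pdalphaW s α f x = pdalpha α f x := by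
  have : ∀ L : List (Fin n), Set.EqOn (L.foldr (fun i g => (pd1W s i)^[α i] g) f)
      (L.foldr (fun i g => (pd1 i)^[α i] g) f) s := by
    intro L
    induction L with
    | nil => intro y _; rfl
    | cons i L ih =>
      rw [List.foldr_cons, List.foldr_cons]
      exact pd1W_iter hs i (α i) (hf.fold α L) ih
  exact this _ hx

theorem jetScalarW_eq {s : Set (En n)} (hs : UniqueDiffOn ℝ s) (m : ℕ) {f : En n → ℝ} (hf : Sm f)
    {x : En n} (hx : x ∈ s) : jetScalarW m s f x = jetScalar m f x := by
  unfold jetScalarW jetScalar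
  apply Finset.sum_congr rfl
  intro α _
  rw [pdalphaW_eq hs _ hf hx]

theorem odot_smul (k : ℕ) (x : En n) (c : ℝ) (p q : MvPolynomial (Fin n) ℝ) :
    odot k x p (c • q) = c • odot k x p q := by
  apply shp_inj (x := x)
  rw [shp_odot, map_smul, map_smul, shp_odot, mul_smul_comm, map_smul]

theorem pdalpha_smul (α : Fin n → ℕ) (c : ℝ) {f : En n → ℝ} (hf : Sm f) (x : En n) :
    pdalpha α (fun y => c * f y) x = c * pdalpha α f x := by
  have h := Tj_mul (Sm.const c) hf x
  have h2 := congrArg (MvPowerSeries.coeff (Finsupp.equivFunOnFinite.symm α)) h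
  rw [Tj_const, MvPowerSeries.coeff_C_mul, coeff_Tj, coeff_Tj, ← mul_div_assoc,
    div_left_inj' (fac_pos _).ne'] at h2
  exact h2

theorem jetScalar_smul (m : ℕ) (c : ℝ) {f : En n → ℝ} (hf : Sm f) (x : En n) :
    jetScalar m (fun y => c * f y) x = c • jetScalar m f x := by
  unfold jetScalar
  rw [Finset.smul_sum]
  apply Finset.sum_congr rfl
  intro α _
  rw [pdalpha_smul _ _ hf, MvPolynomial.smul_eq_C_mul, ← mul_assoc, ← map_mul, mul_div_assoc]

theorem polyPDval_smul (α : Fin n → ℕ) (c : ℝ) (p : MvPolynomial (Fin n) ℝ) (x : En n) :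
    polyPDval α (c • p) x = c * polyPDval α p x := by
  rw [polyPDval_eq, polyPDval_eq, map_smul, coeff_smul, smul_eq_mul]; ring

end Final

section Final2
open MvPolynomial
variable {n k D : ℕ}

def GG (E : Finset (En n)) (Γ : En n → ℝ → Set (Wv n D)) (M₀ : ℝ) (x : En n) (K : ℝ) : Set (Wv n D) :=
  {P | x ∈ E ∧ 0 < K ∧ M₀ • P ∈ Γ x (K * M₀)}

theorem GG_GH {E : Finset (En n)} {Γ : En n → ℝ → Set (Wv n D)} {Cw δmax M₀ : ℝ} (hn : 1 ≤ n) (hM : 0 < M₀)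
    (hδm : 0 < δmax) (hCw : 0 < Cw)
    (hS : IsShapeField k D E Γ) (hC : SFConvex k D E Γ Cw δmax) :
    GH k E (n * δmax) (max Cw 1 * (k + n + 1 : ℝ) ^ (k+1)) (GG E Γ M₀) := by
  obtain ⟨s1, s2, s3⟩ := hS
  have hn' : (1:ℝ) ≤ n := by exact_mod_cast hn
  have hk0 : (0:ℝ) ≤ k := by positivity
  set L : ℝ := k + n + 1 with hL
  have hL1 : 1 ≤ L := by linarith
  have hL0 : 0 < L := by linarith
  have hLn : (n:ℝ) ≤ L := by linarith
  have hLk : (k:ℝ) ≤ L := by linarith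
  have hdegG : ∀ x K P, P ∈ GG E Γ M₀ x K → DV k P := by
    rintro x K P ⟨h1, h2, h3⟩ j
    have h4 := Dk_iff.mpr (s2 x h1 _ (by positivity) _ h3 j)
    have h5 := h4.smul M₀⁻¹
    rwa [Pi.smul_apply, smul_smul, inv_mul_cancel₀ hM.ne', one_smul] at h5
  refine ⟨fun x => ⟨fun K => ?_, fun K K' hK P hP => ?_⟩, hdegG, fun x K P hP => hP.2.1, by positivity, ?_, ?_⟩
  · rintro P ⟨h1, h2, h3⟩ Q ⟨g1, g2, g3⟩ a b ha hb hab
    refine ⟨h1, h2, ?_⟩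
    have := s1 x h1 (K * M₀) (by positivity) h3 g3 ha hb hab
    rwa [smul_comm a, smul_comm b, ← smul_add] at this
  · obtain ⟨h1, h2, h3⟩ := hP
    exact ⟨h1, by linarith, s3 x h1 (K * M₀) (K' * M₀) (by positivity) (by nlinarith) h3⟩
  · exact one_le_mul_of_one_le_of_one_le (le_max_right _ _) (one_le_pow₀ hL1)
  · intro δ hδ hδm' x hx K P1 P2 hP1 hP2 hN Q1 Q2 hQ1 hQ2 hq1 hq2 hq
    have hd1 := hdegG _ _ _ hP1
    have hd2 := hdegG _ _ _ hP2
    obtain ⟨-, hK, hP1⟩ := hP1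
    obtain ⟨-, -, hP2⟩ := hP2
    have hLp : (1:ℝ) ≤ L ^ (k+1) := one_le_pow₀ hL1
    have hKM : 0 < K * M₀ := by positivity
    have hQ : ∀ Q : MvPolynomial (Fin n) ℝ, (∀ α : Mi k n, |coeff α.1 (shp x Q)| ≤ (δ ^ α.1.degree)⁻¹) →
        ∀ α : Fin n → ℕ, (∑ i, α i) ≤ k → |polyPDval α Q x| ≤ (δ / L) ^ (-((∑ i, α i : ℕ) : ℤ)) := by
      intro Q hQ α hα
      have h := hQ ⟨Finsupp.equivFunOnFinite.symm α, by rw [deg_symm]; exact hα⟩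
      simp only [deg_symm] at h
      have hf := fac_le_pow L k α hα hLk
      rw [polyPDval_eq, abs_mul, zpow_neg, zpow_natCast, div_pow, inv_div, div_eq_mul_inv,
        abs_of_nonneg (Finset.prod_nonneg fun i _ => by positivity)]
      exact mul_le_mul hf h (abs_nonneg _) (by positivity)
    have key := hC (δ / L) (by positivity) (by
        rw [div_le_iff₀ hL0]; nlinarith) x hx (K * M₀ * L ^ (k+1)) (by positivity) (M₀ • P1) (M₀ • P2)
      (s3 x hx (K * M₀) _ hKM (by nlinarith) hP1) (s3 x hx (K * M₀) _ hKM (by nlinarith) hP2) Q1 Q2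
      (Dk_iff.mp hQ1) (Dk_iff.mp hQ2) (by
        intro α hα j
        have h := hN ⟨⟨Finsupp.equivFunOnFinite.symm α, by rw [deg_symm]; exact hα⟩, j⟩
        rw [cc_apply, cf_of_Dk _ _ ((hd1.sub hd2) j)] at h
        simp only [dgI, deg_symm] at h
        have hf := fac_le_pow L k α hα hLk
        rw [Pi.smul_apply, Pi.smul_apply, ← smul_sub, polyPDval_smul, polyPDval_eq, abs_mul, abs_mul,
          abs_of_pos hM, abs_of_nonneg (Finset.prod_nonneg fun i _ => by positivity)]
        have e : K * M₀ * L ^ (k+1) * (δ / L) ^ (k + 1 - ∑ i, α i) =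
            M₀ * (L ^ (∑ i, α i) * (K * δ ^ (k + 1 - ∑ i, α i))) := by
          have : L ^ (k+1) = L ^ (∑ i, α i) * L ^ (k + 1 - ∑ i, α i) := by
            rw [← pow_add]; congr 1; omega
          rw [this, div_pow]; field_simp
        rw [e]
        apply mul_le_mul_of_nonneg_left _ hM.le
        exact mul_le_mul hf h (abs_nonneg _) (by positivity))
      (fun α hα => ⟨hQ Q1 hq1 α hα, hQ Q2 hq2 α hα⟩) hq
    refine ⟨hx, by positivity, ?_⟩
    have key2 := s3 x hx _ (max Cw 1 * L ^ (k+1) * K * M₀) (by positivity) (by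
      have : Cw ≤ max Cw 1 := le_max_left _ _
      have h2 := mul_le_mul_of_nonneg_right this (by positivity : 0 ≤ K * M₀ * L ^ (k+1))
      nlinarith) key
    convert key2 using 1
    funext j
    simp only [Pi.smul_apply, odot_smul, smul_add]

theorem FB_final {L : ℝ} (hn : 1 ≤ n) (hLn : (n:ℝ) ≤ L) (hLk : ((k+1 : ℕ):ℝ) ≤ L) {x : En n} {δ C M₀ : ℝ}
    (hδ : 0 < δ) (hC : 1 ≤ C) (hM : 0 < M₀)
    {f : En n → ℝ} {p : MvPolynomial (Fin n) ℝ} (hf : Sm f) (h : FB k x (n * δ) (f - pev p) C)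
    (α : Fin n → ℕ) (hα : ∑ i, α i ≤ k + 1) :
    |pdalpha α (fun y => M₀ * f y) x - polyPDval α (M₀ • p) x| ≤
      C * L ^ (k+1) * M₀ * δ ^ (k + 1 - ∑ i, α i) := by
  have h1 := h (Finsupp.equivFunOnFinite.symm α) (by rw [deg_symm]; exact hα)
  rw [deg_symm, Tj_sub hf (Sm.pev p), map_sub, coeff_Tj, coeff_Tj] at h1
  have e0 : (⇑(Finsupp.equivFunOnFinite.symm α) : Fin n → ℕ) = α := rfl
  rw [e0, pdalpha_pev, ← sub_div, abs_div, abs_of_pos (fac_pos _), div_le_iff₀ (fac_pos _)] at h1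
  rw [pdalpha_smul _ _ hf, polyPDval_smul, ← mul_sub, abs_mul, abs_of_pos hM]
  have hn' : (1:ℝ) ≤ n := by exact_mod_cast hn
  have hL1 : 1 ≤ L := by linarith
  have h2 : fac (Finsupp.equivFunOnFinite.symm α) ≤ L ^ (∑ i, α i) := fac_le_pow L (k+1) α hα hLk
  have h3 : (n * δ) ^ (k + 1 - ∑ i, α i) ≤ L ^ (k + 1 - ∑ i, α i) * δ ^ (k + 1 - ∑ i, α i) := by
    rw [← mul_pow]
    apply pow_le_pow_left₀ (by positivity)
    nlinarith
  have h4 : L ^ (k+1) = L ^ (∑ i, α i) * L ^ (k + 1 - ∑ i, α i) := by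
    rw [← pow_add]; congr 1; omega
  calc M₀ * |pdalpha α f x - polyPDval α p x|
      ≤ M₀ * (C * (n * δ) ^ (k + 1 - ∑ i, α i) * fac (Finsupp.equivFunOnFinite.symm α)) := by gcongr
    _ ≤ M₀ * (C * (L ^ (k + 1 - ∑ i, α i) * δ ^ (k + 1 - ∑ i, α i)) * L ^ (∑ i, α i)) := by
      have := (fac_pos (Finsupp.equivFunOnFinite.symm α)).le
      gcongr
    _ = _ := by rw [h4]; ring

end Final2

/-- **Finiteness principle for vector-valued shape fields** (Theorem 2.5): there is a
finiteness number `k♯ = k♯(m,n,D)` and, for each `C_w > 0`, a constant `C = C(m,n,D,C_w)`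
such that the shape field selection conclusion holds on a closed cube `Q₀`. -/
theorem shape_field_finiteness_principle
    (m n D : ℕ) (hm : 1 ≤ m) (hn : 1 ≤ n) (hD : 1 ≤ D) :
    ∃ ksharp : ℕ, ∀ Cw : ℝ, 0 < Cw → ∃ C : ℝ, 0 < C ∧
      ∀ δmax : ℝ, 0 < δmax →
      ∀ E : Finset (En n), ∀ Γ : En n → ℝ → Set (Fin D → MvPolynomial (Fin n) ℝ),
        IsShapeField (m - 1) D E Γ → SFConvex (m - 1) D E Γ Cw δmax →
        ∀ a : En n, ∀ δQ : ℝ, 0 < δQ → δQ ≤ δmax →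
        ∀ x₀ ∈ E, x₀ ∈ cube a δQ →
        ∀ M₀ : ℝ, 0 < M₀ →
        (∀ S : Finset (En n), S ⊆ E → S.card ≤ ksharp →
          ∃ P : En n → Fin D → MvPolynomial (Fin n) ℝ,
            (∀ z ∈ S, ∀ j, (P z j).totalDegree ≤ m - 1) ∧
            WSemiLE m S P M₀ ∧ (∀ z ∈ S, P z ∈ Γ z M₀)) →
        ∃ P0 ∈ Γ x₀ (C * M₀), ∃ F : En n → Fin D → ℝ,
          ContDiffOn ℝ m F (cube a δQ) ∧
          (∀ z ∈ E, z ∈ cube a δQ → jetDW m (cube a δQ) F z ∈ Γ z (C * M₀)) ∧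
          (∀ x ∈ cube a δQ, ∀ α : Fin n → ℕ, (∑ i, α i) ≤ m → ∀ j,
            |pdalphaW (cube a δQ) α (fun y => F y j) x - polyPDval α (P0 j) x|
              ≤ C * M₀ * δQ ^ (m - ∑ i, α i)) ∧
          (∀ x ∈ cube a δQ, ∀ α : Fin n → ℕ, (∑ i, α i) = m → ∀ j,
            |pdalphaW (cube a δQ) α (fun y => F y j) x| ≤ C * M₀) := by
  obtain ⟨k, rfl⟩ : ∃ k, m = k + 1 := ⟨m - 1, by omega⟩
  simp only [Nat.add_sub_cancel]
  refine ⟨kap k n D (lev k n D ∅ + 1), fun Cw hCw => ?_⟩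
  have hn' : (1:ℝ) ≤ n := by exact_mod_cast hn
  have hk0 : (0:ℝ) ≤ k := by positivity
  set L : ℝ := k + n + 1 with hL
  have hL1 : 1 ≤ L := by linarith
  have hLp : (1:ℝ) ≤ L ^ (k+1) := one_le_pow₀ hL1
  obtain ⟨A0, hA0, hA⟩ := mainLemma k n D (max Cw 1 * L ^ (k+1))
    (one_le_mul_of_one_le_of_one_le (le_max_right _ _) hLp) _ ∅
    (fun i β γ _ h => absurd h (Finset.notMem_empty _)) rfl 1 le_rfl
  obtain ⟨C, hC, hMLP⟩ := hA A0 le_rfl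
  have hCL : C ≤ C * L ^ (k+1) := by nlinarith
  have hC0 : 0 < C := by linarith
  refine ⟨C * L ^ (k+1), by positivity, ?_⟩
  intro δmax hδm E Γ hS hSF a δQ hδQ hδQm x₀ hx₀ hx₀c M₀ hM hyp
  have hG := GG_GH hn hM hδm hCw hS hSF
  obtain ⟨P0, hP0⟩ := Gl_nonempty hG (lev k n D ∅) (by
    intro S hSE hcard
    obtain ⟨P, p1, p2, p3⟩ := hyp S hSE hcard
    refine ⟨fun z => M₀⁻¹ • P z, fun z hz => ⟨hSE hz, one_pos, ?_⟩, fun z hz w hw β => ?_⟩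
    · show M₀ • M₀⁻¹ • P z ∈ _
      rw [smul_smul, mul_inv_cancel₀ hM.ne', one_smul, one_mul]; exact p3 z hz
    · by_cases hzw : z = w
      · subst hzw
        rw [sub_self, map_zero, abs_zero]; positivity
      · have dz : Dk k (P z β.2) := Dk_iff.mpr (p1 z hz β.2)
        have dw : Dk k (P w β.2) := Dk_iff.mpr (p1 w hw β.2)
        have h := p2 z hz w hw hzw β.1.1 (by
          have := β.1.2; rw [Finsupp.degree_eq_sum] at this; simpa using this) β.2
        have e : Finsupp.equivFunOnFinite.symm ⇑β.1.1 = β.1.1 := by ext; rfl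
        rw [polyPDval_eq, e, abs_mul, abs_of_nonneg (Finset.prod_nonneg fun i _ => by positivity)] at h
        rw [← smul_sub, map_smul, cc_apply, Pi.sub_apply, cf_of_Dk _ _ (dz.sub dw), smul_eq_mul, abs_mul,
          abs_of_pos (inv_pos.mpr hM), inv_mul_le_iff₀ hM, one_mul, dgI, Finsupp.degree_eq_sum]
        refine le_trans ?_ h
        exact le_mul_of_one_le_left (abs_nonneg _) (one_le_fac β.1.1)) hx₀
  obtain ⟨F, f1, f2, f3⟩ := hMLP E (n * δmax) _ hG x₀ hx₀ (n * δQ) (by positivity) (by gcongr) P0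
    ⟨le_rfl, hP0, fun α h => absurd h (Finset.notMem_empty _)⟩
  have hud : UniqueDiffOn ℝ (cube a δQ) := uniqueDiffOn_convex (cube_convex a δQ) (cube_interior a δQ hδQ)
  have hsm : ∀ j, Sm (fun y => M₀ * F j y) := fun j => (Sm.const M₀).mul (f1 j)
  have hP0G : P0 ∈ GG E Γ M₀ x₀ 1 := Gl_sub (Nat.zero_le _) hP0
  have hb : ∀ x ∈ cube a δQ, ∀ α : Fin n → ℕ, (∑ i, α i) ≤ k + 1 → ∀ j,
      |pdalphaW (cube a δQ) α (fun y => M₀ * F j y) x - polyPDval α ((M₀ • P0) j) x|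
        ≤ C * L ^ (k+1) * M₀ * δQ ^ (k + 1 - ∑ i, α i) := by
    intro x hx α hα j
    rw [pdalphaW_eq hud α (hsm j) hx]
    exact FB_final hn (by linarith) (by push_cast; linarith) hδQ hC hM (f1 j)
      (f3 x (cube_dist hx hx₀c) j) α hα
  refine ⟨M₀ • P0, ?_, fun y j => M₀ * F j y, ?_, ?_, hb, ?_⟩
  · refine hS.2.2 x₀ hx₀ (1 * M₀) _ (by positivity) ?_ hP0G.2.2
    apply mul_le_mul_of_nonneg_right _ hM.le
    linarith
  · apply ContDiff.contDiffOn
    rw [contDiff_pi]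
    intro j
    exact ContDiff.of_le (hsm j) (by exact_mod_cast le_top)
  · intro z hz hzc
    have h := f2 z hz (cube_dist hzc hx₀c)
    have e : jetDW (k+1) (cube a δQ) (fun y j => M₀ * F j y) z = M₀ • JV k z F := by
      funext j
      show jetScalarW (k+1) (cube a δQ) (fun y => M₀ * F j y) z = M₀ • jetScalar (k+1) (F j) z
      rw [jetScalarW_eq hud _ (hsm j) hzc, jetScalar_smul _ _ (f1 j)]
    rw [e]
    exact hS.2.2 z hz (C * M₀) _ (by positivity) (mul_le_mul_of_nonneg_right hCL hM.le) h.2.2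
  · intro x hx α hα j
    have h := hb x hx α hα.le j
    have h0 : polyPDval α ((M₀ • P0) j) x = 0 := by
      rw [polyPDval_eq, (((hG.deg _ _ _ hP0G).smul M₀) j).shp x _ (by rw [deg_symm]; omega), mul_zero]
    rw [h0, sub_zero, hα, Nat.sub_self, pow_zero, mul_one] at h
    exact h

end
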